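/- arXiv:0712.1398 — 2 statements merged into one kernel-verified Lean document; each statement's English description precedes it below -/
import Mathlib

section
/- Let g ⊆ so(V) be a Lie subalgebra (a faithful orthogonal representation (g,V)). Then there exist an orthogonal decomposition V = W₀ ⊕ W₁ ⊕ ⋯ ⊕ W_m and a direct sum decomposition of g into ideals g = h₀ ⊕ h₁ ⊕ ⋯ ⊕ h_m such that each hᵢ preserves Wᵢ and vanishes on Wⱼ for all j ≠ i, the skew-symmetric prolongation of (h₀, W₀) vanishes (the only T ∈ Λ³W₀ with T_X ∈ h₀|_{W₀} for all X ∈ W₀ is T = 0), and for each i ≥ 1 either hᵢ restricted to Wᵢ is the full algebra so(Wᵢ), or there is a Lie bracket on Wᵢ making Wᵢ a simple real Lie algebra with negative-definite Killing form, with ad-invariant inner product, and hᵢ|_{Wᵢ} = {ad_X : X ∈ Wᵢ} (the adjoint representation of a compact simple Lie algebra). -/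
open scoped RealInnerProductSpace BigOperators

noncomputable section

variable {V : Type} [NormedAddCommGroup V] [InnerProductSpace ℝ V] [FiniteDimensional ℝ V]

/-- A skew-symmetric endomorphism of a real inner product space. -/
def IsSkew (A : V →ₗ[ℝ] V) : Prop := ∀ x y : V, ⟪A x, y⟫ = - ⟪x, A y⟫

set_option linter.all false

/-- Lie algebras of skew endomorphisms. -/
structure LieSkew {E : Type} [NormedAddCommGroup E] [InnerProductSpace ℝ E]
    [FiniteDimensional ℝ E] (h : Submodule ℝ (E →ₗ[ℝ] E)) : Prop where
  skew : ∀ A ∈ h, IsSkew A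
  lie : ∀ A ∈ h, ∀ B ∈ h, A ∘ₗ B - B ∘ₗ A ∈ h

/-- Natural action on bilinear maps. -/
def act {E : Type} [NormedAddCommGroup E] [InnerProductSpace ℝ E]
    (A : E →ₗ[ℝ] E) (T : E →ₗ[ℝ] E →ₗ[ℝ] E) : E →ₗ[ℝ] E →ₗ[ℝ] E :=
  T.compr₂ A - T.comp A - T.compl₂ A

/-- The skew-symmetric prolongation, as bilinear maps. -/
def prol {E : Type} [NormedAddCommGroup E] [InnerProductSpace ℝ E]
    (h : Submodule ℝ (E →ₗ[ℝ] E)) : Submodule ℝ (E →ₗ[ℝ] E →ₗ[ℝ] E) where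
  carrier := {T | (∀ x, T x x = 0) ∧ ∀ x, T x ∈ h}
  add_mem' := by
    rintro S T ⟨h1, h2⟩ ⟨h3, h4⟩
    exact ⟨fun x => by simp [h1, h3], fun x => h.add_mem (h2 x) (h4 x)⟩
  zero_mem' := ⟨fun x => rfl, fun x => h.zero_mem⟩
  smul_mem' := by
    rintro c T ⟨h1, h2⟩
    exact ⟨fun x => by simp [h1], fun x => h.smul_mem c (h2 x)⟩

/-- Totally skew trilinear forms, as bilinear maps. -/
structure IsTri {E : Type} [NormedAddCommGroup E] [InnerProductSpace ℝ E]
    (T : E →ₗ[ℝ] E →ₗ[ℝ] E) : Prop where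
  alt : ∀ x, T x x = 0
  skew : ∀ x y z, ⟪T x y, z⟫ = - ⟪y, T x z⟫

/-- The Jacobi identity. -/
def Jac {E : Type} [NormedAddCommGroup E] [InnerProductSpace ℝ E]
    (T : E →ₗ[ℝ] E →ₗ[ℝ] E) : Prop :=
  ∀ x y z, T x (T y z) = T (T x y) z + T y (T x z)

/-- The endomorphism `x ∧ y`. -/
def wedge {E : Type} [NormedAddCommGroup E] [InnerProductSpace ℝ E] :
    E →ₗ[ℝ] E →ₗ[ℝ] E →ₗ[ℝ] E :=
  LinearMap.mk₂ ℝ (fun x y => (innerₛₗ ℝ x).smulRight y - (innerₛₗ ℝ y).smulRight x)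
    (fun a b c => by ext z; simp [add_smul]; abel)
    (fun c a b => by ext z; simp [mul_smul, smul_sub, smul_comm c])
    (fun a b c => by ext z; simp [add_smul]; abel)
    (fun c a b => by ext z; simp [mul_smul, smul_sub, smul_comm c])

section basics
variable {E : Type} [NormedAddCommGroup E] [InnerProductSpace ℝ E]

@[simp] theorem act_apply (A : E →ₗ[ℝ] E) (T : E →ₗ[ℝ] E →ₗ[ℝ] E) (x y : E) :
    act A T x y = A (T x y) - T (A x) y - T x (A y) := rfl

@[simp] theorem wedge_apply (x y z : E) : wedge x y z = ⟪x, z⟫ • y - ⟪y, z⟫ • x := rfl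

theorem act_eq_comm (A : E →ₗ[ℝ] E) (T : E →ₗ[ℝ] E →ₗ[ℝ] E) (x : E) :
    act A T x = (A ∘ₗ T x - T x ∘ₗ A) - T (A x) := by
  ext y; simp; abel

theorem wedge_swap (x y : E) : wedge x y = - wedge y x := by ext z; simp
theorem wedge_self (x : E) : wedge x x = 0 := by ext z; simp

theorem eq_of_inner {x y : E} (h : ∀ z, ⟪x, z⟫ = ⟪y, z⟫) : x = y := ext_inner_right ℝ h
theorem eq_zero_of_inner {x : E} (h : ∀ z, ⟪x, z⟫ = 0) : x = 0 :=
  ext_inner_right ℝ (fun z => by simp [h z])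

theorem act_add_left (A B : E →ₗ[ℝ] E) (T : E →ₗ[ℝ] E →ₗ[ℝ] E) :
    act (A + B) T = act A T + act B T := by ext x y; simp; abel
theorem act_sub_left (A B : E →ₗ[ℝ] E) (T : E →ₗ[ℝ] E →ₗ[ℝ] E) :
    act (A - B) T = act A T - act B T := by ext x y; simp; abel
theorem act_smul_left (c : ℝ) (A : E →ₗ[ℝ] E) (T : E →ₗ[ℝ] E →ₗ[ℝ] E) :
    act (c • A) T = c • act A T := by ext x y; simp [smul_sub]
theorem act_add_right (A : E →ₗ[ℝ] E) (S T : E →ₗ[ℝ] E →ₗ[ℝ] E) :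
    act A (S + T) = act A S + act A T := by ext x y; simp; abel
theorem act_smul_right (c : ℝ) (A : E →ₗ[ℝ] E) (T : E →ₗ[ℝ] E →ₗ[ℝ] E) :
    act A (c • T) = c • act A T := by ext x y; simp [smul_sub]
theorem act_comm (A B : E →ₗ[ℝ] E) (T : E →ₗ[ℝ] E →ₗ[ℝ] E) :
    act (A ∘ₗ B - B ∘ₗ A) T = act A (act B T) - act B (act A T) := by
  ext x y; simp; abel

theorem IsTri.swap {T : E →ₗ[ℝ] E →ₗ[ℝ] E} (hT : IsTri T) (x y : E) : T x y = - T y x := by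
  have := hT.alt (x + y)
  simp [hT.alt] at this
  exact eq_neg_of_add_eq_zero_left this

theorem IsTri.cyc {T : E →ₗ[ℝ] E →ₗ[ℝ] E} (hT : IsTri T) (x y z : E) :
    ⟪T x y, z⟫ = ⟪T y z, x⟫ := by
  rw [hT.swap x y, inner_neg_left, hT.skew y x z, neg_neg, real_inner_comm]

theorem IsTri.skew' {T : E →ₗ[ℝ] E →ₗ[ℝ] E} (hT : IsTri T) (x y z : E) :
    ⟪y, T x z⟫ = - ⟪T x y, z⟫ := by rw [hT.skew, neg_neg]

theorem IsTri.inner_self {T : E →ₗ[ℝ] E →ₗ[ℝ] E} (hT : IsTri T) (x y : E) :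
    ⟪T x y, y⟫ = 0 := by
  have := hT.skew x y y
  rw [real_inner_comm (T x y) y] at this; linarith

theorem IsTri.inner_self' {T : E →ₗ[ℝ] E →ₗ[ℝ] E} (hT : IsTri T) (x y : E) :
    ⟪T x y, x⟫ = 0 := by rw [hT.swap, inner_neg_left, hT.inner_self, neg_zero]

variable [FiniteDimensional ℝ E]

theorem IsSkew.inner_self {A : E →ₗ[ℝ] E} (hA : IsSkew A) (x : E) : ⟪A x, x⟫ = 0 := by
  have := hA x x
  rw [real_inner_comm (A x) x] at this; linarith

theorem IsSkew.sq {A : E →ₗ[ℝ] E} (hA : IsSkew A) (x : E) : ⟪A (A x), x⟫ = - ‖A x‖ ^ 2 := by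
  rw [hA, real_inner_self_eq_norm_sq]

theorem IsSkew.sub {A B : E →ₗ[ℝ] E} (hA : IsSkew A) (hB : IsSkew B) : IsSkew (A - B) := by
  intro x y; simp [inner_sub_left, inner_sub_right, hA x y, hB x y]; ring
theorem IsSkew.add {A B : E →ₗ[ℝ] E} (hA : IsSkew A) (hB : IsSkew B) : IsSkew (A + B) := by
  intro x y; simp [inner_add_left, inner_add_right, hA x y, hB x y]; ring

theorem IsSkew.eq_zero_of_sq {A : E →ₗ[ℝ] E} (hA : IsSkew A) {x : E} (h : A (A x) = 0) :
    A x = 0 := by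
  have := hA.sq x
  rw [h] at this; simp at this; exact this

theorem IsTri.isSkew {T : E →ₗ[ℝ] E →ₗ[ℝ] E} (hT : IsTri T) (x : E) : IsSkew (T x) :=
  fun y z => hT.skew x y z

theorem LieSkew.isTri {h : Submodule ℝ (E →ₗ[ℝ] E)} (hh : LieSkew h) {T : E →ₗ[ℝ] E →ₗ[ℝ] E} (hT : T ∈ prol h) : IsTri T :=
  ⟨hT.1, fun x y z => hh.skew _ (hT.2 x) y z⟩

theorem LieSkew.act_mem {h : Submodule ℝ (E →ₗ[ℝ] E)} (hh : LieSkew h) {T : E →ₗ[ℝ] E →ₗ[ℝ] E} (hT : T ∈ prol h) {A : E →ₗ[ℝ] E} (hA : A ∈ h) :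
    act A T ∈ prol h := by
  refine ⟨fun x => ?_, fun x => ?_⟩
  · have ht := hh.isTri hT
    simp only [act_apply, ht.alt, map_zero]
    rw [ht.swap (A x) x]; abel
  · rw [act_eq_comm]
    exact h.sub_mem (hh.lie _ hA _ (hT.2 x)) (hT.2 _)

theorem isSkew_wedge (x y : E) : IsSkew (wedge x y) := by
  intro z w
  simp [inner_sub_left, inner_sub_right, inner_smul_left, inner_smul_right]
  rw [real_inner_comm z x, real_inner_comm z y]; ring

theorem comm_wedge {C : E →ₗ[ℝ] E} (hC : IsSkew C) (a b : E) :
    C ∘ₗ wedge a b - wedge a b ∘ₗ C = wedge (C a) b + wedge a (C b) := by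
  ext z
  simp [hC a z, hC b z]
  abel

end basics

section sums
variable {E : Type} [NormedAddCommGroup E] [InnerProductSpace ℝ E] [FiniteDimensional ℝ E]
  {ι : Type} [Fintype ι] (b : OrthonormalBasis ι ℝ E)

theorem sum_skew {M : Type*} [AddCommGroup M] [Module ℝ M] {A : E →ₗ[ℝ] E} (hA : ∀ x y : E, ⟪A x, y⟫ = - ⟪x, A y⟫)
    (f : E →ₗ[ℝ] E →ₗ[ℝ] M) : ∑ i, f (A (b i)) (b i) = - ∑ i, f (b i) (A (b i)) := by
  have h1 : ∀ i, f (A (b i)) (b i) = ∑ j, ⟪b j, A (b i)⟫ • f (b j) (b i) := by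
    intro i
    conv_lhs => rw [← b.sum_repr' (A (b i))]
    simp
  have h2 : ∀ i, f (b i) (A (b i)) = ∑ j, ⟪b j, A (b i)⟫ • f (b i) (b j) := by
    intro i
    conv_lhs => rw [← b.sum_repr' (A (b i))]
    simp
  simp only [h1, h2]
  rw [Finset.sum_comm, ← Finset.sum_neg_distrib]
  refine Finset.sum_congr rfl fun i _ => ?_
  rw [← Finset.sum_neg_distrib]
  refine Finset.sum_congr rfl fun j _ => ?_
  rw [← neg_smul, ← hA, real_inner_comm]

theorem trace_comp_comm (A B : E →ₗ[ℝ] E) :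
    LinearMap.trace ℝ E (A ∘ₗ B) = LinearMap.trace ℝ E (B ∘ₗ A) := LinearMap.trace_comp_comm' B A

theorem trace_sq_skew {A : E →ₗ[ℝ] E} (hA : IsSkew A) :
    LinearMap.trace ℝ E (A ∘ₗ A) = - ∑ i, ‖A (b i)‖ ^ 2 := by
  rw [LinearMap.trace_eq_sum_inner _ b, ← Finset.sum_neg_distrib]
  refine Finset.sum_congr rfl fun i _ => ?_
  rw [real_inner_comm]; exact hA.sq _

theorem trace_sq_skew_neg {A : E →ₗ[ℝ] E} (hA : IsSkew A) (h0 : A ≠ 0) :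
    LinearMap.trace ℝ E (A ∘ₗ A) < 0 := by
  let b := stdOrthonormalBasis ℝ E
  rw [trace_sq_skew b hA]
  have : ∃ i, A (b i) ≠ 0 := by
    by_contra hc
    push Not at hc
    exact h0 (b.toBasis.ext fun i => by simp [hc i])
  obtain ⟨i, hi⟩ := this
  have : 0 < ∑ i, ‖A (b i)‖ ^ 2 :=
    Finset.sum_pos' (fun _ _ => by positivity) ⟨i, Finset.mem_univ _, by positivity⟩
  linarith

end sums

theorem exists_min_nat {α : Type*} (p : α → Prop) (f : α → ℕ) (h : ∃ a, p a) :
    ∃ a, p a ∧ ∀ b, p b → f a ≤ f b := by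
  classical
  have h' : ∃ n, ∃ a, p a ∧ f a = n := by
    obtain ⟨a, ha⟩ := h; exact ⟨_, a, ha, rfl⟩
  obtain ⟨a, ha, hn⟩ := Nat.find_spec h'
  exact ⟨a, ha, fun b hb => hn ▸ Nat.find_min' h' ⟨b, hb, rfl⟩⟩

theorem exists_max_nat {α : Type*} (p : α → Prop) (f : α → ℕ) (N : ℕ) (hN : ∀ a, p a → f a ≤ N)
    (h : ∃ a, p a) : ∃ a, p a ∧ ∀ b, p b → f b ≤ f a := by
  obtain ⟨a, ha, hm⟩ := exists_min_nat p (fun a => N - f a) h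
  refine ⟨a, ha, fun b hb => ?_⟩
  have := hm b hb; have := hN a ha; have := hN b hb
  omega

section proj
variable {E : Type} [NormedAddCommGroup E] [InnerProductSpace ℝ E] [FiniteDimensional ℝ E]

/-- Orthogonal projection as an endomorphism. -/
def pr (U : Submodule ℝ E) : E →ₗ[ℝ] E := (U.starProjection : E →L[ℝ] E)

theorem pr_mem (U : Submodule ℝ E) (x : E) : pr U x ∈ U := U.starProjection_apply_mem x
theorem sub_pr_mem (U : Submodule ℝ E) (x : E) : x - pr U x ∈ Uᗮ :=
  Submodule.sub_starProjection_mem_orthogonal x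
theorem pr_of_mem {U : Submodule ℝ E} {x : E} (hx : x ∈ U) : pr U x = x :=
  Submodule.starProjection_eq_self_iff.2 hx
theorem pr_of_orth {U : Submodule ℝ E} {x : E} (hx : x ∈ Uᗮ) : pr U x = 0 :=
  (Submodule.starProjection_apply_eq_zero_iff U).2 hx
theorem pr_inner (U : Submodule ℝ E) (x y : E) : ⟪pr U x, y⟫ = ⟪x, pr U y⟫ :=
  Submodule.inner_starProjection_left_eq_right U x y
theorem pr_pr (U : Submodule ℝ E) (x : E) : pr U (pr U x) = pr U x := pr_of_mem (pr_mem U x)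
theorem inner_orth {U : Submodule ℝ E} {x y : E} (hx : x ∈ U) (hy : y ∈ Uᗮ) : ⟪x, y⟫ = 0 :=
  (Submodule.mem_orthogonal U y).1 hy x hx
theorem inner_orth' {U : Submodule ℝ E} {x y : E} (hx : x ∈ U) (hy : y ∈ Uᗮ) : ⟪y, x⟫ = 0 := by
  rw [real_inner_comm]; exact inner_orth hx hy
theorem mem_of_orth {U : Submodule ℝ E} {x : E} (h : ∀ z ∈ Uᗮ, ⟪x, z⟫ = 0) : x ∈ U := by
  rw [← Submodule.orthogonal_orthogonal U, Submodule.mem_orthogonal]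
  intro z hz; rw [real_inner_comm]; exact h z hz
theorem mem_orth {U : Submodule ℝ E} {x : E} (h : ∀ z ∈ U, ⟪x, z⟫ = 0) : x ∈ Uᗮ := by
  rw [Submodule.mem_orthogonal]; intro z hz; rw [real_inner_comm]; exact h z hz

theorem exists_riesz (f : E →ₗ[ℝ] ℝ) : ∃ b : E, ∀ x, ⟪b, x⟫ = f x := by
  let e := stdOrthonormalBasis ℝ E
  refine ⟨∑ i, f (e i) • e i, fun x => ?_⟩
  conv_rhs => rw [← e.sum_repr' x]
  simp [sum_inner, inner_smul_left, mul_comm]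

theorem exists_eig {F : Submodule ℝ E} (hF : F ≠ ⊥) {S : E →ₗ[ℝ] E}
    (hS : ∀ x y, ⟪S x, y⟫ = ⟪x, S y⟫) (hSF : ∀ x ∈ F, S x ∈ F) :
    ∃ c : ℝ, ∃ e ∈ F, e ≠ 0 ∧ S e = c • e := by
  have hsym : S.IsSymmetric := hS
  have hr := hsym.restrict_invariant hSF
  haveI : Nontrivial F := (Submodule.nontrivial_iff_ne_bot).2 hF
  obtain ⟨v, hv⟩ := (hr.hasEigenvalue_iSup_of_finiteDimensional).exists_hasEigenvector
  have := congrArg (Subtype.val) hv.apply_eq_smul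
  exact ⟨_, v, v.2, by simpa using hv.2, this⟩

theorem exists_ne_of_ne_bot {F : Submodule ℝ E} (hF : F ≠ ⊥) : ∃ x ∈ F, x ≠ 0 :=
  (Submodule.ne_bot_iff F).1 hF

end proj

/-- `T` is the bracket of a simple compact Lie algebra on `U`, extended by zero. -/
structure Simp {E : Type} [NormedAddCommGroup E] [InnerProductSpace ℝ E]
    (T : E →ₗ[ℝ] E →ₗ[ℝ] E) (U : Submodule ℝ E) : Prop where
  tri : IsTri T
  jac : Jac T
  ker : ∀ x ∈ Uᗮ, T x = 0
  ne : T ≠ 0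
  simp : ∀ J ≤ U, (∀ x, ∀ y ∈ J, T x y ∈ J) → J = ⊥ ∨ J = U

section simp
variable {E : Type} [NormedAddCommGroup E] [InnerProductSpace ℝ E] [FiniteDimensional ℝ E]
  {T : E →ₗ[ℝ] E →ₗ[ℝ] E} {U : Submodule ℝ E}

theorem Simp.mem (hT : Simp T U) (x y : E) : T x y ∈ U :=
  mem_of_orth fun z hz => by rw [← hT.tri.cyc, hT.ker z hz]; simp

theorem Simp.pr_left (hT : Simp T U) (x : E) : T (pr U x) = T x := by
  have := hT.ker _ (sub_pr_mem U x)
  rw [map_sub, sub_eq_zero] at this; exact this.symm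

theorem Simp.pr_right (hT : Simp T U) (x y : E) : T x (pr U y) = T x y := by
  rw [hT.tri.swap, hT.pr_left, ← hT.tri.swap]

theorem Simp.inj (hT : Simp T U) {x : E} (hx : x ∈ U) (h : T x = 0) : x = 0 := by
  have := hT.simp (U ⊓ LinearMap.ker T) inf_le_left (by
    rintro y z ⟨hz, hz'⟩
    have : T z = 0 := hz'
    rw [hT.tri.swap, this]; simp)
  rcases this with h1 | h1
  · have : x ∈ U ⊓ LinearMap.ker T := ⟨hx, h⟩
    rw [h1] at this; simpa using this
  · exfalso; apply hT.ne
    ext1 y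
    rw [← hT.pr_left]
    have : pr U y ∈ U ⊓ LinearMap.ker T := h1.ge (pr_mem U y)
    exact this.2

theorem Simp.ne_bot (hT : Simp T U) : U ≠ ⊥ := by
  rintro rfl
  exact hT.ne (by ext1 x; exact hT.ker x (by simp))

theorem Simp.schur_sym (hT : Simp T U) {S : E →ₗ[ℝ] E} (hS : ∀ x y, ⟪S x, y⟫ = ⟪x, S y⟫)
    (hSU : ∀ x ∈ U, S x ∈ U) (hc : ∀ x, ∀ y ∈ U, S (T x y) = T x (S y)) :
    ∃ c : ℝ, ∀ x ∈ U, S x = c • x := by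
  obtain ⟨c, e, he, he0, hec⟩ := exists_eig hT.ne_bot hS hSU
  refine ⟨c, ?_⟩
  have := hT.simp (U ⊓ LinearMap.ker (S - c • LinearMap.id)) inf_le_left (by
    rintro x y ⟨hy, hy'⟩
    refine ⟨hT.mem _ _, ?_⟩
    simp [sub_eq_zero] at hy' ⊢
    rw [hc x y hy, hy']; simp)
  rcases this with h1 | h1
  · have : e ∈ U ⊓ LinearMap.ker (S - c • LinearMap.id) := ⟨he, by simp [hec]⟩
    rw [h1] at this; exact absurd (by simpa using this) he0
  · intro x hx
    have : x ∈ U ⊓ LinearMap.ker (S - c • LinearMap.id) := h1.ge hx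
    have := this.2
    simpa [sub_eq_zero] using this

theorem Simp.schur_skew (hT : IsTri T) {φ : E →ₗ[ℝ] E} (hφ : IsSkew φ)
    (hc : ∀ x y, φ (T x y) = T x (φ y)) (x : E) : T (φ x) = 0 := by
  have key : ∀ x y, T (φ x) y = φ (T x y) := by
    intro x y
    rw [hT.swap, ← hc, hT.swap y x]; simp
  ext y
  apply eq_zero_of_inner
  intro z
  have h1 : ⟪T (φ x) y, z⟫ = ⟪y, T (φ x) z⟫ := by
    rw [key, hφ, hT.skew, neg_neg, ← hc, key]
  have h2 := hT.skew (φ x) y z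
  linarith

theorem Simp.schur (hT : Simp T U) {ψ : E →ₗ[ℝ] E} (hm : ∀ x, ψ x ∈ U) (hk : ∀ x ∈ Uᗮ, ψ x = 0)
    (hc : ∀ x y, ψ (T x y) = T x (ψ y)) : ∃ c : ℝ, ∀ x ∈ U, ψ x = c • x := by
  let χ := LinearMap.adjoint ψ
  have hχ : ∀ x y, ⟪χ x, y⟫ = ⟪x, ψ y⟫ := fun x y => LinearMap.adjoint_inner_left ψ y x
  have hχ' : ∀ x y, ⟪x, χ y⟫ = ⟪ψ x, y⟫ := fun x y => LinearMap.adjoint_inner_right ψ x y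
  have hmχ : ∀ x, χ x ∈ U := fun x => mem_of_orth fun z hz => by rw [hχ, hk z hz]; simp
  have hcχ : ∀ x y, χ (T x y) = T x (χ y) := by
    intro x y
    apply eq_of_inner; intro z
    rw [hχ, hT.tri.skew, ← hc, hT.tri.skew, hχ]
  have hskew := Simp.schur_skew hT.tri (φ := ψ - χ)
    (by intro x y; simp [inner_sub_left, inner_sub_right, hχ, hχ'])
    (by intro x y; simp [hc, hcχ])
  have hz : ∀ x, ψ x = χ x := by
    intro x
    have := hT.inj (U.sub_mem (hm x) (hmχ x)) (by simpa using hskew x)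
    exact sub_eq_zero.1 this
  refine hT.schur_sym (S := ψ) (fun x y => by rw [hz, hχ]) (fun x _ => hm x) (fun x y _ => hc x y)

/-- composition as a bilinear map -/
def comp2 (T : E →ₗ[ℝ] E →ₗ[ℝ] E) (A : E →ₗ[ℝ] E) : E →ₗ[ℝ] E →ₗ[ℝ] E →ₗ[ℝ] E :=
  LinearMap.mk₂ ℝ (fun u v => T u ∘ₗ A ∘ₗ T v)
    (fun a b c => by ext z; simp) (fun a b c => by ext z; simp)
    (fun a b c => by ext z; simp) (fun a b c => by ext z; simp)

theorem comp2_apply (T : E →ₗ[ℝ] E →ₗ[ℝ] E) (A : E →ₗ[ℝ] E) (u v y : E) :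
    comp2 T A u v y = T u (A (T v y)) := rfl

/-- Casimir operator -/
def casimir (T : E →ₗ[ℝ] E →ₗ[ℝ] E) : E →ₗ[ℝ] E :=
  ∑ i, comp2 T LinearMap.id (stdOrthonormalBasis ℝ E i) (stdOrthonormalBasis ℝ E i)

theorem casimir_apply (T : E →ₗ[ℝ] E →ₗ[ℝ] E) (y : E) : casimir T y =
    ∑ i, T (stdOrthonormalBasis ℝ E i) (T (stdOrthonormalBasis ℝ E i) y) := by
  simp [casimir, comp2_apply]

theorem casimir_inner (hT : IsTri T) (x y : E) : ⟪casimir T x, y⟫ =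
    - ∑ i, ⟪T (stdOrthonormalBasis ℝ E i) x, T (stdOrthonormalBasis ℝ E i) y⟫ := by
  rw [casimir_apply, sum_inner, ← Finset.sum_neg_distrib]
  exact Finset.sum_congr rfl fun i _ => hT.skew _ _ _

theorem trace_eq_casimir (hT : IsTri T) (x y : E) :
    LinearMap.trace ℝ E (T x ∘ₗ T y) = ⟪casimir T x, y⟫ := by
  rw [LinearMap.trace_eq_sum_inner _ (stdOrthonormalBasis ℝ E), casimir_inner hT,
    ← Finset.sum_neg_distrib]
  refine Finset.sum_congr rfl fun i _ => ?_
  rw [LinearMap.comp_apply, hT.skew', hT.swap x, hT.swap y]; simp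

theorem casimir_comm (hT : IsTri T) (hJ : Jac T) (x y : E) :
    casimir T (T x y) = T x (casimir T y) := by
  simp only [casimir_apply, map_sum]
  have h1 := sum_skew (stdOrthonormalBasis ℝ E) (hT.isSkew x) (comp2 T LinearMap.id)
  have h2 := congrArg (fun f => f y) h1
  simp only [LinearMap.sum_apply, LinearMap.neg_apply, comp2_apply, LinearMap.id_apply] at h2
  have : ∀ i, T x (T (stdOrthonormalBasis ℝ E i) (T (stdOrthonormalBasis ℝ E i) y)) =
      T (T x (stdOrthonormalBasis ℝ E i)) (T (stdOrthonormalBasis ℝ E i) y) +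
      T (stdOrthonormalBasis ℝ E i) (T (T x (stdOrthonormalBasis ℝ E i)) y) +
      T (stdOrthonormalBasis ℝ E i) (T (stdOrthonormalBasis ℝ E i) (T x y)) := by
    intro i
    rw [hJ x, hJ x _ y, map_add, add_assoc]
  rw [Finset.sum_congr rfl fun i _ => this i, Finset.sum_add_distrib, Finset.sum_add_distrib, h2]
  simp

theorem Simp.casimir (hT : Simp T U) : ∃ c : ℝ, 0 < c ∧ ∀ x, casimir T x = - c • pr U x := by
  have hs : ∀ x y, ⟪_root_.casimir T x, y⟫ = ⟪x, _root_.casimir T y⟫ := by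
    intro x y
    rw [casimir_inner hT.tri, real_inner_comm _ x, casimir_inner hT.tri]
    simp only [real_inner_comm]
  obtain ⟨c, hc⟩ := hT.schur_sym (S := _root_.casimir T) hs
    (fun x _ => by rw [casimir_apply]; exact U.sum_mem fun i _ => hT.mem _ _)
    (fun x y _ => casimir_comm hT.tri hT.jac x y)
  have hpr : ∀ x, _root_.casimir T x = c • pr U x := by
    intro x
    rw [← hc _ (pr_mem U x)]
    simp only [casimir_apply, hT.pr_right]
  refine ⟨-c, ?_, fun x => by simp [hpr]⟩
  obtain ⟨y, hy, hy0⟩ := exists_ne_of_ne_bot hT.ne_bot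
  have h0 : T y ≠ 0 := fun h => hy0 (hT.inj hy h)
  have h1 := trace_sq_skew_neg (hT.tri.isSkew y) h0
  rw [trace_eq_casimir hT.tri, hpr, pr_of_mem hy, inner_smul_left, real_inner_self_eq_norm_sq] at h1
  simp at h1
  have : 0 < ‖y‖ ^ 2 := by positivity
  nlinarith

theorem trace3_skew {A B C : E →ₗ[ℝ] E} (hA : IsSkew A) (hB : IsSkew B) (hC : IsSkew C) :
    LinearMap.trace ℝ E (A ∘ₗ B ∘ₗ C) = - LinearMap.trace ℝ E (C ∘ₗ B ∘ₗ A) := by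
  rw [LinearMap.trace_eq_sum_inner _ (stdOrthonormalBasis ℝ E),
    LinearMap.trace_eq_sum_inner _ (stdOrthonormalBasis ℝ E), ← Finset.sum_neg_distrib]
  refine Finset.sum_congr rfl fun i _ => ?_
  simp only [LinearMap.comp_apply]
  rw [real_inner_comm, hA, hB, hC, neg_neg]

theorem Jac.comm (hJ : Jac T) (y z : E) : T y ∘ₗ T z - T z ∘ₗ T y = T (T y z) := by
  ext w; simp [hJ y z w]

/-- `∑ Tᵢ A Tᵢ` lies in the image of `T`. -/
theorem sum_TAT (hT : IsTri T) (hJ : Jac T) {A : E →ₗ[ℝ] E} (hA : IsSkew A) :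
    ∃ b, (∀ x, ⟪b, x⟫ = LinearMap.trace ℝ E (A ∘ₗ T x)) ∧
      ∑ i, comp2 T A (stdOrthonormalBasis ℝ E i) (stdOrthonormalBasis ℝ E i)
        = (1 / 2 : ℝ) • T b := by
  obtain ⟨b, hb⟩ := exists_riesz (LinearMap.trace ℝ E ∘ₗ (LinearMap.llcomp ℝ E E E A) ∘ₗ T)
  refine ⟨b, fun x => hb x, ?_⟩
  have hb' : ∀ x, ⟪b, x⟫ = LinearMap.trace ℝ E (A ∘ₗ T x) := fun x => hb x
  ext y
  apply eq_of_inner; intro z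
  have h1 : ⟪(∑ i, comp2 T A (stdOrthonormalBasis ℝ E i) (stdOrthonormalBasis ℝ E i)) y, z⟫ =
      LinearMap.trace ℝ E (T z ∘ₗ A ∘ₗ T y) := by
    rw [LinearMap.trace_eq_sum_inner _ (stdOrthonormalBasis ℝ E), LinearMap.sum_apply, sum_inner]
    refine Finset.sum_congr rfl fun i _ => ?_
    rw [comp2_apply]; simp only [LinearMap.comp_apply]
    rw [hT.skew (stdOrthonormalBasis ℝ E i), hT.skew' z, hT.swap z (stdOrthonormalBasis ℝ E i),
      hT.swap y (stdOrthonormalBasis ℝ E i), real_inner_comm]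
    simp
  have h2 : LinearMap.trace ℝ E (T z ∘ₗ A ∘ₗ T y) = LinearMap.trace ℝ E (A ∘ₗ T y ∘ₗ T z) := by
    rw [trace_comp_comm]; rfl
  have h3 : LinearMap.trace ℝ E (T z ∘ₗ A ∘ₗ T y) = - LinearMap.trace ℝ E (A ∘ₗ T z ∘ₗ T y) := by
    rw [trace3_skew (hT.isSkew z) hA (hT.isSkew y), trace_comp_comm]; rfl
  have h4 : ⟪b, T y z⟫ = LinearMap.trace ℝ E (A ∘ₗ T y ∘ₗ T z) -
      LinearMap.trace ℝ E (A ∘ₗ T z ∘ₗ T y) := by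
    rw [hb', ← hJ.comm, LinearMap.comp_sub, map_sub]
  have h5 : ⟪T b y, z⟫ = ⟪b, T y z⟫ := by rw [hT.cyc, real_inner_comm]
  rw [h1, LinearMap.smul_apply, inner_smul_left, h5, h4]
  simp
  linarith

theorem Simp.derGen (hT : Simp T U) {A : E →ₗ[ℝ] E} (hA : IsSkew A) (hAU : ∀ x ∈ Uᗮ, A x = 0)
    (hd : ∀ y, ∃ w, A ∘ₗ T y - T y ∘ₗ A = T w) : ∃ x, A = T x := by
  obtain ⟨b, hb⟩ := exists_riesz (LinearMap.trace ℝ E ∘ₗ (LinearMap.llcomp ℝ E E E A) ∘ₗ T)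
  have hb' : ∀ x, ⟪b, x⟫ = LinearMap.trace ℝ E (A ∘ₗ T x) := fun x => hb x
  obtain ⟨c, hc, hcas⟩ := hT.casimir
  set x := (-c⁻¹) • b with hx
  refine ⟨x, ?_⟩
  set A' := A - T x with hA'
  have htr : ∀ y, LinearMap.trace ℝ E (A' ∘ₗ T y) = 0 := by
    intro y
    rw [hA', LinearMap.sub_comp, map_sub, ← hb', trace_eq_casimir hT.tri, hcas, inner_smul_left,
      pr_inner, hx, inner_smul_left]
    have : ⟪b, pr U y⟫ = ⟪b, y⟫ := by rw [hb', hb', hT.pr_left]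
    rw [this]
    simp
    field_simp
    ring
  have hskew : IsSkew A' := hA.sub (hT.tri.isSkew x)
  have hcomm : ∀ y, A' ∘ₗ T y - T y ∘ₗ A' = 0 := by
    intro y
    obtain ⟨w, hw⟩ := hd y
    have h1 : A' ∘ₗ T y - T y ∘ₗ A' = T (w - T x y) := by
      rw [map_sub, ← hw, ← hT.jac.comm, hA', LinearMap.sub_comp, LinearMap.comp_sub]; abel
    rw [h1]
    by_contra hne
    have h2 := trace_sq_skew_neg (hT.tri.isSkew (w - T x y)) hne
    have h3 : LinearMap.trace ℝ E (T (w - T x y) ∘ₗ T (w - T x y)) = 0 := by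
      set z := w - T x y
      calc LinearMap.trace ℝ E (T z ∘ₗ T z) = LinearMap.trace ℝ E ((A' ∘ₗ T y - T y ∘ₗ A') ∘ₗ T z) := by
            rw [h1]
        _ = LinearMap.trace ℝ E (A' ∘ₗ (T y ∘ₗ T z)) - LinearMap.trace ℝ E (T y ∘ₗ (A' ∘ₗ T z)) := by
            rw [LinearMap.sub_comp, map_sub]; rfl
        _ = LinearMap.trace ℝ E (A' ∘ₗ (T y ∘ₗ T z)) - LinearMap.trace ℝ E (A' ∘ₗ (T z ∘ₗ T y)) := by
            rw [trace_comp_comm (T y)]; rfl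
        _ = LinearMap.trace ℝ E (A' ∘ₗ T (T y z)) := by
            rw [← hT.jac.comm y z, LinearMap.comp_sub, (LinearMap.trace ℝ E).map_sub]
        _ = 0 := htr _
    linarith
  have h5 : ∀ y, T (A' y) = 0 := Simp.schur_skew hT.tri hskew (fun u v => by
    have := congrArg (fun f => f v) (hcomm u)
    simpa [sub_eq_zero] using this)
  rw [← sub_eq_zero, ← hA']
  ext y
  refine hT.inj (mem_of_orth fun z hz => ?_) (h5 y)
  rw [hskew, hA', LinearMap.sub_apply, hAU z hz, hT.tri.swap, hT.ker z hz]; simp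

theorem simple_ideal {h : Submodule ℝ (E →ₗ[ℝ] E)} (hh : LieSkew h) {T : E →ₗ[ℝ] E →ₗ[ℝ] E}
    (hT : T ∈ prol h) (hJ : Jac T) (h0 : T ≠ 0) :
    ∃ (T1 : E →ₗ[ℝ] E →ₗ[ℝ] E) (U1 : Submodule ℝ E), T1 ∈ prol h ∧ Simp T1 U1 ∧
      (∀ x, T x = 0 → T1 x = 0) ∧ (∀ x, T x = 0 → x ∈ U1ᗮ) ∧ ∀ y ∈ U1, ∀ z, T1 y z = T y z := by
  have ht := hh.isTri hT
  set M := (LinearMap.ker T)ᗮ with hM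
  have hTM : ∀ x y, T x y ∈ M := fun x y => mem_orth fun z hz => by
    have : T z = 0 := hz
    rw [← ht.cyc, this]; simp
  obtain ⟨I, ⟨hI0, hIM, hIinv⟩, hmin⟩ := exists_min_nat
    (fun I : Submodule ℝ E => I ≠ ⊥ ∧ I ≤ M ∧ ∀ x, ∀ y ∈ I, T x y ∈ I)
    (fun I => Module.finrank ℝ I) ⟨M, by
      intro hb
      apply h0
      have : LinearMap.ker T = ⊤ := by
        rw [← Submodule.orthogonal_orthogonal (LinearMap.ker T), ← hM, hb]; simp
      exact LinearMap.ker_eq_top.1 this, le_refl _, fun x y _ => hTM x y⟩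
  have hpq : ∀ p ∈ I, ∀ q ∈ Iᗮ, T p q = 0 := by
    intro p hp q hq
    apply eq_zero_of_inner; intro z
    rw [← ht.cyc]
    exact inner_orth (hIinv z p hp) hq
  have hpr : ∀ p ∈ I, ∀ q, T p (pr I q) = T p q := by
    intro p hp q
    have := hpq p hp _ (sub_pr_mem I q)
    rw [map_sub, sub_eq_zero] at this; exact this.symm
  have hpr' : ∀ p ∈ I, ∀ q, T (pr I q) p = T q p := by
    intro p hp q; rw [ht.swap, hpr p hp, ← ht.swap]
  have hmem : T ∘ₗ pr I ∈ prol h := by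
    refine ⟨fun x => ?_, fun x => hT.2 _⟩
    rw [LinearMap.comp_apply, ← hpr _ (pr_mem I x), ht.alt]
  refine ⟨T ∘ₗ pr I, I, hmem, ⟨hh.isTri hmem, ?_, ?_, ?_, ?_⟩, ?_, ?_, ?_⟩
  · intro x y z
    simp only [LinearMap.comp_apply]
    rw [hJ (pr I x), ← hpr _ (pr_mem I x) y, pr_of_mem (hIinv _ _ (pr_mem I y))]
  · intro x hx
    simp [pr_of_orth hx]
  · intro hz
    obtain ⟨x, hx, hx0⟩ := exists_ne_of_ne_bot hI0
    have h1 : T x = 0 := by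
      have := congrArg (fun f => f x) hz
      simpa [pr_of_mem hx] using this
    have h2 := inner_orth (U := LinearMap.ker T) (x := x) (y := x) h1 (hIM hx)
    exact hx0 (by simpa using h2)
  · intro J hJI hJinv
    by_cases hJ0 : J = ⊥
    · exact Or.inl hJ0
    · right
      refine Submodule.eq_of_le_of_finrank_le hJI (hmin J ⟨hJ0, hJI.trans hIM, fun x y hy => ?_⟩)
      have := hJinv x y hy
      rwa [LinearMap.comp_apply, hpr' y (hJI hy)] at this
  · intro x hx
    ext y
    rw [LinearMap.comp_apply, ← hpr _ (pr_mem I x), hpr' _ (pr_mem I y), hx]; rfl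
  · intro x hx
    exact mem_orth fun z hz => inner_orth (U := LinearMap.ker T) hx (hIM hz)
  · intro y hy z
    simp [pr_of_mem hy]

end simp

section mix
variable {E : Type} [NormedAddCommGroup E] [InnerProductSpace ℝ E] [FiniteDimensional ℝ E]
  {T : E →ₗ[ℝ] E →ₗ[ℝ] E} {U : Submodule ℝ E}

/-- No `Λ²` of a subspace of dimension at least three inside `h`. -/
def NoWedge (h : Submodule ℝ (E →ₗ[ℝ] E)) : Prop :=
  ∀ U : Submodule ℝ E, 3 ≤ Module.finrank ℝ U → ¬ ∀ x ∈ U, ∀ y ∈ U, wedge x y ∈ h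

theorem Simp.finrank (hT : Simp T U) : 3 ≤ Module.finrank ℝ U := by
  have : ∃ x y, T x y ≠ 0 := by
    by_contra hc
    push Not at hc
    exact hT.ne (by ext x y; exact hc x y)
  obtain ⟨x, y, hxy⟩ := this
  rw [← hT.pr_left, ← hT.pr_right] at hxy
  set x := pr U x
  set y := pr U y
  have hli : LinearIndependent ℝ ![x, y, T x y] := by
    rw [Fintype.linearIndependent_iff]
    intro g hg
    simp [Fin.sum_univ_three] at hg
    have h2 : g 2 = 0 := by
      have := congrArg (fun v => ⟪T x y, v⟫) hg
      simp only [inner_add_right, inner_smul_right, hT.tri.inner_self, hT.tri.inner_self',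
        inner_zero_right, mul_zero, zero_add] at this
      rcases mul_eq_zero.1 this with h | h
      · exact h
      · exact absurd (inner_self_eq_zero.1 h) hxy
    rw [h2, zero_smul, add_zero] at hg
    have h1 : g 1 = 0 := by
      have := congrArg (fun v => T x v) hg
      simp [hT.tri.alt] at this
      exact this.resolve_right hxy
    rw [h1, zero_smul, add_zero] at hg
    have h0 : g 0 = 0 := by
      rcases smul_eq_zero.1 hg with h | h
      · exact h
      · rw [h] at hxy; simp at hxy
    intro i; fin_cases i <;> assumption
  have h1 := finrank_span_eq_card hli
  have h2 : Submodule.span ℝ (Set.range ![x, y, T x y]) ≤ U := by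
    rw [Submodule.span_le]
    rintro _ ⟨i, rfl⟩
    fin_cases i
    · exact pr_mem U _
    · exact pr_mem U _
    · exact hT.mem _ _
  have h3 := Submodule.finrank_mono h2
  rw [h1] at h3
  simpa using h3

theorem wedge_sup {h : Submodule ℝ (E →ₗ[ℝ] E)} {η : E} (h1 : ∀ x ∈ U, ∀ y ∈ U, wedge x y ∈ h)
    (h2 : ∀ u ∈ U, wedge η u ∈ h) :
    ∀ x ∈ U ⊔ Submodule.span ℝ {η}, ∀ y ∈ U ⊔ Submodule.span ℝ {η}, wedge x y ∈ h := by
  intro x hx y hy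
  obtain ⟨u, hu, a, ha, rfl⟩ := Submodule.mem_sup.1 hx
  obtain ⟨v, hv, b, hb, rfl⟩ := Submodule.mem_sup.1 hy
  obtain ⟨s, rfl⟩ := Submodule.mem_span_singleton.1 ha
  obtain ⟨t, rfl⟩ := Submodule.mem_span_singleton.1 hb
  simp only [map_add, map_smul, LinearMap.add_apply, LinearMap.smul_apply, wedge_self, smul_zero,
    add_zero]
  refine h.add_mem (h.add_mem (h1 u hu v hv) (h.smul_mem _ (h2 v hv))) (h.smul_mem _ ?_)
  rw [wedge_swap]
  exact h.neg_mem (h2 u hu)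

theorem Simp.anticomm_mem {h : Submodule ℝ (E →ₗ[ℝ] E)} (hh : LieSkew h) (hT : Simp T U)
    (hTh : T ∈ prol h) {A : E →ₗ[ℝ] E} (hA : A ∈ h) : pr U ∘ₗ A + A ∘ₗ pr U ∈ h := by
  obtain ⟨c, hc, hcas⟩ := hT.casimir
  obtain ⟨b, -, hb⟩ := sum_TAT hT.tri hT.jac (hh.skew A hA)
  let e := stdOrthonormalBasis ℝ E
  have h1 : ∑ i, (T (e i) ∘ₗ (T (e i) ∘ₗ A - A ∘ₗ T (e i)) - (T (e i) ∘ₗ A - A ∘ₗ T (e i)) ∘ₗ T (e i))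
      ∈ h := h.sum_mem fun i _ => hh.lie _ (hTh.2 _) _ (hh.lie _ (hTh.2 _) _ hA)
  have h2 : ∑ i, (T (e i) ∘ₗ (T (e i) ∘ₗ A - A ∘ₗ T (e i)) - (T (e i) ∘ₗ A - A ∘ₗ T (e i)) ∘ₗ T (e i))
      = (-c) • (pr U ∘ₗ A + A ∘ₗ pr U) - T b := by
    have h3 : T b = (2 : ℝ) • ((1 / 2 : ℝ) • T b) := by rw [smul_smul]; norm_num
    ext y
    have h4 : ∀ y, (-c) • pr U y = ∑ i, T (e i) (T (e i) y) := by
      intro y; rw [← hcas, casimir_apply]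
    rw [h3, ← hb]
    simp only [LinearMap.sub_apply, LinearMap.smul_apply, LinearMap.add_apply, LinearMap.comp_apply,
      LinearMap.sum_apply, smul_add, h4, comp2_apply]
    rw [← map_smul A, h4, map_sum, Finset.smul_sum, ← Finset.sum_add_distrib,
      ← Finset.sum_sub_distrib]
    refine Finset.sum_congr rfl fun i _ => ?_
    rw [two_smul, map_sub]
    abel
  rw [h2] at h1
  have h5 := h.smul_mem (-c)⁻¹ (h.add_mem h1 (hTh.2 b))
  rwa [sub_add_cancel, smul_smul, inv_mul_cancel₀ (by linarith), one_smul] at h5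

/-- The off-diagonal blocks. -/
def Mixed (h : Submodule ℝ (E →ₗ[ℝ] E)) (U : Submodule ℝ E) (b : E →ₗ[ℝ] E) : Prop :=
  (∀ x, b x ∈ U) ∧ (∀ x ∈ U, b x = 0) ∧ b - LinearMap.adjoint b ∈ h

theorem Mixed.comp {h : Submodule ℝ (E →ₗ[ℝ] E)} (hh : LieSkew h) (hT : Simp T U)
    (hTh : T ∈ prol h) {b : E →ₗ[ℝ] E} (hb : Mixed h U b) (y : E) : Mixed h U (T y ∘ₗ b) := by
  refine ⟨fun x => hT.mem _ _, fun x hx => by simp [hb.2.1 x hx], ?_⟩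
  have := hh.lie _ (hTh.2 y) _ hb.2.2
  convert this using 1
  ext x
  apply eq_of_inner; intro z
  have h1 : ⟪LinearMap.adjoint (T y ∘ₗ b) x, z⟫ = ⟪x, T y (b z)⟫ := LinearMap.adjoint_inner_left _ _ _
  have h2 : ∀ x z, ⟪LinearMap.adjoint b x, z⟫ = ⟪x, b z⟫ := fun x z => LinearMap.adjoint_inner_left _ _ _
  simp only [LinearMap.sub_apply, LinearMap.comp_apply, inner_sub_left, h1, h2, map_sub,
    hb.2.1 _ (hT.mem _ _), hT.tri.skew y, hb.2.1 _ (hT.mem _ _), inner_zero_left, inner_zero_right,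
    inner_neg_left, inner_neg_right]
  ring

theorem Mixed.adjoin {h : Submodule ℝ (E →ₗ[ℝ] E)} (hh : LieSkew h) (hT : Simp T U)
    (hTh : T ∈ prol h) {F : Module.End ℝ E} (hF : F ∈ Algebra.adjoin ℝ (Set.range T)) :
    ∀ {b : E →ₗ[ℝ] E}, Mixed h U b → Mixed h U (F ∘ₗ b) := by
  induction hF using Algebra.adjoin_induction with
  | mem F hF =>
    intro b hb
    obtain ⟨y, rfl⟩ := hF
    exact hb.comp hh hT hTh y
  | algebraMap r =>
    intro b hb
    have : (algebraMap ℝ (Module.End ℝ E) r) ∘ₗ b = r • b := by ext x; simp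
    rw [this]
    refine ⟨fun x => U.smul_mem _ (hb.1 x), fun x hx => by simp [hb.2.1 x hx], ?_⟩
    have h1 : LinearMap.adjoint (r • b) = r • LinearMap.adjoint b := by simp
    rw [h1, ← smul_sub]
    exact h.smul_mem _ hb.2.2
  | add F G _ _ hF hG =>
    intro b hb
    have h1 := hF hb
    have h2 := hG hb
    rw [LinearMap.add_comp]
    refine ⟨fun x => U.add_mem (h1.1 x) (h2.1 x), fun x hx => ?_, ?_⟩
    · rw [LinearMap.add_apply, h1.2.1 x hx, h2.2.1 x hx, add_zero]
    · rw [map_add, add_sub_add_comm]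
      exact h.add_mem h1.2.2 h2.2.2
  | mul F G _ _ hF hG =>
    intro b hb
    have : (F * G) ∘ₗ b = F ∘ₗ (G ∘ₗ b) := rfl
    rw [this]
    exact hF (hG hb)

theorem adjoin_mem (hT : Simp T U) {F : Module.End ℝ E} (hF : F ∈ Algebra.adjoin ℝ (Set.range T)) :
    ∀ x ∈ U, F x ∈ U := by
  induction hF using Algebra.adjoin_induction with
  | mem F hF => obtain ⟨y, rfl⟩ := hF; exact fun x _ => hT.mem _ _
  | algebraMap r => intro x hx; simpa using U.smul_mem r hx
  | add F G _ _ hF hG => exact fun x hx => U.add_mem (hF x hx) (hG x hx)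
  | mul F G _ _ hF hG => exact fun x hx => hF _ (hG x hx)

/-- Two vectors with compatible annihilators are proportional. -/
theorem Simp.propor (hT : Simp T U) {p q : E} (hp : p ∈ U) (hq : q ∈ U) (hq0 : q ≠ 0)
    (hpq : ∀ F ∈ Algebra.adjoin ℝ (Set.range T), F q = 0 → F p = 0) : ∃ c : ℝ, p = c • q := by
  let 𝒜 := Subalgebra.toSubmodule (Algebra.adjoin ℝ (Set.range T))
  let ev : E → (𝒜 →ₗ[ℝ] E) := fun v =>
    { toFun := fun F => F.1 v, map_add' := fun _ _ => rfl, map_smul' := fun _ _ => rfl }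
  have hone : (1 : Module.End ℝ E) ∈ 𝒜 := one_mem (Algebra.adjoin ℝ (Set.range T))
  have hrange : LinearMap.range (ev q) = U := by
    have := hT.simp (LinearMap.range (ev q)) (by
      rintro _ ⟨F, rfl⟩
      exact adjoin_mem hT F.2 q hq) (by
      rintro x _ ⟨F, rfl⟩
      exact ⟨⟨T x * F.1, Subalgebra.mul_mem _ (Algebra.subset_adjoin ⟨x, rfl⟩) F.2⟩, rfl⟩)
    refine this.resolve_left fun h => hq0 ?_
    have : q ∈ LinearMap.range (ev q) := ⟨⟨1, hone⟩, rfl⟩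
    rw [h] at this; simpa using this
  have hex : ∀ u ∈ U, ∃ F : 𝒜, F.1 q = u := fun u hu => by
    have : u ∈ LinearMap.range (ev q) := hrange.ge hu
    exact this
  let evq : 𝒜 →ₗ[ℝ] U := (ev q).codRestrict U (fun F => adjoin_mem hT F.2 q hq)
  have hsurj : LinearMap.range evq = ⊤ := by
    rw [LinearMap.range_eq_top]
    intro u
    obtain ⟨F, hF⟩ := hex u u.2
    exact ⟨F, Subtype.ext hF⟩
  obtain ⟨s, hs⟩ := LinearMap.exists_rightInverse_of_surjective evq hsurj
  let ψ : E →ₗ[ℝ] E := ev p ∘ₗ s ∘ₗ ((pr U).codRestrict U (pr_mem U))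
  have hψ : ∀ F : 𝒜, ψ (F.1 q) = F.1 p := by
    intro F
    have hm := adjoin_mem hT F.2 q hq
    have h1 : (pr U).codRestrict U (pr_mem U) (F.1 q) = evq F := Subtype.ext (pr_of_mem hm)
    have h2 : evq (s (evq F)) = evq F := congrArg (fun f => f (evq F)) hs
    have h3 : (s (evq F)).1 q = F.1 q := congrArg Subtype.val h2
    have h4 := hpq ((s (evq F)).1 - F.1) (Subalgebra.sub_mem _ (s (evq F)).2 F.2) (by
      rw [LinearMap.sub_apply, h3, sub_self])
    change (s ((pr U).codRestrict U (pr_mem U) (F.1 q))).1 p = F.1 p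
    rw [h1]
    rw [LinearMap.sub_apply, sub_eq_zero] at h4
    exact h4
  have hψpr : ∀ x, ψ (pr U x) = ψ x := by
    intro x
    have : (pr U).codRestrict U (pr_mem U) (pr U x) = (pr U).codRestrict U (pr_mem U) x :=
      Subtype.ext (pr_pr U x)
    simp only [ψ, LinearMap.comp_apply, this]
  obtain ⟨c, hc⟩ := hT.schur (ψ := ψ) (fun x => adjoin_mem hT (s _).2 p hp)
    (fun x hx => by rw [← hψpr, pr_of_orth hx, map_zero]) (by
      intro x y
      obtain ⟨F, hF⟩ := hex _ (pr_mem U y)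
      rw [← hT.pr_right, ← hψpr y, ← hF, hψ]
      exact hψ ⟨T x * F.1, Subalgebra.mul_mem _ (Algebra.subset_adjoin ⟨x, rfl⟩) F.2⟩)
  refine ⟨c, ?_⟩
  rw [← hc q hq]
  exact (hψ ⟨1, hone⟩).symm

theorem Simp.mixed_zero {h : Submodule ℝ (E →ₗ[ℝ] E)} (hh : LieSkew h) (hn : NoWedge h)
    (hT : Simp T U) (hTh : T ∈ prol h) : ∀ b, Mixed h U b → b = 0 := by
  by_contra hcon
  push Not at hcon
  obtain ⟨b, ⟨hb, hb0⟩, hmax⟩ := exists_max_nat (fun b => Mixed h U b ∧ b ≠ 0)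
    (fun b => Module.finrank ℝ (LinearMap.ker b)) (Module.finrank ℝ E)
    (fun b _ => Submodule.finrank_le _) hcon
  obtain ⟨ξ, hξ⟩ : ∃ ξ, b ξ ≠ 0 := by
    by_contra hc; push Not at hc; exact hb0 (by ext x; exact hc x)
  set q := b ξ with hq
  have hprop : ∀ x, ∃ c : ℝ, b x = c • q := by
    intro x
    refine hT.propor (hb.1 x) (hb.1 ξ) hξ fun F hF hFq => ?_
    have hFb := Mixed.adjoin hh hT hTh hF hb
    by_contra hne
    have hFb0 : F ∘ₗ b ≠ 0 := fun h0 => hne (congrArg (fun f => f x) h0)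
    have hle := hmax _ ⟨hFb, hFb0⟩
    have hlt : LinearMap.ker b < LinearMap.ker (F ∘ₗ b) := by
      refine lt_of_le_of_ne (fun z hz => ?_) fun heq => hξ ?_
      · have : b z = 0 := hz
        simp [this]
      · have : ξ ∈ LinearMap.ker (F ∘ₗ b) := hFq
        rw [← heq] at this; exact this
    have := Submodule.finrank_lt_finrank_of_lt hlt
    omega
  set χ := LinearMap.adjoint b with hχ
  have hχi : ∀ x y, ⟪χ x, y⟫ = ⟪x, b y⟫ := fun x y => LinearMap.adjoint_inner_left _ _ _
  have hqn : ⟪q, q⟫ ≠ 0 := fun h0 => hξ (inner_self_eq_zero.1 h0)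
  set η := (⟪q, q⟫)⁻¹ • χ q with hη
  have hbη : ∀ x, b x = ⟪η, x⟫ • q := by
    intro x
    obtain ⟨c, hc⟩ := hprop x
    rw [hη, inner_smul_left, hχi, hc, inner_smul_right]
    simp
    congr 1
    field_simp
  have hW : b - χ = wedge η q := by
    ext x
    apply eq_of_inner; intro z
    rw [LinearMap.sub_apply, inner_sub_left, hχi, hbη, hbη z]
    simp [inner_sub_left, inner_smul_left, inner_smul_right]
    rw [real_inner_comm q x]; ring
  have hηU : η ∈ Uᗮ := mem_orth fun u hu => by
    have := hbη u
    rw [hb.2.1 u hu] at this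
    exact (smul_eq_zero.1 this.symm).resolve_right hξ
  have hη0 : ⟪η, η⟫ ≠ 0 := by
    intro h0
    rw [inner_self_eq_zero] at h0
    apply hξ; rw [hq, hbη, h0]; simp
  let J : Submodule ℝ E := U ⊓ h.comap (wedge η)
  have hJ := hT.simp J inf_le_left (by
    rintro x y ⟨hy, hy'⟩
    refine ⟨hT.mem _ _, ?_⟩
    have h1 : wedge η y ∈ h := hy'
    have h2 := hh.lie _ (hTh.2 x) _ h1
    rw [comm_wedge (hT.tri.isSkew x), hT.tri.swap x η, hT.ker η hηU] at h2
    simpa using h2)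
  have hJU : ∀ u ∈ U, wedge η u ∈ h := by
    rcases hJ with hJ | hJ
    · exfalso
      have : q ∈ J := ⟨hb.1 ξ, by change wedge η q ∈ h; rw [← hW]; exact hb.2.2⟩
      rw [hJ] at this
      exact hξ (by simpa using this)
    · intro u hu
      exact (hJ.ge hu).2
  have hUU : ∀ x ∈ U, ∀ y ∈ U, wedge x y ∈ h := by
    intro x hx y hy
    have h1 := hh.lie _ (hJU x hx) _ (hJU y hy)
    rw [comm_wedge (isSkew_wedge _ _)] at h1
    simp only [wedge_apply, inner_orth hx hηU, inner_orth' hy hηU, zero_smul, sub_zero, zero_sub,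
      map_neg, map_smul, LinearMap.smul_apply, LinearMap.neg_apply, wedge_self, smul_zero, neg_zero,
      add_zero] at h1
    have h2 := h.smul_mem (⟪η, η⟫)⁻¹ h1
    rwa [smul_smul, inv_mul_cancel₀ hη0, one_smul] at h2
  exact hn U hT.finrank hUU

theorem Simp.mix {h : Submodule ℝ (E →ₗ[ℝ] E)} (hh : LieSkew h) (hn : NoWedge h)
    (hT : Simp T U) (hTh : T ∈ prol h) {A : E →ₗ[ℝ] E} (hA : A ∈ h) :
    (∀ x ∈ U, A x ∈ U) ∧ (∀ x ∈ Uᗮ, A x ∈ Uᗮ) ∧ A ∘ₗ pr U ∈ h := by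
  have hsk := hh.skew A hA
  have h1 := hT.anticomm_mem hh hTh hA
  have h2 := hT.anticomm_mem hh hTh h1
  have e2 : pr U ∘ₗ (pr U ∘ₗ A + A ∘ₗ pr U) + (pr U ∘ₗ A + A ∘ₗ pr U) ∘ₗ pr U -
      (pr U ∘ₗ A + A ∘ₗ pr U) = (2 : ℝ) • (pr U ∘ₗ A ∘ₗ pr U) := by
    ext x; simp [pr_pr, two_smul]; abel
  have h3 := h.sub_mem h2 h1
  rw [e2] at h3
  have h4 : pr U ∘ₗ A ∘ₗ pr U ∈ h := by
    have := h.smul_mem (2 : ℝ)⁻¹ h3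
    rwa [smul_smul, inv_mul_cancel₀ two_ne_zero, one_smul] at this
  have h5 := h.sub_mem h1 h3
  have hb := hT.mixed_zero hh hn hTh (pr U ∘ₗ A ∘ₗ (LinearMap.id - pr U)) ⟨fun x => pr_mem U _,
    fun x hx => by simp [pr_of_mem hx], by
      convert h5 using 1
      ext x
      apply eq_of_inner; intro z
      have h2 : ⟪LinearMap.adjoint (pr U ∘ₗ A ∘ₗ (LinearMap.id - pr U)) x, z⟫ =
        ⟪x, pr U (A (z - pr U z))⟫ := LinearMap.adjoint_inner_left _ _ _
      rw [LinearMap.sub_apply, inner_sub_left, h2, ← pr_inner]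
      simp only [LinearMap.sub_apply, LinearMap.add_apply, LinearMap.comp_apply, LinearMap.smul_apply,
        LinearMap.id_apply, map_sub, inner_sub_left, inner_sub_right, inner_add_left,
        inner_smul_left, pr_inner, hsk]
      simp only [← pr_inner U x, RCLike.conj_to_real]
      linarith [hsk (pr U x) z, hsk (pr U x) (pr U z)]⟩
  have hor : ∀ x ∈ Uᗮ, A x ∈ Uᗮ := by
    intro x hx
    have h6 : pr U (A x) = 0 := by
      have := congrArg (fun f => f x) hb
      simpa [pr_of_orth hx] using this
    have := sub_pr_mem U (A x)
    rwa [h6, sub_zero] at this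
  have hin : ∀ x ∈ U, A x ∈ U := fun x hx => mem_of_orth fun z hz => by
    rw [hsk, inner_orth hx (hor z hz), neg_zero]
  refine ⟨hin, hor, ?_⟩
  convert h4 using 1
  ext x
  simp [pr_of_mem (hin _ (pr_mem U x))]

end mix

section stepone
variable {E : Type} [NormedAddCommGroup E] [InnerProductSpace ℝ E] [FiniteDimensional ℝ E]

/-- The obstruction to the Jacobi identity. -/
def jacOb (T : E →ₗ[ℝ] E →ₗ[ℝ] E) : E →ₗ[ℝ] E →ₗ[ℝ] E →ₗ[ℝ] E where
  toFun x := act (T x) T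
  map_add' x y := by rw [map_add, act_add_left]
  map_smul' c x := by rw [map_smul, act_smul_left]; rfl

theorem jacOb_apply (T : E →ₗ[ℝ] E →ₗ[ℝ] E) (x : E) : jacOb T x = act (T x) T := rfl

theorem jac_of_jacOb {T : E →ₗ[ℝ] E →ₗ[ℝ] E} (h : jacOb T = 0) : Jac T := by
  intro x y z
  have := congrArg (fun f => f x y z) h
  simp only [jacOb_apply, act_apply, LinearMap.zero_apply] at this
  rw [sub_sub, sub_eq_zero] at this; exact this

theorem Jac.act_eq {T : E →ₗ[ℝ] E →ₗ[ℝ] E} (h : Jac T) (x : E) : act (T x) T = 0 := by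
  ext y z; simp [h x y z]

theorem jac_all {h : Submodule ℝ (E →ₗ[ℝ] E)} (hh : LieSkew h) (hn : NoWedge h) :
    ∀ T ∈ prol h, Jac T := by
  by_contra hcon
  push Not at hcon
  obtain ⟨T0, hT0, hT0J⟩ := hcon
  obtain ⟨β, ⟨hβ1, hβ2, hβ0⟩, hmax⟩ := exists_max_nat
    (fun β : E →ₗ[ℝ] E →ₗ[ℝ] E →ₗ[ℝ] E => (∀ x, β x ∈ prol h) ∧ (∀ x, β x x = 0) ∧ β ≠ 0)
    (fun β => Module.finrank ℝ (LinearMap.ker β)) (Module.finrank ℝ E)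
    (fun b _ => Submodule.finrank_le _) ⟨jacOb T0, fun x => hh.act_mem hT0 (hT0.2 x), fun x => by
      ext y
      simp [jacOb_apply, (hh.isTri hT0).alt], fun h0 => hT0J (jac_of_jacOb h0)⟩
  obtain ⟨v, hv⟩ : ∃ v, β v ≠ 0 := by
    by_contra hc; push Not at hc; exact hβ0 (by ext1 x; exact hc x)
  have hsw : ∀ x y, β x y = - β y x := by
    intro x y
    have := hβ2 (x + y)
    simp [hβ2] at this
    exact eq_neg_of_add_eq_zero_left this
  set T := β v with hTdef
  have hT : T ∈ prol h := hβ1 v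
  have ht := hh.isTri hT
  have hTv : T v = 0 := hβ2 v
  have hσ : jacOb T = 0 := by
    by_contra hne
    have hle := hmax (jacOb T) ⟨fun x => hh.act_mem hT (hT.2 x), fun x => by
      ext y
      simp [jacOb_apply, ht.alt], hne⟩
    have hz : ∀ w, T w = 0 → jacOb T w = 0 := by
      intro w hw
      rw [jacOb_apply, hw]
      ext y z; simp
    have hlt : LinearMap.ker β < LinearMap.ker (jacOb T) := by
      refine lt_of_le_of_ne (fun z hz' => hz z ?_) fun heq => hv ?_
      · have : β z = 0 := hz'
        rw [hTdef, hsw, this]; simp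
      · have : v ∈ LinearMap.ker (jacOb T) := hz v hTv
        rw [← heq] at this; exact this
    have := Submodule.finrank_lt_finrank_of_lt hlt
    omega
  obtain ⟨T1, U1, hT1, hs, hk, hko, heq⟩ := simple_ideal hh hT (jac_of_jacOb hσ) hv
  have : ∃ y ∈ U1, ∃ z, T1 y z ≠ 0 := by
    by_contra hc
    push Not at hc
    exact hs.ne (by ext y z; rw [← hs.pr_left]; exact hc _ (pr_mem U1 y) z)
  obtain ⟨y, hy, z, hyz⟩ := this
  have hA := (hs.mix hh hn hT1 ((hβ1 y).2 z)).2.1 v (hko v hTv)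
  have e1 : β y z v = T1 y z := by
    rw [heq y hy, hTdef, (hh.isTri (hβ1 y)).swap, hsw y v]; simp
  rw [e1] at hA
  exact hyz (by simpa using inner_orth (hs.mem y z) hA)

/-- A simple element of the prolongation with the largest kernel. -/
theorem exists_maxker {h : Submodule ℝ (E →ₗ[ℝ] E)} (hh : LieSkew h) (hn : NoWedge h)
    (h0 : ∃ T ∈ prol h, T ≠ 0) :
    ∃ (T : E →ₗ[ℝ] E →ₗ[ℝ] E) (U : Submodule ℝ E), T ∈ prol h ∧ Simp T U ∧
      ∀ S ∈ prol h, (∀ x ∈ Uᗮ, S x = 0) → ∀ v ∈ U, v ≠ 0 → S v = 0 → S = 0 := by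
  obtain ⟨T, ⟨hT, hT0⟩, hmax⟩ := exists_max_nat
    (fun T : E →ₗ[ℝ] E →ₗ[ℝ] E => T ∈ prol h ∧ T ≠ 0)
    (fun T => Module.finrank ℝ (LinearMap.ker T)) (Module.finrank ℝ E)
    (fun b _ => Submodule.finrank_le _) h0
  obtain ⟨T1, U1, hT1, hs, hk, hko, heq⟩ := simple_ideal hh hT (jac_all hh hn T hT) hT0
  refine ⟨T1, U1, hT1, hs, ?_⟩
  intro S hS hSU v hv hv0 hSv
  by_contra hne
  have h1 := hmax S ⟨hS, hne⟩
  have h2 : Module.finrank ℝ (LinearMap.ker T) ≤ Module.finrank ℝ (LinearMap.ker T1) :=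
    Submodule.finrank_mono (fun x hx => hk x hx)
  have hlt : LinearMap.ker T1 < LinearMap.ker S := by
    refine lt_of_le_of_ne (fun z hz' => ?_) fun heq => hv0 ?_
    · have hz1 : T1 z = 0 := hz'
      have hz2 : pr U1 z = 0 := hs.inj (pr_mem U1 z) (by rw [hs.pr_left, hz1])
      have := sub_pr_mem U1 z
      rw [hz2, sub_zero] at this
      exact hSU z this
    · have : v ∈ LinearMap.ker S := hSv
      rw [← heq] at this
      exact hs.inj hv this
  have := Submodule.finrank_lt_finrank_of_lt hlt
  omega

theorem exists_orth2 {U : Submodule ℝ E} (hU : 3 ≤ Module.finrank ℝ U) (x y : E) :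
    ∃ u ∈ U, u ≠ 0 ∧ ⟪x, u⟫ = 0 ∧ ⟪y, u⟫ = 0 := by
  let f : U →ₗ[ℝ] ℝ × ℝ := ((innerₛₗ ℝ x).prod (innerₛₗ ℝ y)) ∘ₗ U.subtype
  have : LinearMap.ker f ≠ ⊥ := LinearMap.ker_ne_bot_of_finrank_lt (by
    rw [Module.finrank_prod]; simp; omega)
  obtain ⟨u, hu, hu0⟩ := (Submodule.ne_bot_iff _).1 this
  have h1 : f u = 0 := hu
  simp [f] at h1
  exact ⟨u, u.2, by simpa using hu0, h1.1, h1.2⟩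

theorem skew_comp_pr {U : Submodule ℝ E} {A : E →ₗ[ℝ] E} (hA : IsSkew A) (hU : ∀ x ∈ U, A x ∈ U) :
    IsSkew (A ∘ₗ pr U) := by
  intro x y
  simp only [LinearMap.comp_apply]
  rw [← pr_of_mem (hU _ (pr_mem U x)), pr_inner, hA, pr_inner, pr_of_mem (hU _ (pr_mem U y))]

theorem wedge_sum {U : Submodule ℝ E} {h : Submodule ℝ (E →ₗ[ℝ] E)}
    (hw : ∀ x ∈ U, ∀ y ∈ U, wedge x y ∈ h) {B : E →ₗ[ℝ] E} (hB : IsSkew B)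
    (hBU : ∀ x ∈ Uᗮ, B x = 0) : B ∈ h := by
  have hBm : ∀ x, B x ∈ U := fun x => mem_of_orth fun z hz => by rw [hB, hBU z hz]; simp
  have hBp : ∀ x, B (pr U x) = B x := fun x => by
    have := hBU _ (sub_pr_mem U x)
    rw [map_sub, sub_eq_zero] at this; exact this.symm
  let e := stdOrthonormalBasis ℝ E
  have h1 : ∑ i, wedge (pr U (e i)) (B (e i)) ∈ h :=
    h.sum_mem fun i _ => hw _ (pr_mem U _) _ (hBm _)
  have h2 : ∑ i, wedge (pr U (e i)) (B (e i)) = (2 : ℝ) • B := by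
    ext z
    simp only [LinearMap.sum_apply, wedge_apply, LinearMap.smul_apply, pr_inner, hB _ z,
      Finset.sum_sub_distrib, neg_smul, Finset.sum_neg_distrib]
    have e1 : ∑ i, ⟪e i, pr U z⟫ • B (e i) = B z := by
      conv_rhs => rw [← hBp z, ← e.sum_repr' (pr U z), map_sum]
      simp
    have e2 : ∑ i, ⟪e i, B z⟫ • pr U (e i) = B z := by
      conv_rhs => rw [← pr_of_mem (hBm z), ← e.sum_repr' (B z), map_sum]
      simp
    rw [e1, e2, two_smul]; abel
  rw [h2] at h1
  have := h.smul_mem (2 : ℝ)⁻¹ h1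
  rwa [smul_smul, inv_mul_cancel₀ two_ne_zero, one_smul] at this

theorem core_wedge {h : Submodule ℝ (E →ₗ[ℝ] E)} (hh : LieSkew h) (hn : ¬ NoWedge h) :
    ∃ U : Submodule ℝ E, U ≠ ⊥ ∧ (∀ x, (∀ A ∈ h, A x = 0) → x ∈ Uᗮ) ∧
      (∀ A ∈ h, (∀ x ∈ U, A x ∈ U) ∧ A ∘ₗ pr U ∈ h) ∧
      (∀ B, IsSkew B → (∀ x ∈ Uᗮ, B x = 0) → B ∈ h) := by
  unfold NoWedge at hn
  push Not at hn
  obtain ⟨U, ⟨hU3, hw⟩, hmax⟩ := exists_max_nat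
    (fun U : Submodule ℝ E => 3 ≤ Module.finrank ℝ U ∧ ∀ x ∈ U, ∀ y ∈ U, wedge x y ∈ h)
    (fun U => Module.finrank ℝ U) (Module.finrank ℝ E) (fun b _ => Submodule.finrank_le _) hn
  have hinv : ∀ A ∈ h, ∀ x ∈ U, A x ∈ U := by
    intro A hA x hx
    set φ : E → E := fun z => A z - pr U (A z) with hφ
    have hφo : ∀ z, φ z ∈ Uᗮ := fun z => sub_pr_mem U _
    have key : ∀ u ∈ U, ⟪x, u⟫ = 0 → wedge (φ x) u ∈ h := by
      intro u hu hxu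
      obtain ⟨y, hy, hy0, hxy, huy⟩ := exists_orth2 hU3 x u
      have h1 : wedge (φ x) y + wedge x (φ y) ∈ h := by
        have h2 := hh.lie A hA _ (hw x hx y hy)
        rw [comm_wedge (hh.skew A hA)] at h2
        have h3 := h.sub_mem (h.sub_mem h2 (hw _ (pr_mem U (A x)) y hy)) (hw x hx _ (pr_mem U (A y)))
        convert h3 using 1
        simp only [hφ, map_sub, LinearMap.sub_apply]; abel
      have h2 := hh.lie _ (hw y hy u hu) _ h1
      rw [LinearMap.comp_add, LinearMap.add_comp, add_sub_add_comm, comm_wedge (isSkew_wedge _ _),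
        comm_wedge (isSkew_wedge _ _)] at h2
      have e1 : wedge y u (φ x) = 0 := by simp [inner_orth hy (hφo x), inner_orth hu (hφo x)]
      have e2 : wedge y u (φ y) = 0 := by simp [inner_orth hy (hφo y), inner_orth hu (hφo y)]
      have e3 : wedge y u y = ⟪y, y⟫ • u := by simp [huy]
      have e4 : wedge y u x = 0 := by
        simp [real_inner_comm x y, real_inner_comm x u, hxy, hxu]
      rw [e1, e2, e3, e4] at h2
      simp only [map_zero, LinearMap.zero_apply, zero_add, add_zero, map_smul] at h2
      have h3 := h.smul_mem (⟪y, y⟫)⁻¹ h2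
      rwa [smul_smul, inv_mul_cancel₀ (fun h0 => hy0 (inner_self_eq_zero.1 h0)), one_smul] at h3
    have keyx : wedge (φ x) x ∈ h := by
      obtain ⟨u, hu, hu0, hxu, -⟩ := exists_orth2 hU3 x x
      have h2 := hh.lie _ (hw u hu x hx) _ (key u hu hxu)
      rw [comm_wedge (isSkew_wedge _ _)] at h2
      have e1 : wedge u x (φ x) = 0 := by simp [inner_orth hu (hφo x), inner_orth hx (hφo x)]
      have e3 : wedge u x u = ⟪u, u⟫ • x := by simp [hxu]
      rw [e1, e3] at h2
      simp only [map_zero, LinearMap.zero_apply, zero_add, add_zero, map_smul] at h2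
      have h3 := h.smul_mem (⟪u, u⟫)⁻¹ h2
      rwa [smul_smul, inv_mul_cancel₀ (fun h0 => hu0 (inner_self_eq_zero.1 h0)), one_smul] at h3
    by_contra hAx
    have hx0 : x ≠ 0 := by rintro rfl; simp at hAx
    have hφx : φ x ∉ U := fun hm => hAx (by
      have := U.add_mem hm (pr_mem U (A x))
      simpa [hφ] using this)
    have hall : ∀ u ∈ U, wedge (φ x) u ∈ h := by
      intro u hu
      have hxx : ⟪x, x⟫ ≠ 0 := fun h0 => hx0 (inner_self_eq_zero.1 h0)
      have e : u = (⟪x, u⟫ / ⟪x, x⟫) • x + (u - (⟪x, u⟫ / ⟪x, x⟫) • x) := by abel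
      rw [e, map_add, map_smul]
      refine h.add_mem (h.smul_mem _ keyx) (key _ (U.sub_mem hu (U.smul_mem _ hx)) ?_)
      rw [inner_sub_right, inner_smul_right]; field_simp; ring
    have hlt : U < U ⊔ Submodule.span ℝ {φ x} := by
      refine lt_of_le_of_ne le_sup_left fun heq => hφx ?_
      rw [heq]
      exact Submodule.mem_sup_right (Submodule.mem_span_singleton_self _)
    have h1 := Submodule.finrank_lt_finrank_of_lt hlt
    have h2 := hmax _ ⟨by omega, wedge_sup hw hall⟩
    omega
  refine ⟨U, ?_, ?_, ?_, ?_⟩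
  · rintro rfl; simp at hU3
  · intro x hx
    have hp : pr U x = 0 := by
      obtain ⟨u, hu, hu0, hpu, -⟩ := exists_orth2 hU3 (pr U x) x
      have h1 := hx _ (hw _ (pr_mem U x) u hu)
      rw [wedge_apply] at h1
      have h2 : ⟪u, x⟫ = 0 := by rw [← pr_of_mem hu, pr_inner, real_inner_comm]; exact hpu
      have h3 : ⟪pr U x, x⟫ = ⟪pr U x, pr U x⟫ := by rw [← pr_inner, pr_pr]
      rw [h2, zero_smul, sub_zero, h3] at h1
      exact inner_self_eq_zero.1 ((smul_eq_zero.1 h1).resolve_right hu0)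
    have := sub_pr_mem U x
    rwa [hp, sub_zero] at this
  · intro A hA
    exact ⟨hinv A hA, wedge_sum hw (skew_comp_pr (hh.skew A hA) (hinv A hA))
      (fun x hx => by simp [pr_of_orth hx])⟩
  · intro B hB hBU
    exact wedge_sum hw hB hBU

end stepone

section curv
variable {E : Type} [NormedAddCommGroup E] [InnerProductSpace ℝ E] [FiniteDimensional ℝ E]

/-- The situation after the first reductions. -/
structure Ctx (k : Submodule ℝ (E →ₗ[ℝ] E)) : Prop where
  lie : LieSkew k
  jac : ∀ S ∈ prol k, Jac S
  nondeg : ∀ S ∈ prol k, ∀ v, v ≠ 0 → S v = 0 → S = 0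

theorem Ctx.simp {k : Submodule ℝ (E →ₗ[ℝ] E)} (C : Ctx k) {T : E →ₗ[ℝ] E →ₗ[ℝ] E}
    (hT : T ∈ prol k) (h0 : T ≠ 0) : Simp T ⊤ := by
  have ht := C.lie.isTri hT
  refine ⟨ht, C.jac T hT, fun x hx => by simp at hx; simp [hx], h0, fun J _ hJ => ?_⟩
  by_contra hcon
  push Not at hcon
  obtain ⟨hb, htop⟩ := hcon
  have hpq : ∀ p ∈ J, ∀ q ∈ Jᗮ, T p q = 0 := by
    intro p hp q hq
    apply eq_zero_of_inner; intro z
    rw [← ht.cyc]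
    exact inner_orth (hJ z p hp) hq
  have hpr : ∀ p ∈ J, ∀ q, T p (pr J q) = T p q := by
    intro p hp q
    have := hpq p hp _ (sub_pr_mem J q)
    rw [map_sub, sub_eq_zero] at this; exact this.symm
  have hmem : T ∘ₗ pr J ∈ prol k := by
    refine ⟨fun x => ?_, fun x => hT.2 _⟩
    rw [LinearMap.comp_apply, ← hpr _ (pr_mem J x), ht.alt]
  have hJo : Jᗮ ≠ ⊥ := fun h => htop ((Submodule.orthogonal_eq_bot_iff).1 h)
  obtain ⟨v, hv, hv0⟩ := exists_ne_of_ne_bot hJo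
  have hz := C.nondeg _ hmem v hv0 (by simp [pr_of_orth hv])
  obtain ⟨x, hx, hx0⟩ := exists_ne_of_ne_bot hb
  apply h0
  refine C.nondeg T hT x hx0 ?_
  have := congrArg (fun f => f x) hz
  simpa [pr_of_mem hx] using this

/-- Hilbert-Schmidt form on bilinear maps. -/
def hs : (E →ₗ[ℝ] E →ₗ[ℝ] E) →ₗ[ℝ] (E →ₗ[ℝ] E →ₗ[ℝ] E) →ₗ[ℝ] ℝ :=
  LinearMap.mk₂ ℝ (fun S S' => ∑ i, ∑ j, ⟪S (stdOrthonormalBasis ℝ E i) (stdOrthonormalBasis ℝ E j),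
      S' (stdOrthonormalBasis ℝ E i) (stdOrthonormalBasis ℝ E j)⟫)
    (fun a b c => by simp [inner_add_left, Finset.sum_add_distrib])
    (fun a b c => by simp [real_inner_smul_left, Finset.mul_sum])
    (fun a b c => by simp [inner_add_right, Finset.sum_add_distrib])
    (fun a b c => by simp [real_inner_smul_right, Finset.mul_sum])

theorem hs_apply (S S' : E →ₗ[ℝ] E →ₗ[ℝ] E) : hs S S' =
    ∑ i, ∑ j, ⟪S (stdOrthonormalBasis ℝ E i) (stdOrthonormalBasis ℝ E j),
      S' (stdOrthonormalBasis ℝ E i) (stdOrthonormalBasis ℝ E j)⟫ := rfl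

theorem hs_comm (S S' : E →ₗ[ℝ] E →ₗ[ℝ] E) : hs S S' = hs S' S := by
  simp only [hs_apply, real_inner_comm]

theorem hs_nonneg (S : E →ₗ[ℝ] E →ₗ[ℝ] E) : 0 ≤ hs S S := by
  rw [hs_apply]
  exact Finset.sum_nonneg fun i _ => Finset.sum_nonneg fun j _ => real_inner_self_nonneg

theorem hs_def (S : E →ₗ[ℝ] E →ₗ[ℝ] E) (h : hs S S = 0) : S = 0 := by
  rw [hs_apply, Finset.sum_eq_zero_iff_of_nonneg (fun i _ => Finset.sum_nonneg fun j _ =>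
    real_inner_self_nonneg)] at h
  refine (stdOrthonormalBasis ℝ E).toBasis.ext fun i => (stdOrthonormalBasis ℝ E).toBasis.ext fun j => ?_
  have h1 := h i (Finset.mem_univ _)
  rw [Finset.sum_eq_zero_iff_of_nonneg (fun j _ => real_inner_self_nonneg)] at h1
  have h2 := h1 j (Finset.mem_univ _)
  simpa using h2

theorem hs_act {A : E →ₗ[ℝ] E} (hA : IsSkew A) (S S' : E →ₗ[ℝ] E →ₗ[ℝ] E) :
    hs (act A S) S' = - hs S (act A S') := by
  simp only [hs_apply, act_apply, inner_sub_left, inner_sub_right, Finset.sum_sub_distrib]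
  set e := stdOrthonormalBasis ℝ E
  have h1 : ∑ i, ∑ j, ⟪A (S (e i) (e j)), S' (e i) (e j)⟫ = - ∑ i, ∑ j, ⟪S (e i) (e j), A (S' (e i) (e j))⟫ := by
    simp only [hA _, Finset.sum_neg_distrib]
  have h2 : ∑ i, ∑ j, ⟪S (A (e i)) (e j), S' (e i) (e j)⟫ = - ∑ i, ∑ j, ⟪S (e i) (e j), S' (A (e i)) (e j)⟫ := by
    rw [Finset.sum_comm, Finset.sum_comm (f := fun i j => ⟪S (e i) (e j), S' (A (e i)) (e j)⟫), ← Finset.sum_neg_distrib]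
    refine Finset.sum_congr rfl fun j _ => ?_
    exact sum_skew e hA (LinearMap.mk₂ ℝ (fun u v => ⟪S u (e j), S' v (e j)⟫)
      (fun a b c => by simp [inner_add_left]) (fun a b c => by simp [real_inner_smul_left])
      (fun a b c => by simp [inner_add_right]) (fun a b c => by simp [real_inner_smul_right]))
  have h3 : ∑ i, ∑ j, ⟪S (e i) (A (e j)), S' (e i) (e j)⟫ = - ∑ i, ∑ j, ⟪S (e i) (e j), S' (e i) (A (e j))⟫ := by
    rw [← Finset.sum_neg_distrib]
    refine Finset.sum_congr rfl fun i _ => ?_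
    exact sum_skew e hA (LinearMap.mk₂ ℝ (fun u v => ⟪S (e i) u, S' (e i) v⟫)
      (fun a b c => by simp [inner_add_left]) (fun a b c => by simp [real_inner_smul_left])
      (fun a b c => by simp [inner_add_right]) (fun a b c => by simp [real_inner_smul_right]))
  rw [h1, h2, h3]; ring

theorem exists_frame {M : Type} [AddCommGroup M] [Module ℝ M] [Module.Finite ℝ M] (q : M →ₗ[ℝ] M →ₗ[ℝ] ℝ)
    (hc : ∀ x y, q x y = q y x) (hn : ∀ x, 0 ≤ q x x) (hd : ∀ x, q x x = 0 → x = 0)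
    (N : Submodule ℝ M) :
    ∃ (n : ℕ) (t : Fin n → M), (∀ a, t a ∈ N) ∧ ∀ S ∈ N, S = ∑ a, q (t a) S • t a := by
  let core : InnerProductSpace.Core ℝ M :=
    { inner := fun x y => q x y
      conj_inner_symm := fun x y => by simp [hc]
      re_inner_nonneg := fun x => by simpa using hn x
      add_left := fun x y z => by simp
      smul_left := fun x y r => by simp
      definite := hd }
  letI : NormedAddCommGroup M := core.toNormedAddCommGroup
  letI : InnerProductSpace ℝ M := InnerProductSpace.ofCore core.toCore
  let b := stdOrthonormalBasis ℝ N
  refine ⟨_, fun a => (b a : M), fun a => (b a).2, fun S hS => ?_⟩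
  have h1 := congrArg Subtype.val (b.sum_repr' ⟨S, hS⟩)
  simp only [Submodule.coe_sum, Submodule.coe_smul] at h1
  exact h1.symm

end curv

section forms
variable {E : Type} [NormedAddCommGroup E] [InnerProductSpace ℝ E] [FiniteDimensional ℝ E]

/-- Hilbert-Schmidt form on endomorphisms. -/
def hq : (E →ₗ[ℝ] E) →ₗ[ℝ] (E →ₗ[ℝ] E) →ₗ[ℝ] ℝ :=
  LinearMap.mk₂ ℝ (fun A B => ∑ i, ⟪A (stdOrthonormalBasis ℝ E i), B (stdOrthonormalBasis ℝ E i)⟫)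
    (fun a b c => by simp [inner_add_left, Finset.sum_add_distrib])
    (fun a b c => by simp [real_inner_smul_left, Finset.mul_sum])
    (fun a b c => by simp [inner_add_right, Finset.sum_add_distrib])
    (fun a b c => by simp [real_inner_smul_right, Finset.mul_sum])

theorem hq_apply (A B : E →ₗ[ℝ] E) : hq A B =
    ∑ i, ⟪A (stdOrthonormalBasis ℝ E i), B (stdOrthonormalBasis ℝ E i)⟫ := rfl

theorem hq_comm (A B : E →ₗ[ℝ] E) : hq A B = hq B A := by
  simp only [hq_apply, real_inner_comm]

theorem hq_nonneg (A : E →ₗ[ℝ] E) : 0 ≤ hq A A := by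
  rw [hq_apply]
  exact Finset.sum_nonneg fun i _ => real_inner_self_nonneg

theorem hq_def (A : E →ₗ[ℝ] E) (h : hq A A = 0) : A = 0 := by
  rw [hq_apply, Finset.sum_eq_zero_iff_of_nonneg (fun i _ => real_inner_self_nonneg)] at h
  refine (stdOrthonormalBasis ℝ E).toBasis.ext fun i => ?_
  have h1 := h i (Finset.mem_univ _)
  simpa using h1

theorem hq_trace {A : E →ₗ[ℝ] E} (hA : IsSkew A) (B : E →ₗ[ℝ] E) :
    hq A B = - LinearMap.trace ℝ E (A ∘ₗ B) := by
  rw [LinearMap.trace_eq_sum_inner _ (stdOrthonormalBasis ℝ E), ← Finset.sum_neg_distrib, hq_apply]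
  refine Finset.sum_congr rfl fun i _ => ?_
  rw [hA]; rfl

theorem hq_lie {A : E →ₗ[ℝ] E} (hA : IsSkew A) (B C : E →ₗ[ℝ] E) :
    hq (A ∘ₗ B - B ∘ₗ A) C = - hq B (A ∘ₗ C - C ∘ₗ A) := by
  set e := stdOrthonormalBasis ℝ E with he
  have h1 : ∑ i, ⟪B (A (e i)), C (e i)⟫ = - ∑ i, ⟪B (e i), C (A (e i))⟫ :=
    sum_skew e hA (LinearMap.mk₂ ℝ (fun u v => ⟪B u, C v⟫)
      (fun a b c => by simp [inner_add_left]) (fun a b c => by simp [real_inner_smul_left])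
      (fun a b c => by simp [inner_add_right]) (fun a b c => by simp [real_inner_smul_right]))
  simp only [hq_apply, LinearMap.sub_apply, LinearMap.comp_apply, inner_sub_left, inner_sub_right,
    Finset.sum_sub_distrib, hA (B _), Finset.sum_neg_distrib, ← he]
  rw [h1]; ring

theorem hq_wedge {A : E →ₗ[ℝ] E} (hA : IsSkew A) (x y : E) : hq A (wedge x y) = 2 * ⟪A x, y⟫ := by
  set e := stdOrthonormalBasis ℝ E with he
  have h1 : ∀ x y : E, ∑ i, ⟪A (e i), ⟪x, e i⟫ • y⟫ = ⟪A x, y⟫ := by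
    intro x y
    rw [hA x y, ← e.sum_inner_mul_inner, ← Finset.sum_neg_distrib]
    refine Finset.sum_congr rfl fun i _ => ?_
    rw [real_inner_smul_right, hA]; ring
  rw [hq_apply]
  simp only [wedge_apply, inner_sub_right, Finset.sum_sub_distrib, ← he]
  rw [h1, h1, hA y x, real_inner_comm]; ring

variable {k : Submodule ℝ (E →ₗ[ℝ] E)} {T S : E →ₗ[ℝ] E →ₗ[ℝ] E}

/-- The inverse dimension. -/
def gam (E : Type) [NormedAddCommGroup E] [InnerProductSpace ℝ E] : ℝ := (Module.finrank ℝ E : ℝ)⁻¹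

theorem Ctx.cas (C : Ctx k) (hT : T ∈ prol k) (y : E) : casimir T y = - (gam E * hs T T) • y := by
  by_cases h0 : T = 0
  · subst h0; rw [casimir_apply]; simp
  obtain ⟨c, hc, hcas⟩ := (C.simp hT h0).casimir
  have hcas' : ∀ x, casimir T x = - c • x := by
    intro x; rw [hcas, pr_of_mem Submodule.mem_top]
  have hne : (Module.finrank ℝ E : ℝ) ≠ 0 := by
    have := (C.simp hT h0).finrank
    rw [finrank_top] at this
    positivity
  have h1 : hs T T = c * Module.finrank ℝ E := by
    rw [hs_apply, Finset.sum_comm]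
    have : ∀ j, ∑ i, ⟪T (stdOrthonormalBasis ℝ E i) (stdOrthonormalBasis ℝ E j),
      T (stdOrthonormalBasis ℝ E i) (stdOrthonormalBasis ℝ E j)⟫ = c := by
      intro j
      have h := casimir_inner (C.lie.isTri hT) (stdOrthonormalBasis ℝ E j) (stdOrthonormalBasis ℝ E j)
      rw [hcas', real_inner_smul_left, real_inner_self_eq_norm_sq] at h
      simp at h
      simp [h]
    rw [Finset.sum_congr rfl fun j _ => this j]
    simp [mul_comm]
  rw [hcas', h1, gam]
  congr 1; field_simp

theorem Ctx.tq (C : Ctx k) (hT : T ∈ prol k) (x y : E) :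
    hq (T x) (T y) = gam E * hs T T * ⟪x, y⟫ := by
  rw [hq_trace ((C.lie.isTri hT).isSkew x), trace_eq_casimir (C.lie.isTri hT), C.cas hT,
    real_inner_smul_left]; ring

theorem Ctx.tq2 (C : Ctx k) (hT : T ∈ prol k) (hS : S ∈ prol k) (x y : E) :
    hq (T x) (S y) + hq (S x) (T y) = 2 * gam E * hs T S * ⟪x, y⟫ := by
  have h := C.tq ((prol k).add_mem hT hS) x y
  have h1 := C.tq hT x y
  have h2 := C.tq hS x y
  simp only [LinearMap.add_apply, map_add, hs_comm S T] at h
  linarith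

theorem Ctx.tq3 (C : Ctx k) (hT : T ∈ prol k) (hS : S ∈ prol k) (x : E) :
    hq (T x) (S x) = gam E * hs T S * ⟪x, x⟫ := by
  have := C.tq2 hT hS x x
  rw [hq_comm (S x)] at this; linarith

theorem Ctx.pj (C : Ctx k) (hT : T ∈ prol k) (hS : S ∈ prol k) (x : E) :
    act (S x) T = - act (T x) S := by
  have h := (C.jac _ ((prol k).add_mem hT hS)).act_eq x
  have h1 := (C.jac _ hT).act_eq x
  have h2 := (C.jac _ hS).act_eq x
  simp only [LinearMap.add_apply, act_add_left, act_add_right, h1, h2] at h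
  simp only [zero_add, add_zero] at h
  exact eq_neg_of_add_eq_zero_left h

/-- The comparison endomorphism of two brackets. -/
def MM (T S : E →ₗ[ℝ] E →ₗ[ℝ] E) : E →ₗ[ℝ] E :=
  ∑ i, T (stdOrthonormalBasis ℝ E i) ∘ₗ S (stdOrthonormalBasis ℝ E i)

theorem MM_apply (T S : E →ₗ[ℝ] E →ₗ[ℝ] E) (x : E) : MM T S x =
    ∑ i, T (stdOrthonormalBasis ℝ E i) (S (stdOrthonormalBasis ℝ E i) x) := by simp [MM]

theorem MM_inner (hT : IsTri T) (hS : IsTri S) (x z : E) : ⟪MM T S x, z⟫ = - hq (S x) (T z) := by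
  rw [MM_apply, sum_inner, hq_apply, ← Finset.sum_neg_distrib]
  refine Finset.sum_congr rfl fun i _ => ?_
  rw [hT.skew, hS.swap _ x, hT.swap _ z]; simp

theorem Ctx.MM_anti (C : Ctx k) (hT : T ∈ prol k) (hS : S ∈ prol k) (h : hs T S = 0) :
    MM S T = - MM T S := by
  ext x; apply eq_of_inner; intro z
  rw [LinearMap.neg_apply, inner_neg_left, MM_inner (C.lie.isTri hT) (C.lie.isTri hS),
    MM_inner (C.lie.isTri hS) (C.lie.isTri hT)]
  have := C.tq2 hT hS x z
  rw [h] at this; linarith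

theorem Ctx.MM_eq (C : Ctx k) (hT : T ∈ prol k) (hS : S ∈ prol k) (h : hs T S = 0) :
    MM T S = (1 / 2 : ℝ) • ∑ i, (T (stdOrthonormalBasis ℝ E i) ∘ₗ S (stdOrthonormalBasis ℝ E i)
      - S (stdOrthonormalBasis ℝ E i) ∘ₗ T (stdOrthonormalBasis ℝ E i)) := by
  rw [Finset.sum_sub_distrib]
  change _ = (1 / 2 : ℝ) • (MM T S - MM S T)
  rw [C.MM_anti hT hS h]; module

theorem Ctx.MM_mem (C : Ctx k) (hT : T ∈ prol k) (hS : S ∈ prol k) (h : hs T S = 0) :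
    MM T S ∈ k := by
  rw [C.MM_eq hT hS h]
  exact k.smul_mem _ (k.sum_mem fun i _ => C.lie.lie _ (hT.2 _) _ (hS.2 _))

theorem Ctx.MM_act (C : Ctx k) (hT : T ∈ prol k) (hS : S ∈ prol k) :
    act (MM T S) T = (gam E * hs T T) • S := by
  have tT := C.lie.isTri hT
  have tS := C.lie.isTri hS
  set e := stdOrthonormalBasis ℝ E with he
  have key : ∀ x y, T x (MM T S y) = ∑ i, T (e i) (T x (S (e i) y) - S (T x (e i)) y) := by
    intro x y
    have h1 : ∑ i, T (T x (e i)) (S (e i) y) = - ∑ i, T (e i) (S (T x (e i)) y) :=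
      sum_skew e (tT.isSkew x) (LinearMap.mk₂ ℝ (fun u v => T u (S v y))
        (fun a b c => by simp) (fun a b c => by simp) (fun a b c => by simp) (fun a b c => by simp))
    rw [MM_apply, map_sum]
    simp only [← he, C.jac T hT x, map_sub, Finset.sum_add_distrib, Finset.sum_sub_distrib]
    rw [h1]; abel
  ext x y
  rw [act_apply, tT.swap (MM T S x) y, key x y, key y x, MM_apply, LinearMap.smul_apply,
    LinearMap.smul_apply, ← neg_neg ((gam E * hs T T) • S x y), ← neg_smul, ← C.cas hT, casimir_apply,
    sub_neg_eq_add, ← Finset.sum_neg_distrib, ← Finset.sum_add_distrib, ← Finset.sum_sub_distrib]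
  refine Finset.sum_congr rfl fun i _ => ?_
  rw [← map_add, ← map_sub, ← map_neg]
  congr 1
  have hp := congrArg (fun f => f x y) (C.pj hT hS (e i))
  simp only [act_apply, LinearMap.neg_apply] at hp
  rw [tS.swap (T x (e i)) y, tS.swap (T y (e i)) x, tT.swap x (e i), tT.swap y (e i)]
  rw [tT.swap (S (e i) x) y, tS.swap (T (e i) x) y] at hp
  simp only [map_neg] at hp ⊢
  have : S (e i) (T x y) + T y (S (e i) x) - T x (S (e i) y) + S y (T (e i) x) - S x (T (e i) y) + T (e i) (S x y)= 0 := by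
    rw [← sub_eq_zero] at hp
    rw [← hp]; abel
  rw [← sub_eq_zero, ← this]; abel

theorem hq_MM (hT : IsTri T) (hS : IsTri S) {A : E →ₗ[ℝ] E} (hA : IsSkew A) :
    3 * hq (MM T S) A = hs S (act A T) := by
  set e := stdOrthonormalBasis ℝ E with he
  have h2 : hq (MM T S) A = - ∑ j, ∑ i, ⟪S (e j) (e i), T (A (e j)) (e i)⟫ := by
    rw [hq_apply, ← Finset.sum_neg_distrib]
    refine Finset.sum_congr rfl fun j _ => ?_
    rw [MM_inner hT hS, hq_apply]
  have h3 : ∑ j, ∑ i, ⟪S (e j) (e i), T (e j) (A (e i))⟫ = ∑ j, ∑ i, ⟪S (e j) (e i), T (A (e j)) (e i)⟫ := by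
    rw [Finset.sum_comm]
    refine Finset.sum_congr rfl fun i _ => Finset.sum_congr rfl fun j _ => ?_
    rw [hS.swap, hT.swap]; simp
  have h1 : ∀ j, ∑ i, ⟪S (e j) (e i), A (T (e j) (e i))⟫ = - ∑ i, ⟪S (e j) (e i), T (e j) (A (e i))⟫ := by
    intro j
    have a1 := hq_trace (hS.isSkew (e j)) (A ∘ₗ T (e j))
    have a2 := hq_trace (hS.isSkew (e j)) (T (e j) ∘ₗ A)
    rw [hq_apply] at a1 a2
    simp only [LinearMap.comp_apply, ← he] at a1 a2
    have a3 := trace3_skew (hS.isSkew (e j)) (hT.isSkew (e j)) hA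
    have a4 := trace_comp_comm (A ∘ₗ T (e j)) (S (e j))
    rw [LinearMap.comp_assoc] at a4
    rw [a1, a2, a3, a4]; ring
  rw [hs_apply]
  simp only [act_apply, inner_sub_right, Finset.sum_sub_distrib, ← he]
  rw [Finset.sum_congr rfl fun j _ => h1 j, Finset.sum_neg_distrib, h3, h2]; ring

end forms

section main
variable {E : Type} [NormedAddCommGroup E] [InnerProductSpace ℝ E] [FiniteDimensional ℝ E]
variable {k : Submodule ℝ (E →ₗ[ℝ] E)} {T S : E →ₗ[ℝ] E →ₗ[ℝ] E}

theorem Ctx.gam_pos (C : Ctx k) (hT : T ∈ prol k) (h0 : T ≠ 0) : 0 < gam E := by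
  have := (C.simp hT h0).finrank
  rw [finrank_top] at this
  rw [gam]; positivity

theorem hs_pos (h0 : T ≠ 0) : 0 < hs T T :=
  lt_of_le_of_ne (hs_nonneg T) fun h => h0 (hs_def T h.symm)

theorem hs_perp (h0 : T ≠ 0) (V : E →ₗ[ℝ] E →ₗ[ℝ] E) : ∃ a : ℝ, hs T (V - a • T) = 0 := by
  refine ⟨hs T V / hs T T, ?_⟩
  have := (hs_pos h0).ne'
  rw [map_sub, map_smul, smul_eq_mul]; field_simp; ring

theorem hs_act_self {A : E →ₗ[ℝ] E} (hA : IsSkew A) (T : E →ₗ[ℝ] E →ₗ[ℝ] E) : hs T (act A T) = 0 := by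
  have := hs_act hA T T
  rw [hs_comm] at this; linarith

theorem Ctx.stab (C : Ctx k) (hT : T ∈ prol k) (h0 : T ≠ 0) {A : E →ₗ[ℝ] E} (hA : A ∈ k)
    (h : act A T = 0) : ∃ u, A = T u := by
  refine (C.simp hT h0).derGen (C.lie.skew A hA) (fun x hx => ?_) (fun y => ⟨A y, ?_⟩)
  · simp at hx; simp [hx]
  · have := act_eq_comm A T y
    rw [h] at this
    exact (sub_eq_zero.1 this.symm)

/-- The Lie algebra acts faithfully on its prolongation. -/
def Fa (k : Submodule ℝ (E →ₗ[ℝ] E)) : Prop := ∀ A ∈ k, (∀ V ∈ prol k, act A V = 0) → A = 0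

theorem Ctx.fa (C : Ctx k) (hT : T ∈ prol k) (h0 : T ≠ 0) (hS : S ∈ prol k) (hS0 : S ≠ 0)
    (hTS : hs T S = 0) : Fa k := by
  intro A hA hAV
  by_contra hne
  obtain ⟨u, rfl⟩ := C.stab hT h0 hA (hAV T hT)
  let J : Submodule ℝ E :=
    { carrier := {v | ∀ V ∈ prol k, act (T v) V = 0}
      add_mem' := fun {a b} ha hb V hV => by rw [map_add, act_add_left, ha V hV, hb V hV, add_zero]
      zero_mem' := fun V hV => by ext x y; simp
      smul_mem' := fun c a ha V hV => by rw [map_smul, act_smul_left, ha V hV, smul_zero] }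
  have hJ : ∀ x, ∀ y ∈ J, T x y ∈ J := by
    intro x y hy V hV
    rw [← (C.jac T hT).comm, act_comm, hy V hV, hy _ (C.lie.act_mem hV (hT.2 x))]
    ext a b; simp
  have hall : ∀ v, act (T v) S = 0 := by
    intro v
    rcases (C.simp hT h0).simp J le_top hJ with h | h
    · exfalso
      have hu : u ∈ J := hAV
      rw [h, Submodule.mem_bot] at hu
      rw [hu] at hne; simp at hne
    · have : v ∈ J := by rw [h]; trivial
      exact this S hS
  have h1 := C.MM_act hT hS
  have h2 : act (MM T S) T = 0 := by
    rw [C.MM_eq hT hS hTS, act_smul_left]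
    have : ∀ s : Finset (Fin (Module.finrank ℝ E)), act (∑ i ∈ s, (T (stdOrthonormalBasis ℝ E i) ∘ₗ S (stdOrthonormalBasis ℝ E i)
      - S (stdOrthonormalBasis ℝ E i) ∘ₗ T (stdOrthonormalBasis ℝ E i))) T = 0 := by
      intro s
      induction s using Finset.induction_on with
      | empty => ext a b; simp
      | insert i s hi ih =>
        rw [Finset.sum_insert hi, act_add_left, ih, act_comm, (C.jac T hT).act_eq, C.pj hT hS, hall]
        ext a b; simp
    rw [this, smul_zero]
  rw [h2] at h1
  rcases smul_eq_zero.1 h1.symm with h | h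
  · exact (mul_pos (C.gam_pos hT h0) (hs_pos h0)).ne' h
  · exact hS0 h

theorem Ctx.stabx (C : Ctx k) (F : Fa k) (hT : T ∈ prol k) (h0 : T ≠ 0) {A : E →ₗ[ℝ] E} (hA : A ∈ k)
    {x : E} (hx : x ≠ 0) (h : A x = 0) : ∃ V ∈ prol k, A = V x := by
  obtain ⟨n, t, htm, hexp⟩ := exists_frame (hs (E := E)) hs_comm hs_nonneg hs_def (prol k)
  have hg : gam E * ⟪x, x⟫ ≠ 0 := mul_ne_zero (C.gam_pos hT h0).ne' (by simpa using hx)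
  let V := ∑ a, (hq A (t a x) / (gam E * ⟪x, x⟫)) • t a
  have hV : V ∈ prol k := (prol k).sum_mem fun a _ => (prol k).smul_mem _ (htm a)
  have hVW : ∀ W ∈ prol k, hq (A - V x) (W x) = 0 := by
    intro W hW
    have e1 : hq (V x) (W x) = hq A (W x) := by
      rw [C.tq3 hV hW]
      conv_rhs => rw [hexp W hW]
      simp only [V, map_sum, LinearMap.sum_apply, LinearMap.smul_apply, map_smul, smul_eq_mul,
        Finset.sum_mul, Finset.mul_sum]
      refine Finset.sum_congr rfl fun a _ => ?_
      rw [div_mul_eq_mul_div, mul_div_assoc', div_mul_eq_mul_div, div_eq_iff hg]; ring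
    rw [map_sub, LinearMap.sub_apply, e1, sub_self]
  refine ⟨V, hV, ?_⟩
  set D := A - V x with hD
  have hDk : D ∈ k := k.sub_mem hA (hV.2 x)
  have hDx : D x = 0 := by simp [hD, h, hV.1]
  have : D = 0 := by
    apply F D hDk
    intro W hW
    have hc : ∀ B ∈ k, B x = 0 → ∀ W, act B W x = B ∘ₗ W x - W x ∘ₗ B := by
      intro B _ hB W
      rw [act_eq_comm, hB, map_zero, sub_zero]
    have hm := C.lie.act_mem hW hDk
    apply hs_def
    have h1 : hq (act D W x) (act D W x) = 0 := by
      conv_lhs => enter [1, 2]; rw [hc D hDk hDx]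
      rw [hq_comm, ← neg_neg (D ∘ₗ W x - W x ∘ₗ D), neg_sub, map_neg, hq_comm,
        hq_lie ((C.lie.isTri hW).isSkew x), neg_neg, ← hc _ (hW.2 x) (hW.1 x)]
      exact hVW _ (C.lie.act_mem hm (hW.2 x))
    rw [C.tq3 hm hm] at h1
    rw [mul_right_comm] at h1
    exact (mul_eq_zero.1 h1).resolve_left hg
  exact sub_eq_zero.1 this

/-- The orthogonal projection of wedges to `k`. -/
structure PP (k : Submodule ℝ (E →ₗ[ℝ] E)) (P : E →ₗ[ℝ] E →ₗ[ℝ] E →ₗ[ℝ] E) : Prop where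
  mem : ∀ x y, P x y ∈ k
  dual : ∀ x y, ∀ A ∈ k, hq (P x y) A = 2 * ⟪A x, y⟫

theorem exists_PP (k : Submodule ℝ (E →ₗ[ℝ] E)) : ∃ P, PP k P := by
  obtain ⟨n, t, htm, hexp⟩ := exists_frame (hq (E := E)) hq_comm hq_nonneg hq_def k
  refine ⟨LinearMap.mk₂ ℝ (fun x y => ∑ a, (2 * ⟪t a x, y⟫) • t a)
    (fun a b c => by simp [inner_add_left, Finset.sum_add_distrib, mul_add, add_smul])
    (fun a b c => by
      simp only [map_smul, real_inner_smul_left, Finset.smul_sum, smul_smul]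
      exact Finset.sum_congr rfl fun i _ => by congr 1; ring)
    (fun a b c => by simp [inner_add_right, Finset.sum_add_distrib, mul_add, add_smul])
    (fun a b c => by
      simp only [map_smul, real_inner_smul_right, Finset.smul_sum, smul_smul]
      exact Finset.sum_congr rfl fun i _ => by congr 1; ring), ?_, ?_⟩
  · intro x y
    rw [LinearMap.mk₂_apply]
    exact k.sum_mem fun a _ => k.smul_mem _ (htm a)
  · intro x y A hA
    conv_rhs => rw [hexp A hA]
    simp only [LinearMap.mk₂_apply, map_sum, LinearMap.sum_apply, map_smul, LinearMap.smul_apply,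
      sum_inner, real_inner_smul_left, Finset.mul_sum, smul_eq_mul]
    exact Finset.sum_congr rfl fun i _ => by ring

variable {P : E →ₗ[ℝ] E →ₗ[ℝ] E →ₗ[ℝ] E}

theorem hq_ext {A B : E →ₗ[ℝ] E} (hA : A ∈ k) (hB : B ∈ k) (h : ∀ D ∈ k, hq A D = hq B D) : A = B := by
  rw [← sub_eq_zero]
  apply hq_def
  have := h _ (k.sub_mem hA hB)
  have h2 : hq (A - B) = hq A - hq B := map_sub _ _ _
  rw [h2, LinearMap.sub_apply, this, sub_self]

theorem PP.pair (p : PP k P) (x y z w : E) : ⟪P x y z, w⟫ = ⟪P z w x, y⟫ := by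
  have h1 := p.dual z w _ (p.mem x y)
  have h2 := p.dual x y _ (p.mem z w)
  rw [hq_comm] at h1; linarith

theorem PP.swap (p : PP k P) (C : Ctx k) (x y : E) : P x y = - P y x := by
  refine hq_ext (p.mem x y) (k.neg_mem (p.mem y x)) fun D hD => ?_
  rw [map_neg, LinearMap.neg_apply, p.dual _ _ D hD, p.dual _ _ D hD, C.lie.skew D hD, real_inner_comm]
  ring

theorem PP.self (p : PP k P) (C : Ctx k) (x : E) : P x x = 0 := by
  have := p.swap C x x
  have h2 : (2 : ℝ) • P x x = 0 := by rw [two_smul]; nth_rewrite 1 [this]; simp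
  exact (smul_eq_zero.1 h2).resolve_left (by norm_num)

theorem PP.inv (p : PP k P) (C : Ctx k) {A : E →ₗ[ℝ] E} (hA : A ∈ k) (x y : E) :
    A ∘ₗ P x y - P x y ∘ₗ A = P (A x) y + P x (A y) := by
  refine hq_ext (C.lie.lie _ hA _ (p.mem x y)) (k.add_mem (p.mem _ _) (p.mem _ _)) fun D hD => ?_
  rw [hq_lie (C.lie.skew A hA), p.dual _ _ _ (C.lie.lie _ hA _ hD), map_add, LinearMap.add_apply,
    p.dual _ _ D hD, p.dual _ _ D hD]
  simp only [LinearMap.sub_apply, LinearMap.comp_apply, inner_sub_left, C.lie.skew A hA (D x)]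
  ring

theorem PP.sym (p : PP k P) (x y z : E) : ⟪P x y x, z⟫ = ⟪P x z x, y⟫ := p.pair x y x z

theorem PP.comm (p : PP k P) (C : Ctx k) {A : E →ₗ[ℝ] E} (hA : A ∈ k) {x : E} (hx : A x = 0) (y : E) :
    A (P x y x) = P x (A y) x := by
  have := congrArg (fun f => f x) (p.inv C hA x y)
  simpa [hx] using this

theorem PP.key0 (p : PP k P) (C : Ctx k) (F : Fa k) (hT : T ∈ prol k) (h0 : T ≠ 0) {x y : E} (hx : x ≠ 0)
    (hxy : ⟪x, y⟫ = 0) (z : E) :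
    ⟪(gam E * hs T T) • P x y x + (2 : ℝ) • T x (T x y), P x z x⟫ =
      6 * gam E * ⟪x, x⟫ * ⟪(gam E * hs T T) • P x y x + (2 : ℝ) • T x (T x y), z⟫ := by
  have tT := C.lie.isTri hT
  have hc : 0 < gam E * hs T T := mul_pos (C.gam_pos hT h0) (hs_pos h0)
  have hPs := C.lie.skew _ (p.mem x y)
  set S := act (P x y) T with hSd
  have hS : S ∈ prol k := C.lie.act_mem hT (p.mem x y)
  have tS := C.lie.isTri hS
  have hTS : hs T S = 0 := hs_act_self hPs T
  have hM := C.MM_mem hT hS hTS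
  obtain ⟨u, hu⟩ : ∃ u, (gam E * hs T T) • P x y - MM T S = T u := by
    refine C.stab hT h0 (k.sub_mem (k.smul_mem _ (p.mem x y)) hM) ?_
    rw [act_sub_left, act_smul_left, C.MM_act hT hS, sub_self]
  have hu2 : u = (2 : ℝ) • T x y := by
    apply eq_of_inner; intro v
    have h1 := congrArg (fun f => hq f (T v)) hu
    simp only [map_sub, LinearMap.sub_apply, map_smul, LinearMap.smul_apply, smul_eq_mul] at h1
    have h2 := hq_MM tT tS (tT.isSkew v)
    rw [(C.jac T hT).act_eq, map_zero] at h2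
    rw [p.dual _ _ _ (hT.2 v), C.tq hT, (by linarith : hq (MM T S) (T v) = 0), tT.cyc] at h1
    rw [real_inner_smul_left]
    have := mul_left_cancel₀ hc.ne' (by linarith : (gam E * hs T T) * ⟪u, v⟫ = (gam E * hs T T) * (2 * ⟪T x y, v⟫))
    exact this
  have hG : (gam E * hs T T) • P x y x + (2 : ℝ) • T x (T x y) = MM T S x := by
    have h1 := congrArg (fun f => f x) hu
    simp only [LinearMap.sub_apply, LinearMap.smul_apply] at h1
    rw [tT.swap u x, hu2, map_smul, sub_eq_iff_eq_add] at h1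
    rw [h1]; abel
  obtain ⟨V, hV, hVe⟩ : ∃ V ∈ prol k, T (P x z x) + P x (T x z) = V x := by
    refine C.stabx F hT h0 (k.add_mem (hT.2 _) (p.mem _ _)) hx ?_
    rw [LinearMap.add_apply, tT.swap, p.comm C (hT.2 x) (tT.alt x)]; simp
  obtain ⟨a, ha⟩ := hs_perp h0 V
  have hV' : V - a • T ∈ prol k := (prol k).sub_mem hV ((prol k).smul_mem _ hT)
  have e1 : hs V S = -6 * hq (V x) (T y) := by
    have h1 := hq_MM tT (C.lie.isTri hV') hPs
    rw [hq_comm, p.dual _ _ _ (C.MM_mem hT hV' ha), MM_inner tT (C.lie.isTri hV')] at h1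
    simp only [map_sub, LinearMap.sub_apply, map_smul, LinearMap.smul_apply, smul_eq_mul, C.tq hT, hxy] at h1
    rw [← hSd, hTS] at h1
    linarith
  have e2 : hq (V x) (T y) = gam E * hs T T * ⟪P x y x, z⟫ + 2 * ⟪T x (T x y), z⟫ := by
    rw [← hVe, map_add, LinearMap.add_apply, C.tq hT, p.dual _ _ _ (hT.2 y), p.sym x y z, tT.swap y x,
      inner_neg_left, tT.skew x (T x y) z]
  have e3 : ⟪MM T S x, P x z x⟫ = - (gam E * ⟪x, x⟫ * hs V S) := by
    rw [MM_inner tT tS]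
    have h1 : hq (S x) (V x) = hq (S x) (T (P x z x)) := by
      rw [← hVe, map_add, hq_comm (S x) (P x (T x z)), p.dual _ _ _ (hS.2 x), tS.alt]; simp
    rw [← h1, C.tq3 hS hV, hs_comm]; ring
  rw [hG, e3, e1, e2, ← hG, inner_add_left, real_inner_smul_left, real_inner_smul_left]; ring

/-- The operator whose vanishing is constancy of curvature. -/
def QQ (P : E →ₗ[ℝ] E →ₗ[ℝ] E →ₗ[ℝ] E) (x : E) : E →ₗ[ℝ] E :=
  (P x).flip x - (6 * gam E * ⟪x, x⟫) • LinearMap.id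

theorem QQ_apply (x y : E) : QQ P x y = P x y x - (6 * gam E * ⟪x, x⟫) • y := by simp [QQ]

theorem PP.key (p : PP k P) (C : Ctx k) (F : Fa k) (hT : T ∈ prol k) {x y : E} (hx : x ≠ 0)
    (hxy : ⟪x, y⟫ = 0) :
    (gam E * hs T T) • P x (QQ P x y) x + (2 : ℝ) • T x (T x (QQ P x y)) = 0 := by
  by_cases h0 : T = 0
  · subst h0; simp
  have tT := C.lie.isTri hT
  apply eq_zero_of_inner; intro z
  have h := p.key0 C F hT h0 hx hxy z
  have c1 : ∀ y, T x (P x y x) = P x (T x y) x := fun y => p.comm C (hT.2 x) (tT.alt x) y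
  have e : (gam E * hs T T) • P x (QQ P x y) x + (2 : ℝ) • T x (T x (QQ P x y)) =
      QQ P x ((gam E * hs T T) • P x y x + (2 : ℝ) • T x (T x y)) := by
    simp only [QQ_apply, map_sub, map_smul, map_add, c1, LinearMap.sub_apply, LinearMap.add_apply,
      LinearMap.smul_apply, smul_sub, smul_add]
  rw [e, QQ_apply, inner_sub_left, p.sym, real_inner_comm, h, real_inner_smul_left, sub_self]

theorem PP.trans (p : PP k P) (C : Ctx k) (F : Fa k) (hT : T ∈ prol k) (h0 : T ≠ 0) {x y : E} (hx : x ≠ 0)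
    (hxy : ⟪x, y⟫ = 0) (h : P x y x = 0) : y = 0 := by
  have tT := C.lie.isTri hT
  have hP : P x y = 0 := by
    apply hq_def
    rw [p.dual _ _ _ (p.mem x y), h]; simp
  have hk : ∀ A ∈ k, ⟪A x, y⟫ = 0 := by
    intro A hA
    have := p.dual x y A hA
    rw [hP, map_zero, LinearMap.zero_apply] at this; linarith
  have h1 : T x y = 0 := by
    apply eq_zero_of_inner; intro u
    rw [← tT.cyc, hk _ (hT.2 u)]
  obtain ⟨V, hV, hVe⟩ := C.stabx F hT h0 (hT.2 y) hx (by rw [tT.swap, h1, neg_zero])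
  obtain ⟨a, ha⟩ := hs_perp h0 V
  have hV' : V - a • T ∈ prol k := (prol k).sub_mem hV ((prol k).smul_mem _ hT)
  have h2 := hk _ (C.MM_mem hT hV' ha)
  rw [MM_inner tT (C.lie.isTri hV')] at h2
  simp only [map_sub, LinearMap.sub_apply, map_smul, LinearMap.smul_apply, smul_eq_mul, C.tq hT, hxy] at h2
  rw [← hVe] at h2
  have h3 : T y = 0 := hq_def _ (by linarith)
  by_contra hy
  exact h0 (C.nondeg T hT y hy h3)

end main

section main8
variable {E : Type} [NormedAddCommGroup E] [InnerProductSpace ℝ E] [FiniteDimensional ℝ E]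
variable {k : Submodule ℝ (E →ₗ[ℝ] E)} {T S U : E →ₗ[ℝ] E →ₗ[ℝ] E}
variable {P : E →ₗ[ℝ] E →ₗ[ℝ] E →ₗ[ℝ] E}

theorem PP.qcomm (p : PP k P) (C : Ctx k) (hS : S ∈ prol k) (x z : E) :
    S x (QQ P x z) = QQ P x (S x z) := by
  rw [QQ_apply, QQ_apply, map_sub, map_smul, p.comm C (hS.2 x) ((C.lie.isTri hS).alt x)]

theorem PP.qperp (p : PP k P) (C : Ctx k) {x z : E} (hz : ⟪x, z⟫ = 0) : ⟪x, QQ P x z⟫ = 0 := by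
  have : ⟪P x z x, x⟫ = 0 := (C.lie.skew _ (p.mem x z)).inner_self x
  rw [QQ_apply, inner_sub_right, real_inner_smul_right, hz, real_inner_comm, this]; simp

theorem Ctx.sperp (C : Ctx k) (hS : S ∈ prol k) (x z : E) : ⟪x, S x z⟫ = 0 := by
  rw [real_inner_comm]; exact (C.lie.isTri hS).inner_self' x z

theorem PP.pol (p : PP k P) (C : Ctx k) (F : Fa k) (hT : T ∈ prol k) (hS : S ∈ prol k)
    (h : hs T S = 0) {x z : E} (hx : x ≠ 0) (hz : ⟪x, z⟫ = 0) :
    T x (S x (QQ P x z)) = - S x (T x (QQ P x z)) := by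
  have k1 := p.key C F hT hx hz
  have k2 := p.key C F hS hx hz
  have k3 := p.key C F ((prol k).add_mem hT hS) hx hz
  have e : hs (T + S) (T + S) = hs T T + hs S S := by
    simp only [map_add, LinearMap.add_apply, hs_comm S T, h]; ring
  rw [e] at k3
  simp only [LinearMap.add_apply, map_add] at k3
  have : (2 : ℝ) • (T x (S x (QQ P x z)) + S x (T x (QQ P x z))) = 0 := by
    linear_combination (norm := module) k3 - k1 - k2
  exact eq_neg_of_add_eq_zero_left ((smul_eq_zero.1 this).resolve_left (by norm_num))

theorem PP.qinj (p : PP k P) (C : Ctx k) (F : Fa k) (hT : T ∈ prol k) (h0 : T ≠ 0) {x z : E}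
    (hx : x ≠ 0) (hz : ⟪x, z⟫ = 0) (h : T x (QQ P x z) = 0) : QQ P x z = 0 := by
  have k1 := p.key C F hT hx hz
  rw [h, map_zero, smul_zero, add_zero] at k1
  have hne : gam E * hs T T ≠ 0 := (mul_pos (C.gam_pos hT h0) (hs_pos h0)).ne'
  exact p.trans C F hT h0 hx (p.qperp C hz) ((smul_eq_zero.1 k1).resolve_left hne)

theorem PP.small (p : PP k P) (C : Ctx k) (F : Fa k) (hT : T ∈ prol k) (h0 : T ≠ 0)
    (hS : S ∈ prol k) (hS0 : S ≠ 0) (hTS : hs T S = 0) {x y : E} (hx : x ≠ 0) (hxy : ⟪x, y⟫ = 0)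
    (hQ : QQ P x y ≠ 0) (hU : U ∈ prol k) (h1 : hs T U = 0) (h2 : hs S U = 0)
    (h3 : hs (act (T x) S) U = 0) : U = 0 := by
  by_contra hU0
  have hV : act (T x) S ∈ prol k := C.lie.act_mem hS (hT.2 x)
  have v : ∀ w, act (T x) S x w = T x (S x w) - S x (T x w) := by
    intro w; simp [(C.lie.isTri hT).alt x]
  have vq : ∀ z, ⟪x, z⟫ = 0 → act (T x) S x (QQ P x z) = (2 : ℝ) • T x (S x (QQ P x z)) := by
    intro z hz
    have := p.pol C F hT hS hTS hx hz
    rw [v, two_smul]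
    nth_rewrite 3 [this]; abel
  have a1 := p.pol C F hV hU h3 hx hxy
  rw [p.qcomm C hU, vq _ (C.sperp hU x y), vq y hxy, map_smul] at a1
  have a2 : U x (T x (S x (QQ P x y))) = T x (S x (QQ P x (U x y))) := by
    have b1 := p.pol C F hT hU h1 hx (C.sperp hS x y)
    have b2 := p.pol C F hS hU h2 hx hxy
    rw [← p.qcomm C hU, b2, map_neg, p.qcomm C hS, b1, neg_neg]
  rw [a2] at a1
  have a3 : T x (S x (QQ P x (U x y))) = 0 := by
    have : (4 : ℝ) • T x (S x (QQ P x (U x y))) = 0 := by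
      linear_combination (norm := module) a1
    exact (smul_eq_zero.1 this).resolve_left (by norm_num)
  rw [p.qcomm C hS] at a3
  have a4 := p.qinj C F hT h0 hx (C.sperp hS _ _) a3
  rw [← p.qcomm C hS] at a4
  have a5 := p.qinj C F hS hS0 hx (C.sperp hU _ _) a4
  rw [← p.qcomm C hU] at a5
  exact hQ (p.qinj C F hU hU0 hx hxy a5)

theorem Ctx.perp_act (C : Ctx k) (hT : T ∈ prol k) (hS : S ∈ prol k) (u : E) :
    hs T (act (T u) S) = 0 := by
  rw [C.pj hS hT, map_neg, hs_act_self (C.lie.skew _ (hS.2 u)), neg_zero]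

theorem PP.constL (p : PP k P) (C : Ctx k) (F : Fa k) (hT : T ∈ prol k) (h0 : T ≠ 0)
    {x y : E} (hx : x ≠ 0) (hxy : ⟪x, y⟫ = 0) : QQ P x y = 0 := by
  by_contra hQ
  have key : ∀ S ∈ prol k, hs T S = 0 → ∀ u v, act (T (T u v)) S = 0 := by
    intro S hS hTS u v
    by_cases hS0 : S = 0
    · subst hS0; ext; simp
    set V := act (T x) S with hVd
    have hV : V ∈ prol k := C.lie.act_mem hS (hT.2 x)
    have hTV : hs T V = 0 := C.perp_act hT hS x
    have hSV : hs S V = 0 := hs_act_self (C.lie.skew _ (hT.2 x)) S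
    have c1 : ∀ u, ∃ c : ℝ, act (T u) S = c • V := by
      intro u
      by_cases hV0 : V = 0
      · refine ⟨0, ?_⟩
        rw [zero_smul]
        exact p.small C F hT h0 hS hS0 hTS hx hxy hQ (C.lie.act_mem hS (hT.2 u)) (C.perp_act hT hS u)
          (hs_act_self (C.lie.skew _ (hT.2 u)) S) (by rw [← hVd, hV0]; simp)
      · obtain ⟨c, hc⟩ := hs_perp hV0 (act (T u) S)
        refine ⟨c, sub_eq_zero.1 ?_⟩
        refine p.small C F hT h0 hS hS0 hTS hx hxy hQ
          ((prol k).sub_mem (C.lie.act_mem hS (hT.2 u)) ((prol k).smul_mem _ hV)) ?_ ?_ hc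
        · rw [map_sub, map_smul, hTV, C.perp_act hT hS u]; simp
        · rw [map_sub, map_smul, hSV, hs_act_self (C.lie.skew _ (hT.2 u)) S]; simp
    have c2 : ∀ u, ∃ d : ℝ, act (T u) V = d • S := by
      intro u
      obtain ⟨c, hc⟩ := hs_perp hS0 (act (T u) V)
      refine ⟨c, sub_eq_zero.1 ?_⟩
      refine p.small C F hT h0 hS hS0 hTS hx hxy hQ
        ((prol k).sub_mem (C.lie.act_mem hV (hT.2 u)) ((prol k).smul_mem _ hS)) ?_ hc ?_
      · rw [map_sub, map_smul, hTS, C.perp_act hT hV u]; simp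
      · rw [← hVd, map_sub, map_smul, hs_comm V S, hSV, hs_act_self (C.lie.skew _ (hT.2 u)) V]; simp
    obtain ⟨cu, hcu⟩ := c1 u
    obtain ⟨cv, hcv⟩ := c1 v
    obtain ⟨du, hdu⟩ := c2 u
    obtain ⟨dv, hdv⟩ := c2 v
    have e : act (T (T u v)) S = (cv * du - cu * dv) • S := by
      rw [← (C.jac T hT).comm, act_comm, hcu, hcv, act_smul_right, act_smul_right, hdu, hdv]
      module
    have e2 := hs_act_self (C.lie.skew _ (hT.2 (T u v))) S
    rw [e, map_smul, smul_eq_mul] at e2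
    rw [e, (mul_eq_zero.1 e2).resolve_right (hs_pos hS0).ne', zero_smul]
  apply h0
  ext u v
  by_contra hne
  refine h0 (C.nondeg T hT (T u v) hne (F _ (hT.2 _) fun V hV => ?_))
  obtain ⟨a, ha⟩ := hs_perp h0 V
  have := key _ ((prol k).sub_mem hV ((prol k).smul_mem a hT)) ha u v
  have e : V = (V - a • T) + a • T := by abel
  rw [e, act_add_right, this, act_smul_right, (C.jac T hT).act_eq]; simp

end main8

section main9
variable {E : Type} [NormedAddCommGroup E] [InnerProductSpace ℝ E] [FiniteDimensional ℝ E]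
variable {k : Submodule ℝ (E →ₗ[ℝ] E)} {T S U : E →ₗ[ℝ] E →ₗ[ℝ] E}
variable {P : E →ₗ[ℝ] E →ₗ[ℝ] E →ₗ[ℝ] E}

/-- The difference between the projected curvature operator and constant curvature. -/
def Om (P : E →ₗ[ℝ] E →ₗ[ℝ] E →ₗ[ℝ] E) (x y z w : E) : ℝ :=
  ⟪P x y z, w⟫ - (6 * gam E) * ⟪wedge x y z, w⟫

theorem PP.om0 (p : PP k P) (C : Ctx k) (F : Fa k) (hT : T ∈ prol k) (h0 : T ≠ 0) (x y : E) :
    P x y x = (6 * gam E) • wedge x y x := by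
  by_cases hx : x = 0
  · subst hx; simp
  have hxx : ⟪x, x⟫ ≠ 0 := fun h => hx (inner_self_eq_zero.1 h)
  have hperp : ⟪x, y - (⟪x, y⟫ / ⟪x, x⟫) • x⟫ = 0 := by
    rw [inner_sub_right, real_inner_smul_right]; field_simp; ring
  have := p.constL C F hT h0 hx hperp
  rw [QQ_apply, map_sub, map_smul, p.self C, smul_zero, sub_zero] at this
  rw [sub_eq_zero.1 this, wedge_apply, smul_sub, smul_smul, smul_sub, smul_smul, smul_smul,
    real_inner_comm y x]
  congr 2
  field_simp

theorem PP.gam_eq (p : PP k P) (C : Ctx k) (F : Fa k) (hT : T ∈ prol k) (h0 : T ≠ 0) :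
    gam E = 1 / 6 := by
  have tT := C.lie.isTri hT
  have o1 : ∀ x y z w, Om P x y z w = - Om P y x z w := by
    intro x y z w
    rw [Om, Om, p.swap C x y]
    simp only [wedge_apply, LinearMap.neg_apply, inner_neg_left, inner_sub_left]; ring
  have o2 : ∀ x y z w, Om P x y z w = - Om P x y w z := by
    intro x y z w
    rw [Om, Om, C.lie.skew _ (p.mem x y), isSkew_wedge x y z w, real_inner_comm,
      real_inner_comm (wedge x y w)]; ring
  have o3 : ∀ x y z w, Om P x y z w = - Om P z y x w := by
    intro x y z w
    have a := p.om0 C F hT h0 (x + z) y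
    have b := p.om0 C F hT h0 x y
    have c := p.om0 C F hT h0 z y
    have a' := congrArg (fun v => ⟪v, w⟫) a
    have b' := congrArg (fun v => ⟪v, w⟫) b
    have c' := congrArg (fun v => ⟪v, w⟫) c
    simp only [map_add, LinearMap.add_apply, wedge_apply, inner_add_left, inner_add_right,
      real_inner_smul_left, inner_sub_left, add_smul, smul_add] at a' b' c'
    simp only [Om, wedge_apply, inner_sub_left, real_inner_smul_left]
    linarith
  have o4 : ∀ a x y z w, ⟪T a (P x y z), w⟫ - ⟪P x y (T a z), w⟫
      - (6 * gam E) * (⟪T a (wedge x y z), w⟫ - ⟪wedge x y (T a z), w⟫) =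
      Om P (T a x) y z w + Om P x (T a y) z w := by
    intro a x y z w
    have h1 := congrArg (fun f => ⟪f z, w⟫) (p.inv C (hT.2 a) x y)
    have h2 := congrArg (fun f => ⟪f z, w⟫) (comm_wedge (tT.isSkew a) x y)
    simp only [LinearMap.sub_apply, LinearMap.comp_apply, LinearMap.add_apply, inner_sub_left,
      inner_add_left] at h1 h2
    rw [h1, h2, Om, Om]; ring
  have o5 : ∀ a x y z w, - Om P x y z (T a w) - Om P x y (T a z) w =
      Om P (T a x) y z w + Om P x (T a y) z w := by
    intro a x y z w
    rw [← o4, Om, Om, tT.isSkew a, tT.isSkew a]; ring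
  set e := stdOrthonormalBasis ℝ E with he
  have hP : ∀ u, ∑ i, P (e i) (T u (e i)) = (2 : ℝ) • T u := by
    intro u
    refine hq_ext (k.sum_mem fun i _ => p.mem _ _) (k.smul_mem _ (hT.2 u)) fun D hD => ?_
    rw [map_sum, LinearMap.sum_apply, map_smul, LinearMap.smul_apply, hq_comm, hq_apply, smul_eq_mul,
      Finset.mul_sum]
    exact Finset.sum_congr rfl fun i _ => p.dual _ _ D hD
  have hW : ∀ u z w, ∑ i, ⟪wedge (e i) (T u (e i)) z, w⟫ = 2 * ⟪T u z, w⟫ := by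
    intro u z w
    simp only [wedge_apply, inner_sub_left, real_inner_smul_left, Finset.sum_sub_distrib]
    have h1 : ∑ i, ⟪e i, z⟫ * ⟪T u (e i), w⟫ = ⟪T u z, w⟫ := by
      rw [tT.isSkew u z w, ← e.sum_inner_mul_inner z, ← Finset.sum_neg_distrib]
      exact Finset.sum_congr rfl fun i _ => by rw [tT.isSkew u (e i) w, real_inner_comm]; ring
    have h2 : ∑ i, ⟪T u (e i), z⟫ * ⟪e i, w⟫ = - ⟪T u z, w⟫ := by
      rw [← e.sum_inner_mul_inner (T u z), ← Finset.sum_neg_distrib]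
      exact Finset.sum_congr rfl fun i _ => by rw [tT.isSkew u (e i) z, real_inner_comm]; ring
    rw [h1, h2]; ring
  have hΦ : ∀ u z w, ∑ i, Om P (e i) (T u (e i)) z w = (2 - 12 * gam E) * ⟪T u z, w⟫ := by
    intro u z w
    simp only [Om, Finset.sum_sub_distrib, ← Finset.mul_sum, hW]
    rw [← sum_inner, ← LinearMap.sum_apply, hP, LinearMap.smul_apply, real_inner_smul_left]; ring
  have n3 : ∀ x y z w, Om P x y z (-w) = - Om P x y z w := by intros; simp [Om]; ring
  have n2 : ∀ x y z w, Om P x y (-z) w = - Om P x y z w := by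
    intro x y z w; rw [o2, n3, o2]; ring
  have n1 : ∀ x y z w, Om P x (-y) z w = - Om P x y z w := by
    intro x y z w; simp only [Om, wedge_apply, map_neg, LinearMap.neg_apply, inner_neg_left, inner_sub_left, real_inner_smul_left]; ring
  have n0 : ∀ y z w, Om P 0 y z w = 0 := by intros; simp [Om]
  have fin : ∀ u z w, (2 - 12 * gam E) * ⟪T u z, w⟫ = 0 := by
    intro u z w
    have h : ∀ i, Om P (e i) (T w (e i)) u z - Om P (e i) (T z (e i)) u w = - Om P (e i) (T u (e i)) z w := by
      intro i
      have := o5 (e i) (e i) u z w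
      rw [tT.alt, n0, zero_add, tT.swap (e i) u, tT.swap (e i) w, tT.swap (e i) z, n1, n2, n3] at this
      rw [← this, o2 (e i) u z (T w (e i)), o1 (e i) u (T w (e i)), o3 u (e i) (T w (e i)) z,
        o1 (T w (e i)), o1 (e i) u (T z (e i)), o3 u (e i) (T z (e i)), o1 (T z (e i))]
      ring
    have hs := Finset.sum_congr (rfl : (Finset.univ : Finset _) = Finset.univ) fun i _ => h i
    rw [Finset.sum_sub_distrib, Finset.sum_neg_distrib, hΦ, hΦ, hΦ] at hs
    have h1 : ⟪T w u, z⟫ = ⟪T u z, w⟫ := tT.cyc w u z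
    have h2 : ⟪T z u, w⟫ = - ⟪T u z, w⟫ := by rw [tT.swap z u]; simp
    rw [h1, h2] at hs
    linarith
  by_contra hg
  apply h0
  ext u z
  apply eq_zero_of_inner; intro w
  have := fin u z w
  refine (mul_eq_zero.1 this).resolve_left fun h => hg ?_
  linarith

theorem Ctx.dichotomy (C : Ctx k) (hT : T ∈ prol k) (h0 : T ≠ 0) :
    (∀ A ∈ k, ∃ x, A = T x) ∨ (∀ x y, wedge x y ∈ k) := by
  by_cases h : ∀ S ∈ prol k, hs T S = 0 → S = 0
  · left
    intro A hA
    exact C.stab hT h0 hA (h _ (C.lie.act_mem hT hA) (hs_act_self (C.lie.skew _ hA) T))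
  · right
    push Not at h
    obtain ⟨S, hS, hTS, hS0⟩ := h
    have F := C.fa hT h0 hS hS0 hTS
    obtain ⟨P, p⟩ := exists_PP k
    have hg := p.gam_eq C F hT h0
    intro x y
    have e := p.om0 C F hT h0 x y
    rw [hg, show (6 : ℝ) * (1 / 6) = 1 by norm_num, one_smul] at e
    have : P x y - wedge x y = 0 := by
      apply hq_def
      have h1 := hq_wedge (C.lie.skew _ (p.mem x y)) x y
      have h2 := hq_wedge (isSkew_wedge x y) x y
      have h3 := p.dual x y _ (p.mem x y)
      have h4 := hq_comm (P x y) (wedge x y)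
      rw [e] at h1 h3
      simp only [map_sub, LinearMap.sub_apply]
      linarith
    rw [← sub_eq_zero.1 this]
    exact p.mem x y

end main9

section main10
variable {E : Type} [NormedAddCommGroup E] [InnerProductSpace ℝ E] [FiniteDimensional ℝ E]

/-- Orthogonal projection onto `U`, valued in `U`. -/
def prU (U : Submodule ℝ E) : E →ₗ[ℝ] U := LinearMap.codRestrict U (pr U) (pr_mem U)

theorem prU_coe (U : Submodule ℝ E) (x : E) : (prU U x : E) = pr U x := rfl

theorem prU_of (U : Submodule ℝ E) (x : U) : prU U (x : E) = x :=
  Subtype.ext (pr_of_mem x.2)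

/-- Extension by zero of endomorphisms. -/
def extU (U : Submodule ℝ E) : (U →ₗ[ℝ] U) →ₗ[ℝ] (E →ₗ[ℝ] E) where
  toFun A := U.subtype ∘ₗ A ∘ₗ prU U
  map_add' A B := by ext x; simp
  map_smul' c A := by ext x; simp

theorem extU_apply (U : Submodule ℝ E) (A : U →ₗ[ℝ] U) (x : E) : extU U A x = (A (prU U x) : E) := rfl

/-- Extension by zero of bilinear maps. -/
def ext2 (U : Submodule ℝ E) (S : U →ₗ[ℝ] U →ₗ[ℝ] U) : E →ₗ[ℝ] E →ₗ[ℝ] E :=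
  extU U ∘ₗ S ∘ₗ prU U

theorem ext2_apply (U : Submodule ℝ E) (S : U →ₗ[ℝ] U →ₗ[ℝ] U) (x y : E) :
    ext2 U S x y = (S (prU U x) (prU U y) : E) := rfl

/-- Restriction of bilinear maps. -/
def res2 (U : Submodule ℝ E) (T : E →ₗ[ℝ] E →ₗ[ℝ] E) : U →ₗ[ℝ] U →ₗ[ℝ] U :=
  LinearMap.mk₂ ℝ (fun x y => prU U (T x y)) (fun a b c => by simp) (fun a b c => by simp)
    (fun a b c => by simp) (fun a b c => by simp)

theorem res2_apply (U : Submodule ℝ E) (T : E →ₗ[ℝ] E →ₗ[ℝ] E) (x y : U) :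
    res2 U T x y = prU U (T x y) := rfl

variable {U : Submodule ℝ E} {T : E →ₗ[ℝ] E →ₗ[ℝ] E} {h : Submodule ℝ (E →ₗ[ℝ] E)}

theorem Simp.res2_coe (hT : Simp T U) (x y : U) : (res2 U T x y : E) = T x y := by
  rw [res2_apply, prU_coe, pr_of_mem (hT.mem _ _)]

theorem Simp.extU_res2 (hT : Simp T U) (x : U) : extU U (res2 U T x) = T x := by
  ext y
  rw [extU_apply, hT.res2_coe, prU_coe, hT.pr_right]

theorem LieSkew.comap (hh : LieSkew h) : LieSkew (h.comap (extU U)) := by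
  constructor
  · intro A hA x y
    have := hh.skew _ hA x y
    rw [extU_apply, extU_apply, prU_of, prU_of] at this
    exact this
  · intro A hA B hB
    have := hh.lie _ hA _ hB
    have e : extU U (A ∘ₗ B - B ∘ₗ A) = extU U A ∘ₗ extU U B - extU U B ∘ₗ extU U A := by
      ext x
      simp [extU_apply, prU_of]
    show extU U _ ∈ h
    rw [e]; exact this

theorem ext2_mem {S : U →ₗ[ℝ] U →ₗ[ℝ] U} (hS : S ∈ prol (h.comap (extU U))) : ext2 U S ∈ prol h := by
  refine ⟨fun x => ?_, fun x => hS.2 (prU U x)⟩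
  rw [ext2_apply, hS.1]; rfl

theorem core (hh : LieSkew h) (h0 : ∃ T ∈ prol h, T ≠ 0) :
    ∃ U : Submodule ℝ E, U ≠ ⊥ ∧ (∀ x, (∀ A ∈ h, A x = 0) → x ∈ Uᗮ) ∧
      (∀ A ∈ h, (∀ x ∈ U, A x ∈ U) ∧ A ∘ₗ pr U ∈ h) ∧
      ((∀ B, IsSkew B → (∀ x ∈ Uᗮ, B x = 0) → B ∈ h) ∨
        ∃ T ∈ prol h, Simp T U ∧ ∀ A ∈ h, (∀ x ∈ Uᗮ, A x = 0) → ∃ x, A = T x) := by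
  by_cases hn : NoWedge h
  · obtain ⟨T, U, hT, sT, hmax⟩ := exists_maxker hh hn h0
    refine ⟨U, sT.ne_bot, ?_, fun A hA => ⟨(sT.mix hh hn hT hA).1, (sT.mix hh hn hT hA).2.2⟩,
      Or.inr ⟨T, hT, sT, ?_⟩⟩
    · intro x hx
      have h1 : T (pr U x) = 0 := by
        rw [sT.pr_left]; ext y
        rw [sT.tri.swap, hx _ (hT.2 y)]; simp
      have h2 := sT.inj (pr_mem U x) h1
      have h3 := sub_pr_mem U x
      rwa [h2, sub_zero] at h3
    · have hJ := jac_all hh hn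
      have C : Ctx (h.comap (extU U)) := by
        refine ⟨hh.comap, ?_, ?_⟩
        · intro S hS x y z
          have := hJ _ (ext2_mem hS) x y z
          simp only [ext2_apply, prU_of] at this
          exact Subtype.ext this
        · intro S hS v hv hSv
          have := hmax _ (ext2_mem hS) (fun x hx => by
            ext y
            have : prU U x = 0 := Subtype.ext (pr_of_orth hx)
            rw [ext2_apply, this]; simp) v v.2 (by simpa using hv) (by
            ext y; rw [ext2_apply, prU_of, hSv]; rfl)
          ext x y
          have h2 := congrArg (fun f => f (x : E) (y : E)) this
          simp only [ext2_apply, prU_of] at h2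
          exact h2
      have hT' : res2 U T ∈ prol (h.comap (extU U)) := by
        refine ⟨fun x => ?_, fun x => ?_⟩
        · rw [res2_apply, sT.tri.alt, map_zero]
        · show extU U _ ∈ h
          rw [sT.extU_res2]; exact hT.2 x
      have hT0 : res2 U T ≠ 0 := by
        intro h0
        apply sT.ne
        ext x y
        rw [← sT.pr_left, ← prU_coe, ← sT.extU_res2, h0]; simp [extU_apply]
      rcases C.dichotomy hT' hT0 with h1 | h1
      · intro A hA hAU
        have hAp : ∀ x, A (pr U x) = A x := fun x => by
          have := hAU _ (sub_pr_mem U x)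
          rw [map_sub, sub_eq_zero] at this; exact this.symm
        have e : extU U (prU U ∘ₗ A ∘ₗ U.subtype) = A := by
          ext x
          rw [extU_apply]
          simp only [LinearMap.comp_apply, Submodule.subtype_apply, prU_coe, hAp]
          rw [← hAp, pr_of_mem ((sT.mix hh hn hT hA).1 _ (pr_mem U x))]
        obtain ⟨x, hx⟩ := h1 (prU U ∘ₗ A ∘ₗ U.subtype) (by show extU U _ ∈ h; rw [e]; exact hA)
        exact ⟨x, by rw [← e, hx, sT.extU_res2]⟩
      · exfalso
        refine hn U sT.finrank fun x hx y hy => ?_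
        have h2 : extU U (wedge ⟨x, hx⟩ ⟨y, hy⟩) ∈ h := h1 ⟨x, hx⟩ ⟨y, hy⟩
        convert h2 using 1
        ext z
        have hi : ∀ x ∈ U, ⟪x, pr U z⟫ = ⟪x, z⟫ := fun x hx => by rw [← pr_inner, pr_of_mem hx]
        simp [extU_apply, prU_coe, hi x hx, hi y hy]
  · obtain ⟨U, a, b, c, d⟩ := core_wedge hh hn
    exact ⟨U, a, b, c, Or.inl d⟩

end main10

section main11
variable {E : Type} [NormedAddCommGroup E] [InnerProductSpace ℝ E] [FiniteDimensional ℝ E]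

/-- Elements of `g` vanishing on the orthogonal complement of `W`. -/
def van (g : Submodule ℝ (E →ₗ[ℝ] E)) (W : Submodule ℝ E) : Submodule ℝ (E →ₗ[ℝ] E) where
  carrier := {A | A ∈ g ∧ ∀ z ∈ Wᗮ, A z = 0}
  add_mem' := by
    rintro A B ⟨h1, h2⟩ ⟨h3, h4⟩
    exact ⟨g.add_mem h1 h3, fun z hz => by simp [h2 z hz, h4 z hz]⟩
  zero_mem' := ⟨g.zero_mem, fun z hz => rfl⟩
  smul_mem' := by
    rintro c A ⟨h1, h2⟩
    exact ⟨g.smul_mem c h1, fun z hz => by simp [h2 z hz]⟩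

/-- Pieces of special type. -/
def Good (g : Submodule ℝ (E →ₗ[ℝ] E)) (U : Submodule ℝ E) : Prop :=
  (∀ B, IsSkew B → (∀ x ∈ Uᗮ, B x = 0) → B ∈ g) ∨
    ∃ T ∈ prol g, Simp T U ∧ ∀ A ∈ van g U, ∃ x, A = T x

variable {g : Submodule ℝ (E →ₗ[ℝ] E)} {W U : Submodule ℝ E} {A B : E →ₗ[ℝ] E}

theorem skew_maps (hA : IsSkew A) (h : ∀ z ∈ Wᗮ, A z = 0) (x : E) : A x ∈ W :=
  mem_of_orth fun z hz => by rw [hA, h z hz]; simp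

theorem van_lie (hg : LieSkew g) : LieSkew (van g W) := by
  refine ⟨fun A hA => hg.skew A hA.1, fun A hA B hB => ⟨hg.lie A hA.1 B hB.1, fun z hz => ?_⟩⟩
  simp [hA.2 z hz, hB.2 z hz]

theorem outer (hg : LieSkew g) (n : ℕ) : ∀ W : Submodule ℝ E, Module.finrank ℝ W ≤ n →
    ∃ (m : ℕ) (W0 : Submodule ℝ E) (Ws : Fin m → Submodule ℝ E),
      W0 ≤ W ∧ (∀ i, Ws i ≤ W) ∧ (∀ i, Ws i ≤ W0ᗮ) ∧ (∀ i j, i ≠ j → Ws i ≤ (Ws j)ᗮ) ∧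
      (W ≤ W0 ⊔ ⨆ i, Ws i) ∧ (van g W ≤ van g W0 ⊔ ⨆ i, van g (Ws i)) ∧
      (∀ T ∈ prol (van g W0), T = 0) ∧ ∀ i, Good g (Ws i) := by
  induction n with
  | zero =>
    intro W hW
    have hW0 : W = ⊥ := Submodule.finrank_eq_zero.1 (by omega)
    subst hW0
    refine ⟨0, ⊥, Fin.elim0, le_rfl, fun i => i.elim0, fun i => i.elim0, fun i => i.elim0, by simp,
      le_sup_left, ?_, fun i => i.elim0⟩
    intro T hT
    ext x y
    rw [(hT.2 x).2 y (by simp)]; rfl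
  | succ n ih =>
    intro W hW
    by_cases h0 : ∃ T ∈ prol (van g W), T ≠ 0
    swap
    · push Not at h0
      exact ⟨0, W, Fin.elim0, le_rfl, fun i => i.elim0, fun i => i.elim0, fun i => i.elim0, le_sup_left,
        le_sup_left, h0, fun i => i.elim0⟩
    obtain ⟨U, hUb, hUk, hUA, hUd⟩ := core (van_lie hg) h0
    have hUW' : Wᗮ ≤ Uᗮ := fun x hx => hUk x fun A hA => hA.2 x hx
    have hUW : U ≤ W := fun x hx => mem_of_orth fun z hz => inner_orth hx (hUW' hz)
    have hlt : W ⊓ Uᗮ < W := by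
      refine lt_of_le_of_ne inf_le_left fun h => hUb ?_
      rw [Submodule.eq_bot_iff]
      intro x hx
      have : x ∈ W ⊓ Uᗮ := by rw [h]; exact hUW hx
      exact inner_self_eq_zero.1 (inner_orth hx this.2 : ⟪x, x⟫ = 0)
    have hfr := Submodule.finrank_lt_finrank_of_lt hlt
    obtain ⟨m, W0, Ws, a1, a2, a3, a4, a5, a6, a7, a8⟩ := ih (W ⊓ Uᗮ) (by omega)
    have hW0U : U ≤ W0ᗮ := fun x hx => mem_orth fun z hz => inner_orth hx (a1 hz).2
    have hWsU : ∀ i, U ≤ (Ws i)ᗮ := fun i x hx => mem_orth fun z hz => inner_orth hx (a2 i hz).2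
    have hU1 : ∀ i : Fin (m + 1), ∀ P : Submodule ℝ E → Prop, P U → (∀ j, P (Ws j)) →
        P ((Fin.cons U Ws : Fin (m + 1) → Submodule ℝ E) i) := by
      intro i P h1 h2
      refine Fin.cases ?_ ?_ i
      · simpa using h1
      · intro j; simpa using h2 j
    have iS : ∀ j, (Fin.cons U Ws : Fin (m + 1) → Submodule ℝ E) (Fin.succ j) = Ws j := fun j => rfl
    have i0 : (Fin.cons U Ws : Fin (m + 1) → Submodule ℝ E) 0 = U := rfl
    refine ⟨m + 1, W0, Fin.cons U Ws, fun x hx => (a1 hx).1, fun i => hU1 i (· ≤ W) hUW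
      fun j x hx => (a2 j hx).1, fun i => hU1 i (· ≤ W0ᗮ) hW0U a3, ?_, ?_, ?_, a7, fun i => hU1 i (Good g) ?_ a8⟩
    · intro i j
      refine Fin.cases ?_ ?_ i
      · refine Fin.cases ?_ ?_ j
        · intro h; exact absurd rfl h
        · intro j _; rw [iS, i0]; exact hWsU j
      · intro i
        refine Fin.cases ?_ ?_ j
        · intro _; rw [iS, i0]; exact fun x hx => (a2 i hx).2
        · intro j h; rw [iS, iS]; exact a4 i j (fun h' => h (by rw [h']))
    · intro x hx
      have h1 : x - pr U x ∈ W ⊓ Uᗮ := ⟨W.sub_mem hx (hUW (pr_mem U x)), sub_pr_mem U x⟩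
      have h2 := a5 h1
      have h3 : W0 ⊔ ⨆ i, Ws i ≤ W0 ⊔ ⨆ i, (Fin.cons U Ws : Fin (m + 1) → Submodule ℝ E) i :=
        sup_le_sup le_rfl (iSup_le fun j => le_iSup_of_le (Fin.succ j) (by rw [iS]))
      have h4 : U ≤ W0 ⊔ ⨆ i, (Fin.cons U Ws : Fin (m + 1) → Submodule ℝ E) i :=
        le_trans (le_iSup_of_le 0 (by rw [i0])) le_sup_right
      have := Submodule.add_mem _ (h3 h2) (h4 (pr_mem U x))
      simpa using this
    · intro A hA
      have h3 : van g W0 ⊔ ⨆ i, van g (Ws i) ≤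
          van g W0 ⊔ ⨆ i, van g ((Fin.cons U Ws : Fin (m + 1) → Submodule ℝ E) i) :=
        sup_le_sup le_rfl (iSup_le fun j => le_iSup_of_le (Fin.succ j) (by rw [iS]))
      have h4 : van g U ≤ van g W0 ⊔ ⨆ i, van g ((Fin.cons U Ws : Fin (m + 1) → Submodule ℝ E) i) :=
        le_trans (le_iSup_of_le 0 (by rw [i0])) le_sup_right
      obtain ⟨b1, b2⟩ := hUA A hA
      have c1 : A ∘ₗ pr U ∈ van g U := ⟨b2.1, fun z hz => by simp [pr_of_orth hz]⟩
      have c2 : A - A ∘ₗ pr U ∈ van g (W ⊓ Uᗮ) := by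
        refine ⟨g.sub_mem hA.1 b2.1, fun z hz => ?_⟩
        have hsk : IsSkew (A - A ∘ₗ pr U) := (hg.skew _ hA.1).sub (hg.skew _ b2.1)
        have hm1 : ∀ w, (A - A ∘ₗ pr U) w ∈ W := skew_maps hsk fun z hz => by
          simp [hA.2 z hz, pr_of_orth (hUW' hz)]
        have hm2 : ∀ w, (A - A ∘ₗ pr U) w ∈ Uᗮ := skew_maps hsk fun z hz => by
          rw [Submodule.orthogonal_orthogonal] at hz
          simp [pr_of_mem hz]
        apply eq_zero_of_inner; intro w
        rw [hsk, inner_orth' (Submodule.mem_inf.2 ⟨hm1 w, hm2 w⟩) hz, neg_zero]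
      have := Submodule.add_mem _ (h3 (a6 c2)) (h4 c1)
      simpa using this
    · rcases hUd with h | ⟨T, hT, sT, h⟩
      · exact Or.inl fun B hB hBU => (h B hB hBU).1
      · exact Or.inr ⟨T, ⟨hT.1, fun x => (hT.2 x).1⟩, sT, fun A hA =>
          h A ⟨hA.1, fun z hz => hA.2 z (hUW' hz)⟩ hA.2⟩

theorem prol_alt (hg : LieSkew g) {W0 : Submodule ℝ E} (h0 : ∀ T ∈ prol (van g W0), T = 0)
    (T : AlternatingMap ℝ ↥W0 ℝ (Fin 3))
    (hT : ∀ X : ↥W0, ∃ A ∈ van g W0, ∀ Y Z : ↥W0, ⟪A (Y : E), (Z : E)⟫ = T ![X, Y, Z]) : T = 0 := by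
  have uniq : ∀ A ∈ van g W0, (∀ Y Z : ↥W0, ⟪A (Y : E), (Z : E)⟫ = 0) → A = 0 := by
    intro A hA h
    have hm := skew_maps (hg.skew A hA.1) hA.2
    ext x
    have e : A x = A (pr W0 x) := by
      have := hA.2 _ (sub_pr_mem W0 x)
      rwa [map_sub, sub_eq_zero] at this
    have := h ⟨pr W0 x, pr_mem W0 x⟩ ⟨A (pr W0 x), hm _⟩
    rw [e]
    exact inner_self_eq_zero.1 this
  choose f hf hfT using hT
  have uniq2 : ∀ A ∈ van g W0, ∀ B ∈ van g W0,
      (∀ Y Z : ↥W0, ⟪A (Y : E), (Z : E)⟫ = ⟪B (Y : E), (Z : E)⟫) → A = B := by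
    intro A hA B hB h
    refine sub_eq_zero.1 (uniq _ ((van g W0).sub_mem hA hB) fun Y Z => ?_)
    rw [LinearMap.sub_apply, inner_sub_left, h, sub_self]
  let F : W0 →ₗ[ℝ] (E →ₗ[ℝ] E) :=
    { toFun := f
      map_add' := fun X X' => uniq2 _ (hf _) _ ((van g W0).add_mem (hf _) (hf _)) fun Y Z => by
        rw [LinearMap.add_apply, inner_add_left, hfT, hfT, hfT]
        exact AlternatingMap.map_vecCons_add T ![Y, Z] X X'
      map_smul' := fun c X => uniq2 _ (hf _) _ ((van g W0).smul_mem _ (hf _)) fun Y Z => by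
        simp only [RingHom.id_apply]
        rw [LinearMap.smul_apply, real_inner_smul_left, hfT, hfT]
        exact AlternatingMap.map_vecCons_smul T ![Y, Z] c X }
  have hS : F ∘ₗ prU W0 ∈ prol (van g W0) := by
    refine ⟨fun x => ?_, fun x => hf _⟩
    show f (prU W0 x) x = 0
    have hA := hf (prU W0 x)
    have hm := skew_maps (hg.skew _ hA.1) hA.2
    have e : f (prU W0 x) x = f (prU W0 x) (prU W0 x) := by
      have := hA.2 _ (sub_pr_mem W0 x)
      rwa [map_sub, sub_eq_zero] at this
    have h2 := hfT (prU W0 x) (prU W0 x) ⟨f (prU W0 x) (prU W0 x), hm _⟩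
    rw [T.map_eq_zero_of_eq (i := 0) (j := 1) _ rfl (by decide)] at h2
    rw [e]
    exact inner_self_eq_zero.1 h2
  have hS0 := h0 _ hS
  ext v
  have hv : v = ![v 0, v 1, v 2] := by ext i; fin_cases i <;> rfl
  have h1 : f (v 0) = 0 := by
    have := congrArg (fun f => f (v 0 : E)) hS0
    simp only [LinearMap.comp_apply, prU_of] at this
    exact this
  rw [hv, ← hfT, h1]; simp

end main11

theorem good_adj {E : Type} [NormedAddCommGroup E] [InnerProductSpace ℝ E] [FiniteDimensional ℝ E]
    {U : Submodule ℝ E} {T : E →ₗ[ℝ] E →ₗ[ℝ] E} (sT : Simp T U) :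
    (∀ X Y : ↥U, res2 U T X Y = - res2 U T Y X) ∧
    (∀ X Y Z : ↥U, res2 U T (res2 U T X Y) Z + res2 U T (res2 U T Y Z) X
      + res2 U T (res2 U T Z X) Y = 0) ∧
    (∃ X Y : ↥U, res2 U T X Y ≠ 0) ∧
    (∀ I : Submodule ℝ ↥U, (∀ X : ↥U, ∀ y ∈ I, res2 U T X y ∈ I) → I = ⊥ ∨ I = ⊤) ∧
    (∀ X : ↥U, X ≠ 0 → LinearMap.trace ℝ ↥U (res2 U T X ∘ₗ res2 U T X) < 0) ∧
    (∀ X Y Z : ↥U, ⟪res2 U T X Y, Z⟫ = - ⟪Y, res2 U T X Z⟫) := by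
  have hc := sT.res2_coe
  have hsk : ∀ X Y Z : ↥U, ⟪res2 U T X Y, Z⟫ = - ⟪Y, res2 U T X Z⟫ := by
    intro X Y Z
    rw [Submodule.coe_inner, Submodule.coe_inner, hc, hc, sT.tri.skew]
  have hinj : ∀ X : ↥U, res2 U T X = 0 → X = 0 := by
    intro X h
    have h1 := sT.extU_res2 X
    rw [h, map_zero] at h1
    exact Subtype.ext (sT.inj X.2 h1.symm)
  refine ⟨?_, ?_, ?_, ?_, ?_, hsk⟩
  · intro X Y
    apply Subtype.ext
    rw [Submodule.coe_neg, hc, hc, sT.tri.swap]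
  · intro X Y Z
    apply Subtype.ext
    simp only [Submodule.coe_add, hc, Submodule.coe_zero]
    have := sT.jac X Y Z
    rw [sT.tri.swap (T Y Z) X, this, sT.tri.swap (T Z X) Y, sT.tri.swap Z X, map_neg]
    abel
  · obtain ⟨x, hx, hx0⟩ := exists_ne_of_ne_bot sT.ne_bot
    by_contra hcon
    push Not at hcon
    have := hinj ⟨x, hx⟩ (by ext1 Y; exact hcon _ _)
    exact hx0 (congrArg Subtype.val this)
  · intro I hI
    rcases sT.simp (I.map U.subtype) (Submodule.map_subtype_le U I) (by
      rintro x _ ⟨y, hy, rfl⟩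
      refine ⟨res2 U T (prU U x) y, hI _ y hy, ?_⟩
      rw [Submodule.subtype_apply, hc, prU_coe, sT.pr_left]; rfl) with h | h
    · left
      rw [Submodule.eq_bot_iff]
      intro y hy
      have : U.subtype y ∈ I.map U.subtype := ⟨y, hy, rfl⟩
      rw [h, Submodule.mem_bot] at this
      exact Subtype.ext this
    · right
      rw [eq_top_iff]
      rintro ⟨x, hx⟩ -
      rw [← h] at hx
      obtain ⟨y, hy, hyx⟩ := hx
      have : y = ⟨x, by rw [← hyx]; exact y.2⟩ := Subtype.ext hyx
      rw [← this]; exact hy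
  · intro X hX
    exact trace_sq_skew_neg (hsk X) fun h => hX (hinj X h)

theorem stmt_12
    (g : Submodule ℝ (V →ₗ[ℝ] V))
    (hgskew : ∀ A ∈ g, IsSkew A)
    (hglie : ∀ A ∈ g, ∀ B ∈ g, A ∘ₗ B - B ∘ₗ A ∈ g) :
    ∃ (m : ℕ) (W0 : Submodule ℝ V) (Ws : Fin m → Submodule ℝ V)
      (h0 : Submodule ℝ (V →ₗ[ℝ] V)) (hs : Fin m → Submodule ℝ (V →ₗ[ℝ] V)),
      -- orthogonal decomposition `V = W₀ ⊕ W₁ ⊕ ⋯ ⊕ W_m`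
      (∀ i, ∀ x ∈ W0, ∀ y ∈ Ws i, ⟪x, y⟫ = 0) ∧
      (∀ i j, i ≠ j → ∀ x ∈ Ws i, ∀ y ∈ Ws j, ⟪x, y⟫ = 0) ∧
      (W0 ⊔ ⨆ i, Ws i) = ⊤ ∧
      -- decomposition of `g` into ideals `g = h₀ ⊕ h₁ ⊕ ⋯ ⊕ h_m`
      h0 ≤ g ∧ (∀ i, hs i ≤ g) ∧
      (h0 ⊔ ⨆ i, hs i) = g ∧
      (∀ A ∈ g, ∀ B ∈ h0, A ∘ₗ B - B ∘ₗ A ∈ h0) ∧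
      (∀ i, ∀ A ∈ g, ∀ B ∈ hs i, A ∘ₗ B - B ∘ₗ A ∈ hs i) ∧
      -- `h₀` preserves `W₀` and vanishes on the other summands
      (∀ A ∈ h0, (∀ x ∈ W0, A x ∈ W0) ∧ ∀ i, ∀ x ∈ Ws i, A x = 0) ∧
      -- each `hᵢ` preserves `Wᵢ` and vanishes on the other summands
      (∀ i, ∀ A ∈ hs i, (∀ x ∈ Ws i, A x ∈ Ws i) ∧ (∀ x ∈ W0, A x = 0) ∧
        ∀ j, j ≠ i → ∀ x ∈ Ws j, A x = 0) ∧
      -- the skew-symmetric prolongation of `(h₀, W₀)` vanishes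
      (∀ T : AlternatingMap ℝ ↥W0 ℝ (Fin 3),
        (∀ X : ↥W0, ∃ A ∈ h0, ∀ Y Z : ↥W0, ⟪A (Y : V), (Z : V)⟫ = T ![X, Y, Z]) →
        T = 0) ∧
      -- for `i ≥ 1`: either `hᵢ|_{Wᵢ} = so(Wᵢ)` ...
      (∀ i,
        (∀ B : V →ₗ[ℝ] V, IsSkew B → (∀ x ∈ Ws i, B x ∈ Ws i) → (∀ x ∈ W0, B x = 0) →
          (∀ j, j ≠ i → ∀ x ∈ Ws j, B x = 0) → B ∈ hs i)
        ∨
        -- ... or `(hᵢ, Wᵢ)` is the adjoint representation of a compact simple Lie algebra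
        (∃ br : ↥(Ws i) →ₗ[ℝ] ↥(Ws i) →ₗ[ℝ] ↥(Ws i),
          (∀ X Y : ↥(Ws i), br X Y = - br Y X) ∧
          (∀ X Y Z : ↥(Ws i), br (br X Y) Z + br (br Y Z) X + br (br Z X) Y = 0) ∧
          (∃ X Y : ↥(Ws i), br X Y ≠ 0) ∧
          (∀ I : Submodule ℝ ↥(Ws i), (∀ X : ↥(Ws i), ∀ y ∈ I, br X y ∈ I) →
            I = ⊥ ∨ I = ⊤) ∧
          (∀ X : ↥(Ws i), X ≠ 0 → LinearMap.trace ℝ ↥(Ws i) (br X ∘ₗ br X) < 0) ∧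
          (∀ X Y Z : ↥(Ws i), ⟪br X Y, Z⟫ = - ⟪Y, br X Z⟫) ∧
          (∀ A : V →ₗ[ℝ] V, A ∈ hs i ↔
            ((∀ x ∈ W0, A x = 0) ∧ (∀ j, j ≠ i → ∀ x ∈ Ws j, A x = 0) ∧
              ∃ X : ↥(Ws i), ∀ y : ↥(Ws i), A (y : V) = (br X y : V))))) := by
  have hg : LieSkew g := ⟨hgskew, hglie⟩
  obtain ⟨m, W0, Ws, -, -, a3, a4, a5, a6, a7, a8⟩ := outer hg (Module.finrank ℝ V) ⊤ (by simp)
  have hle : g ≤ van g W0 ⊔ ⨆ i, van g (Ws i) :=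
    fun A hA => a6 ⟨hA, fun z hz => by
      have : z = 0 := by simpa using hz
      rw [this, map_zero]⟩
  have o1 : ∀ i, ∀ x ∈ W0, ∀ y ∈ Ws i, ⟪x, y⟫ = 0 := fun i x hx y hy => inner_orth hx (a3 i hy)
  have o2 : ∀ i j, i ≠ j → ∀ x ∈ Ws i, ∀ y ∈ Ws j, ⟪x, y⟫ = 0 :=
    fun i j hij x hx y hy => inner_orth' hy (a4 i j hij hx)
  have a3' : ∀ i, W0 ≤ (Ws i)ᗮ := fun i x hx => mem_orth fun z hz => o1 i x hx z hz
  -- every element of `g` preserves complements of the pieces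
  have ideal : ∀ U : Submodule ℝ V, (W0 = U ∨ W0 ≤ Uᗮ) → (∀ j, Ws j = U ∨ Ws j ≤ Uᗮ) →
      ∀ A ∈ g, ∀ B ∈ van g U, A ∘ₗ B - B ∘ₗ A ∈ van g U := by
    intro U hU0 hUs A hA B hB
    refine ⟨hglie A hA B hB.1, fun z hz => ?_⟩
    let St : Submodule ℝ (V →ₗ[ℝ] V) :=
      { carrier := {A | A z ∈ Uᗮ}
        add_mem' := fun h1 h2 => Uᗮ.add_mem h1 h2
        zero_mem' := Uᗮ.zero_mem
        smul_mem' := fun c A h => Uᗮ.smul_mem c h }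
    have hK : ∀ K : Submodule ℝ V, (K = U ∨ K ≤ Uᗮ) → van g K ≤ St := by
      rintro K (rfl | hK) A hA
      · show A z ∈ Kᗮ
        rw [hA.2 z hz]; exact Submodule.zero_mem _
      · exact hK (skew_maps (hgskew A hA.1) hA.2 z)
    have hAS : A z ∈ Uᗮ := (sup_le (hK W0 hU0) (iSup_le fun j => hK _ (hUs j))) (hle hA)
    simp [hB.2 z hz, hB.2 _ hAS]
  have piece : ∀ i, ∀ v, (∀ w ∈ W0, ⟪w, v⟫ = 0) → (∀ j, j ≠ i → ∀ w ∈ Ws j, ⟪w, v⟫ = 0) → v ∈ Ws i := by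
    intro i v h1 h2
    have hle2 : W0 ⊔ ⨆ j, Ws j ≤ (ℝ ∙ (v - pr (Ws i) v))ᗮ := by
      refine sup_le ?_ (iSup_le fun j => ?_)
      · intro w hw
        rw [Submodule.mem_orthogonal_singleton_iff_inner_left, inner_sub_right, h1 w hw,
          o1 i w hw _ (pr_mem _ _), sub_zero]
      · intro w hw
        rw [Submodule.mem_orthogonal_singleton_iff_inner_left]
        by_cases hj : j = i
        · subst hj; exact inner_orth hw (sub_pr_mem _ _)
        · rw [inner_sub_right, h2 j hj w hw, o2 j i hj w hw _ (pr_mem _ _), sub_zero]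
    have h3 := hle2 (a5 (Submodule.mem_top (x := v - pr (Ws i) v)))
    rw [Submodule.mem_orthogonal_singleton_iff_inner_left, inner_self_eq_zero, sub_eq_zero] at h3
    rw [h3]; exact pr_mem _ _
  refine ⟨m, W0, Ws, van g W0, fun i => van g (Ws i), o1, o2, eq_top_iff.2 a5, fun A hA => hA.1,
    fun i A hA => hA.1, le_antisymm (sup_le (fun A hA => hA.1) (iSup_le fun i A hA => hA.1)) hle,
    ideal W0 (Or.inl rfl) (fun j => Or.inr (a3 j)),
    fun i => ideal (Ws i) (Or.inr (a3' i)) (fun j => ?_), ?_, ?_, ?_, ?_⟩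
  · by_cases h : j = i
    · exact Or.inl (by rw [h])
    · exact Or.inr (a4 j i h)
  · exact fun A hA => ⟨fun x _ => skew_maps (hgskew A hA.1) hA.2 x, fun i x hx => hA.2 x (a3 i hx)⟩
  · exact fun i A hA => ⟨fun x _ => skew_maps (hgskew A hA.1) hA.2 x, fun x hx => hA.2 x (a3' i hx),
      fun j hj x hx => hA.2 x (a4 j i hj hx)⟩
  · exact fun T hT => prol_alt hg a7 T hT
  · intro i
    rcases a8 i with h | ⟨T, hT, sT, h⟩
    · left
      intro B hB _ hB0 hBj
      have hk : ∀ z ∈ (Ws i)ᗮ, B z = 0 := by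
        intro z hz
        apply eq_zero_of_inner; intro w
        have : B w ∈ Ws i := piece i _
          (fun u hu => by rw [real_inner_comm, hB, hB0 u hu]; simp)
          (fun j hj u hu => by rw [real_inner_comm, hB, hBj j hj u hu]; simp)
        rw [hB, inner_orth' this hz, neg_zero]
      exact ⟨h B hB hk, hk⟩
    · right
      obtain ⟨b1, b2, b3, b4, b5, b6⟩ := good_adj sT
      refine ⟨res2 (Ws i) T, b1, b2, b3, b4, b5, b6, fun A => ⟨fun hA => ?_, ?_⟩⟩
      · refine ⟨fun x hx => hA.2 x (a3' i hx), fun j hj x hx => hA.2 x (a4 j i hj hx), ?_⟩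
        obtain ⟨x, rfl⟩ := h A hA
        exact ⟨prU (Ws i) x, fun y => by rw [sT.res2_coe, prU_coe, sT.pr_left]⟩
      · rintro ⟨h0, hj, X, hX⟩
        have hkill : ∀ z ∈ (Ws i)ᗮ, T X z = 0 := fun z hz => by
          rw [sT.tri.swap, sT.ker z hz]; simp
        have hle3 : W0 ⊔ ⨆ j, Ws j ≤ LinearMap.ker (A - T X) := by
          refine sup_le ?_ (iSup_le fun j => ?_)
          · intro w hw
            rw [LinearMap.mem_ker, LinearMap.sub_apply, h0 w hw, hkill w (a3' i hw), sub_zero]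
          · intro w hw
            rw [LinearMap.mem_ker, LinearMap.sub_apply]
            by_cases hji : j = i
            · subst hji
              rw [hX ⟨w, hw⟩, sT.res2_coe, sub_self]
            · rw [hj j hji w hw, hkill w (a4 j i hji hw), sub_zero]
        have hAT : A = T X := by
          ext w
          have := hle3 (a5 (Submodule.mem_top (x := w)))
          rw [LinearMap.mem_ker, LinearMap.sub_apply, sub_eq_zero] at this
          exact this
        rw [hAT]
        exact ⟨hT.2 _, hkill⟩
end
end

section
/- Let g ⊊ so(V) be a proper Lie subalgebra acting irreducibly on V, with n = dim V > 4. If F ∈ so(V) satisfies [F, g^⊥] ⊆ g and L*_F T^g = 0 (where F is identified with its 2-form), then F ∈ g^⊥. -/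
open scoped RealInnerProductSpace BigOperators

noncomputable section

variable {V : Type} [NormedAddCommGroup V] [InnerProductSpace ℝ V] [FiniteDimensional ℝ V]

/-- The inner product on `Λ²V ≅ so(V)` for which `{eᵢ∧eⱼ : i<j}` is orthonormal,
computed in the standard orthonormal basis of `V`. -/
def formInner (F G : V → V) : ℝ :=
  ∑ i, ∑ j ∈ Finset.Ioi i,
    ⟪F (stdOrthonormalBasis ℝ V i), stdOrthonormalBasis ℝ V j⟫ *
      ⟪G (stdOrthonormalBasis ℝ V i), stdOrthonormalBasis ℝ V j⟫

/-- `(α ∧ α)(X,Y,Z,W)` where `α` is the 2-form of the skew endomorphism `A`. -/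
def wedgeSelf (A : V →ₗ[ℝ] V) (X Y Z W : V) : ℝ :=
  ⟪A X, Y⟫ * ⟪A Z, W⟫ - ⟪A X, Z⟫ * ⟪A Y, W⟫ + ⟪A X, W⟫ * ⟪A Y, Z⟫ +
    ⟪A Y, Z⟫ * ⟪A X, W⟫ - ⟪A Y, W⟫ * ⟪A X, Z⟫ + ⟪A Z, W⟫ * ⟪A X, Y⟫


/-- rank one map `x ↦ ⟨v,x⟩ u`. -/
def rk (u v : V) : Module.End ℝ V := (innerₛₗ ℝ v).smulRight u

lemma rk_apply (u v x : V) : rk u v x = ⟪v, x⟫ • u := rfl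

local notation "bs" => stdOrthonormalBasis ℝ V
local notation "tr" => LinearMap.trace ℝ V

lemma tr_eq (X : Module.End ℝ V) : tr X = ∑ i, ⟪bs i, X (bs i)⟫ :=
  LinearMap.trace_eq_sum_inner X (stdOrthonormalBasis ℝ V)

lemma tr_rk (u v : V) : tr (rk u v) = ⟪v, u⟫ := by
  rw [tr_eq]
  simp only [rk_apply, inner_smul_right]
  rw [← OrthonormalBasis.sum_inner_mul_inner bs v u]

def EE (i j : Fin (Module.finrank ℝ V)) : Module.End ℝ V :=
  rk (bs i) (bs j) - rk (bs j) (bs i)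

lemma mul_rk (X : Module.End ℝ V) (u v : V) : X * rk u v = rk (X u) v := by
  ext x; simp [rk_apply]

lemma rk_mul (X : Module.End ℝ V) (hX : IsSkew X) (u v : V) : rk u v * X = - rk u (X v) := by
  ext x
  simp [rk_apply, hX v x]

lemma rk_rk (u v w z : V) : rk u v * rk w z = ⟪v, w⟫ • rk u z := by
  ext x; simp [rk_apply, smul_smul, mul_comm, inner_smul_right]

lemma smul_rk (a : ℝ) (u v : V) : rk (a • u) v = a • rk u v := by
  ext x; simp [rk_apply, smul_smul, mul_comm]

lemma skew_swap {X : Module.End ℝ V} (hX : IsSkew X) (x y : V) : ⟪X x, y⟫ = - ⟪X y, x⟫ := by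
  rw [hX x y, real_inner_comm]

lemma skew_self {X : Module.End ℝ V} (hX : IsSkew X) (x : V) : ⟪X x, x⟫ = 0 := by
  have := skew_swap hX x x; linarith

lemma EE_skew (i j : Fin (Module.finrank ℝ V)) : IsSkew (EE (V := V) i j) := by
  intro x y
  simp only [EE, LinearMap.sub_apply, rk_apply, inner_sub_left, inner_sub_right, inner_smul_left,
    inner_smul_right, real_inner_comm x]
  simp
  ring

lemma tr_EE_mul {X : Module.End ℝ V} (hX : IsSkew X) (i j : Fin (Module.finrank ℝ V)) :
    tr (EE i j * X) = 2 * ⟪bs i, X (bs j)⟫ * (-1) := by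
  rw [EE, sub_mul, rk_mul X hX, rk_mul X hX]
  simp only [map_sub, map_neg, tr_rk]
  rw [skew_swap hX (bs i), real_inner_comm (bs i) (X (bs j))]
  ring

lemma sum_rk (y : V → V) (f : V →ₗ[ℝ] V) (x : V) :
    ∑ i, ⟪bs i, x⟫ • f (bs i) = f x := by
  conv_rhs => rw [← OrthonormalBasis.sum_repr' bs x]
  simp

lemma sum_b (x : V) : ∑ i, ⟪bs i, x⟫ • bs i = x := OrthonormalBasis.sum_repr' bs x

/-- (a) -/
lemma sum_tr_EE {X : Module.End ℝ V} (hX : IsSkew X) :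
    ∑ i, ∑ j, tr (EE i j * X) • EE (V := V) i j = (-4 : ℝ) • X := by
  have h1 : ∑ i, ∑ j, ⟪bs i, X (bs j)⟫ • rk (bs i) (bs j) = X := by
    rw [Finset.sum_comm]
    ext x
    simp only [LinearMap.sum_apply, LinearMap.smul_apply, rk_apply]
    simp_rw [smul_comm _ (⟪bs _, x⟫), ← Finset.smul_sum, sum_b]
    exact sum_rk id X x
  have h2 : ∑ i, ∑ j, ⟪bs i, X (bs j)⟫ • rk (bs j) (bs i) = - X := by
    conv_rhs => rw [← h1]
    rw [Finset.sum_comm, ← Finset.sum_neg_distrib]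
    refine Finset.sum_congr rfl fun i _ => ?_
    rw [← Finset.sum_neg_distrib]
    refine Finset.sum_congr rfl fun j _ => ?_
    rw [← neg_smul, real_inner_comm, skew_swap hX, real_inner_comm]
  simp only [tr_EE_mul hX]
  simp only [EE, smul_sub, Finset.sum_sub_distrib]
  simp only [mul_comm _ (-1 : ℝ), ← mul_assoc, mul_smul, ← Finset.smul_sum, h1, h2]
  module

/-- (c) -/
lemma sum_EE_mul_EE {X : Module.End ℝ V} (hX : IsSkew X) :
    ∑ i, ∑ j, EE i j * X * EE (V := V) i j = (-2 : ℝ) • X := by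
  have h1 : ∑ i, ∑ j, ⟪bs i, X (bs j)⟫ • rk (bs i) (bs j) = X := by
    rw [Finset.sum_comm]
    ext x
    simp only [LinearMap.sum_apply, LinearMap.smul_apply, rk_apply]
    simp_rw [smul_comm _ (⟪bs _, x⟫), ← Finset.smul_sum, sum_b]
    exact sum_rk id X x
  have key : ∀ i j, EE i j * X * EE (V := V) i j =
      -⟪bs i, X (bs j)⟫ • rk (bs i) (bs j) - ⟪bs j, X (bs i)⟫ • rk (bs j) (bs i) := by
    intro i j
    simp only [EE, mul_assoc, mul_sub, sub_mul, mul_rk, rk_apply, smul_rk]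
    have e1 : ⟪bs i, X (bs i)⟫ = 0 := by rw [real_inner_comm]; exact skew_self hX _
    have e2 : ⟪bs j, X (bs j)⟫ = 0 := by rw [real_inner_comm]; exact skew_self hX _
    have e3 : ⟪bs j, X (bs i)⟫ = - ⟪bs i, X (bs j)⟫ := by
      rw [real_inner_comm, skew_swap hX, real_inner_comm]
    rw [e1, e2, e3]
    module
  simp only [key, Finset.sum_sub_distrib, neg_smul, Finset.sum_neg_distrib, h1]
  rw [Finset.sum_comm, h1]
  module

/-- (b) -/
lemma sum_EE_EE :
    ∑ i, ∑ j, EE i j * EE (V := V) i j = (-2 * ((Module.finrank ℝ V : ℝ) - 1)) • 1 := by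
  have h0 : ∑ i, rk (bs i) (bs i) = (1 : Module.End ℝ V) := by
    ext x; simp only [LinearMap.sum_apply, rk_apply, sum_b]; rfl
  have key : ∀ i j, EE i j * EE (V := V) i j =
      (if i = j then (2:ℝ) else 0) • rk (bs i) (bs i) - rk (bs i) (bs i) - rk (bs j) (bs j) := by
    intro i j
    have hb : ∀ i j, ⟪bs i, bs j⟫ = if i = j then (1:ℝ) else 0 :=
      fun i j => OrthonormalBasis.inner_eq_ite _ i j
    simp only [EE, mul_sub, sub_mul, rk_rk, hb]
    by_cases h : i = j
    · subst h; simp; module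
    · have h' : ¬ j = i := fun e => h e.symm
      simp [h, h']; abel
  simp only [key, Finset.sum_sub_distrib, h0, ite_smul, Finset.sum_ite_eq, Finset.mem_univ, if_true,
    Finset.sum_const, ← Finset.smul_sum, zero_smul, Finset.card_univ, Fintype.card_fin]
  rw [← Nat.cast_smul_eq_nsmul ℝ]
  module

lemma sum_Ioi {n : ℕ} (h : Fin n → Fin n → ℝ) (hs : ∀ i j, h i j = h j i) (h0 : ∀ i, h i i = 0) :
    ∑ i, ∑ j ∈ Finset.Ioi i, h i j = (1 / 2) * ∑ i, ∑ j, h i j := by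
  have e : ∀ i, ∑ j, h i j = ∑ j ∈ Finset.Ioi i, h i j + ∑ j ∈ Finset.Iio i, h i j := by
    intro i
    rw [← Finset.sum_filter_add_sum_filter_not Finset.univ (fun j => i < j)]
    congr 1
    · refine Finset.sum_congr ?_ fun _ _ => rfl
      ext; simp
    · have : Finset.univ.filter (fun j => ¬ i < j) = insert i (Finset.Iio i) := by
        ext j; simp [le_iff_eq_or_lt]
      rw [this, Finset.sum_insert (by simp), h0, zero_add]
  have e2 : ∑ i, ∑ j ∈ Finset.Iio i, h i j = ∑ i, ∑ j ∈ Finset.Ioi i, h i j := by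
    rw [Finset.sum_comm' (t' := Finset.univ) (s' := fun j => Finset.Ioi j) (by simp)]
    simp_rw [hs]
  simp_rw [e, Finset.sum_add_distrib, e2]
  ring

lemma tr_mul_skew {X : Module.End ℝ V} (hX : IsSkew X) (Y : Module.End ℝ V) :
    tr (X * Y) = - ∑ i, ∑ j, ⟪X (bs i), bs j⟫ * ⟪Y (bs i), bs j⟫ := by
  rw [tr_eq, ← Finset.sum_neg_distrib]
  refine Finset.sum_congr rfl fun i _ => ?_
  have := hX (bs i) (Y (bs i))
  rw [Module.End.mul_apply, ← neg_eq_iff_eq_neg.mpr this,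
    ← OrthonormalBasis.sum_inner_mul_inner bs (X (bs i)) (Y (bs i))]
  simp only [real_inner_comm (Y _)]

lemma formInner_eq {X Y : Module.End ℝ V} (hX : IsSkew X) (hY : IsSkew Y) :
    formInner (⇑X) (⇑Y) = -(1/2) * tr (X * Y) := by
  rw [formInner, tr_mul_skew hX, sum_Ioi]
  · ring
  · intro i j; rw [skew_swap hX, skew_swap hY]; ring
  · intro i; simp [skew_self hX]

lemma skew_br {X Y : Module.End ℝ V} (hX : IsSkew X) (hY : IsSkew Y) : IsSkew (X * Y - Y * X) := by
  intro x y
  simp only [LinearMap.sub_apply, Module.End.mul_apply, inner_sub_left, inner_sub_right]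
  rw [hX, hY, hY, hX]; ring

lemma skew_tr_sq {X : Module.End ℝ V} (hX : IsSkew X) : tr (X * X) ≤ 0 := by
  rw [tr_mul_skew hX, neg_nonpos]
  exact Finset.sum_nonneg fun i _ => Finset.sum_nonneg fun j _ => mul_self_nonneg _

lemma skew_tr_sq_zero {X : Module.End ℝ V} (hX : IsSkew X) (h : tr (X * X) = 0) : X = 0 := by
  rw [tr_mul_skew hX, neg_eq_zero, Finset.sum_eq_zero_iff_of_nonneg
    (fun i _ => Finset.sum_nonneg fun j _ => mul_self_nonneg _)] at h
  refine (stdOrthonormalBasis ℝ V).toBasis.ext fun i => ?_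
  have h1 := h i (Finset.mem_univ _)
  rw [Finset.sum_eq_zero_iff_of_nonneg (fun j _ => mul_self_nonneg _)] at h1
  refine InnerProductSpace.ext_inner_right_basis (𝕜 := ℝ) (stdOrthonormalBasis ℝ V).toBasis fun j => ?_
  have := h1 j (Finset.mem_univ _)
  simpa using this

/-- The commutation hypothesis makes the Casimir scalar. -/
lemma scalar_of_irr (g : Submodule ℝ (V →ₗ[ℝ] V))
    (hirr : ∀ W : Submodule ℝ V, (∀ A ∈ g, ∀ x ∈ W, A x ∈ W) → W = ⊥ ∨ W = ⊤)
    (hn : 4 < Module.finrank ℝ V) (C : Module.End ℝ V) (hC : C.IsSymmetric)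
    (hcom : ∀ A ∈ g, ∀ x, C (A x) = A (C x)) : ∃ c : ℝ, C = c • 1 := by
  let c := hC.eigenvalues rfl ⟨0, by omega⟩
  have hc : Module.End.HasEigenvalue C c := hC.hasEigenvalue_eigenvalues rfl ⟨0, by omega⟩
  refine ⟨c, ?_⟩
  rcases hirr (Module.End.eigenspace C c) (by
    intro A hA x hx
    rw [Module.End.mem_eigenspace_iff] at hx ⊢
    rw [hcom A hA, hx, map_smul]) with h | h
  · exact absurd h hc
  · ext x
    have : x ∈ Module.End.eigenspace C c := by rw [h]; trivial
    rw [Module.End.mem_eigenspace_iff] at this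
    simpa using this

section proj
variable {N : ℕ} (α : Fin N → Module.End ℝ V)

/-- orthogonal projection onto the span of `α`. -/
def PP_s15 : Module.End ℝ V →ₗ[ℝ] Module.End ℝ V :=
  ∑ k, ((-(1/2) : ℝ) • ((LinearMap.trace ℝ V).comp (LinearMap.mulRight ℝ (α k)))).smulRight (α k)

lemma PP_apply (X : Module.End ℝ V) : PP_s15 α X = ∑ k, (-(1/2) * tr (X * α k)) • α k := by
  simp [PP_s15, LinearMap.sum_apply]

lemma PP_alpha (hon : ∀ k l, tr (α k * α l) = if k = l then -2 else 0) (k) :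
    PP_s15 α (α k) = α k := by
  rw [PP_apply, Finset.sum_eq_single k]
  · simp [hon]
  · intro l _ hl; simp [hon, Ne.symm hl]
  · simp

lemma PP_span (hon : ∀ k l, tr (α k * α l) = if k = l then -2 else 0) {A : Module.End ℝ V}
    (hA : A ∈ Submodule.span ℝ (Set.range α)) : PP_s15 α A = A := by
  induction hA using Submodule.span_induction with
  | mem x h => obtain ⟨k, rfl⟩ := h; exact PP_alpha α hon k
  | zero => simp
  | add x y _ _ hx hy => rw [map_add, hx, hy]
  | smul a x _ hx => rw [map_smul, hx]

lemma PP_orth (hon : ∀ k l, tr (α k * α l) = if k = l then -2 else 0) (X : Module.End ℝ V) (k) :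
    tr ((X - PP_s15 α X) * α k) = 0 := by
  rw [sub_mul, map_sub, PP_apply, Finset.sum_mul, map_sum, Finset.sum_eq_single k]
  · simp [hon]; ring
  · intro l _ hl; simp [hon, hl]
  · simp

lemma sum_PP (hsk : ∀ k, IsSkew (α k)) (φ : Module.End ℝ V →ₗ[ℝ] Module.End ℝ V →ₗ[ℝ] ℝ)
    (Q : Module.End ℝ V →ₗ[ℝ] Module.End ℝ V) :
    ∑ i, ∑ j, φ (PP_s15 α (EE i j)) (Q (EE i j)) = 2 * ∑ k, φ (α k) (Q (α k)) := by
  have h : ∀ k, ∑ i, ∑ j, tr (EE i j * α k) * φ (α k) (Q (EE i j)) = -4 * φ (α k) (Q (α k)) := by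
    intro k
    have := congrArg (fun Z => φ (α k) (Q Z)) (sum_tr_EE (hsk k))
    simpa only [map_sum, map_smul, smul_eq_mul] using this
  simp only [PP_apply, map_sum, map_smul, LinearMap.sum_apply, LinearMap.smul_apply, smul_eq_mul,
    mul_assoc]
  have : ∀ i : Fin (Module.finrank ℝ V), ∑ j, ∑ k, -(1/2 : ℝ) * (tr (EE i j * α k) *
      φ (α k) (Q (EE i j))) = ∑ k, ∑ j, -(1/2 : ℝ) * (tr (EE i j * α k) *
      φ (α k) (Q (EE i j))) := fun i => Finset.sum_comm
  simp_rw [this]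
  rw [Finset.sum_comm, Finset.mul_sum]
  refine Finset.sum_congr rfl fun k _ => ?_
  simp_rw [← Finset.mul_sum, h]
  ring

lemma sum_perp (hsk : ∀ k, IsSkew (α k))
    (hon : ∀ k l, tr (α k * α l) = if k = l then -2 else 0)
    (φ : Module.End ℝ V →ₗ[ℝ] Module.End ℝ V →ₗ[ℝ] ℝ) :
    ∑ i, ∑ j, φ (EE i j - PP_s15 α (EE i j)) (EE i j - PP_s15 α (EE i j)) =
      ∑ i, ∑ j, φ (EE i j) (EE i j) - 2 * ∑ k, φ (α k) (α k) := by
  have h1 := sum_PP α hsk φ (LinearMap.id)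
  have h2 := sum_PP α hsk φ (PP_s15 α)
  have h3 := sum_PP α hsk φ.flip (LinearMap.id)
  simp only [LinearMap.id_apply, PP_alpha α hon, LinearMap.flip_apply] at h1 h2 h3
  simp only [map_sub, LinearMap.sub_apply, Finset.sum_sub_distrib]
  rw [h1, h2, h3]; ring

end proj

theorem stmt_15
    (g : Submodule ℝ (V →ₗ[ℝ] V))
    (hgskew : ∀ A ∈ g, IsSkew A)
    (hglie : ∀ A ∈ g, ∀ B ∈ g, A ∘ₗ B - B ∘ₗ A ∈ g)
    (hproper : ∃ A : V →ₗ[ℝ] V, IsSkew A ∧ A ∉ g)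
    (hirr : ∀ W : Submodule ℝ V, (∀ A ∈ g, ∀ x ∈ W, A x ∈ W) → W = ⊥ ∨ W = ⊤)
    (hn : 4 < Module.finrank ℝ V)
    -- `α` is an orthonormal basis of `g ⊆ Λ²V`, defining `T^g = Σₖ αₖ ∧ αₖ`
    (N : ℕ) (α : Fin N → (V →ₗ[ℝ] V))
    (hα : ∀ k, α k ∈ g)
    (hon : ∀ k l, formInner (⇑(α k)) (⇑(α l)) = if k = l then 1 else 0)
    (hspan : ∀ A ∈ g, A ∈ Submodule.span ℝ (Set.range α))
    (F : V →ₗ[ℝ] V) (hF : IsSkew F)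
    -- `[F, g^⊥] ⊆ g`
    (hFbr : ∀ G : V →ₗ[ℝ] V, IsSkew G → (∀ A ∈ g, formInner (⇑G) (⇑A) = 0) →
      F ∘ₗ G - G ∘ₗ F ∈ g)
    -- `L*_F T^g = 0`
    (hLF : ∀ X Y : V,
      (∑ i, ∑ j ∈ Finset.Ioi i,
        ⟪F (stdOrthonormalBasis ℝ V i), stdOrthonormalBasis ℝ V j⟫ *
          (∑ k, wedgeSelf (α k) (stdOrthonormalBasis ℝ V i)
            (stdOrthonormalBasis ℝ V j) X Y)) = 0) :
    -- then `F ∈ g^⊥`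
    ∀ A ∈ g, formInner (⇑F) (⇑A) = 0 := by
  have mulc : ∀ X Y : Module.End ℝ V, tr (X * Y) = tr (Y * X) := LinearMap.trace_mul_comm ℝ
  have hsk : ∀ k, IsSkew (α k) := fun k => hgskew _ (hα k)
  have hon' : ∀ k l, tr ((α k : Module.End ℝ V) * α l) = if k = l then -2 else 0 := by
    intro k l
    have := hon k l
    rw [formInner_eq (hsk k) (hsk l)] at this
    split_ifs at this ⊢ <;> linarith
  have hPg : ∀ X, PP_s15 α X ∈ g := fun X => by
    rw [PP_apply]; exact g.sum_mem fun k _ => g.smul_mem _ (hα k)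
  have hPA : ∀ A ∈ g, PP_s15 α A = A := fun A hA => PP_span α hon' (hspan A hA)
  -- anything orthogonal to the basis is orthogonal to g
  have horth : ∀ X : Module.End ℝ V, (∀ k, tr (X * α k) = 0) → ∀ A ∈ g, tr (X * A) = 0 := by
    intro X hX A hA
    rw [← hPA A hA, PP_apply, Finset.mul_sum, map_sum]
    refine Finset.sum_eq_zero fun k _ => ?_
    simp [hX k]
  have hsub : ∀ X Y : Module.End ℝ V, IsSkew X → IsSkew Y → IsSkew (X - Y) := by
    intro X Y hX hY x y
    simp only [LinearMap.sub_apply, inner_sub_left, inner_sub_right]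
    rw [hX, hY]; ring
  -- Casimir
  set C : Module.End ℝ V := ∑ k, (α k : Module.End ℝ V) * α k with hCdef
  have hCsym : C.IsSymmetric := by
    intro x y
    simp only [hCdef, LinearMap.sum_apply, sum_inner, inner_sum, Module.End.mul_apply]
    refine Finset.sum_congr rfl fun k _ => ?_
    rw [hsk k, hsk k, neg_neg]
  have hCcom : ∀ A ∈ g, C * (A : Module.End ℝ V) = A * C := by
    intro A hA
    have hbr : ∀ k, (A : Module.End ℝ V) * α k - α k * A =
        ∑ l, (-(1/2) * tr (((A : Module.End ℝ V) * α k - α k * A) * α l)) • α l := by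
      intro k
      rw [← PP_apply]
      exact (hPA _ (hglie A hA _ (hα k))).symm
    have hanti : ∀ k l, tr (((A : Module.End ℝ V) * α k - α k * A) * α l) =
        - tr (((A : Module.End ℝ V) * α l - α l * A) * α k) := by
      intro k l
      simp only [sub_mul, map_sub]
      rw [mulc (A * α l) (α k), mulc (α l * A) (α k), ← mul_assoc, ← mul_assoc,
        mulc (α k * α l) A, ← mul_assoc]
      ring
    have e : (A : Module.End ℝ V) * C - C * A = ∑ k, (((A : Module.End ℝ V) * α k - α k * A) * α k
        + α k * ((A : Module.End ℝ V) * α k - α k * A)) := by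
      rw [hCdef, Finset.mul_sum, Finset.sum_mul, ← Finset.sum_sub_distrib]
      refine Finset.sum_congr rfl fun k _ => ?_
      noncomm_ring
    have e0 : (A : Module.End ℝ V) * C - C * A = 0 := by
      rw [e, Finset.sum_add_distrib]
      have s1 : ∑ k, ((A : Module.End ℝ V) * α k - α k * A) * α k = ∑ k, ∑ l,
          (-(1/2) * tr (((A : Module.End ℝ V) * α k - α k * A) * α l)) • ((α l : Module.End ℝ V) * α k) := by
        refine Finset.sum_congr rfl fun k _ => ?_
        conv_lhs => rw [hbr k]
        rw [Finset.sum_mul]; simp only [smul_mul_assoc]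
      have s2 : ∑ k, (α k : Module.End ℝ V) * ((A : Module.End ℝ V) * α k - α k * A) = ∑ k, ∑ l,
          (-(1/2) * tr (((A : Module.End ℝ V) * α k - α k * A) * α l)) • ((α k : Module.End ℝ V) * α l) := by
        refine Finset.sum_congr rfl fun k _ => ?_
        conv_lhs => rw [hbr k]
        rw [Finset.mul_sum]; simp only [mul_smul_comm]
      rw [s1, s2, Finset.sum_comm, ← Finset.sum_add_distrib]
      refine Finset.sum_eq_zero fun k _ => ?_
      rw [← Finset.sum_add_distrib]
      refine Finset.sum_eq_zero fun l _ => ?_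
      rw [hanti l k]
      module
    exact (sub_eq_zero.mp e0).symm
  obtain ⟨c, hc⟩ := scalar_of_irr g hirr hn C hCsym (fun A hA x => by
    have := LinearMap.congr_fun (hCcom A hA) x
    simpa using this)
  set n : ℝ := (Module.finrank ℝ V : ℝ) with hndef
  have hnpos : (4 : ℝ) < n := by rw [hndef]; exact_mod_cast hn
  -- c ≠ -(n-1)
  have hcne : c ≠ -(n - 1) := by
    intro hcc
    have hs := sum_perp α hsk hon' ((LinearMap.mul ℝ (Module.End ℝ V)).compr₂ tr)
    simp only [LinearMap.compr₂_apply, LinearMap.mul_apply'] at hs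
    have t1 : ∑ i, ∑ j, tr (EE i j * EE (V := V) i j) = -2 * (n - 1) * n := by
      have := congrArg (tr) (sum_EE_EE (V := V))
      simpa only [map_sum, map_smul, LinearMap.trace_one, smul_eq_mul] using this
    have t2 : ∑ k, tr ((α k : Module.End ℝ V) * α k) = c * n := by
      have := congrArg (tr) (hCdef.symm.trans hc)
      simpa only [map_sum, map_smul, LinearMap.trace_one, smul_eq_mul] using this
    rw [t1, t2, hcc] at hs
    have hs0 : ∑ i, ∑ j, -tr ((EE i j - PP_s15 α (EE (V := V) i j)) * (EE i j - PP_s15 α (EE i j))) = 0 := by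
      simp only [Finset.sum_neg_distrib, hs]; ring
    have hskE : ∀ i j, IsSkew (EE i j - PP_s15 α (EE (V := V) i j)) := fun i j =>
      hsub _ _ (EE_skew i j) (hgskew _ (hPg _))
    have hnn : ∀ i j, 0 ≤ -tr ((EE i j - PP_s15 α (EE (V := V) i j)) * (EE i j - PP_s15 α (EE i j))) :=
      fun i j => neg_nonneg.mpr (skew_tr_sq (hskE i j))
    rw [Finset.sum_eq_zero_iff_of_nonneg (fun i _ => Finset.sum_nonneg fun j _ => hnn i j)] at hs0
    obtain ⟨A, hA, hAg⟩ := hproper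
    apply hAg
    have hE : ∀ i j, EE (V := V) i j ∈ g := by
      intro i j
      have h1 := hs0 i (Finset.mem_univ _)
      rw [Finset.sum_eq_zero_iff_of_nonneg (fun j _ => hnn i j)] at h1
      have h2 := skew_tr_sq_zero (hskE i j) (neg_eq_zero.mp (h1 j (Finset.mem_univ _)))
      rw [sub_eq_zero.mp h2]; exact hPg _
    have h4 := sum_tr_EE hA
    have : A = (-(1/4) : ℝ) • ∑ i, ∑ j, tr (EE i j * A) • EE (V := V) i j := by
      rw [h4, smul_smul]; norm_num
    rw [this]
    exact g.smul_mem _ (g.sum_mem fun i _ => g.sum_mem fun j _ => g.smul_mem _ (hE i j))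
  -- the 4-form hypothesis
  have hL : ∑ k, (α k : Module.End ℝ V) * F * α k = - PP_s15 α F := by
    have hwk : ∀ k X Y, ∑ i, ∑ j ∈ Finset.Ioi i,
        ⟪F (bs i), bs j⟫ * wedgeSelf (α k) (bs i) (bs j) X Y =
        - tr (F * α k) * ⟪α k X, Y⟫ + 2 * ⟪α k (F (α k X)), Y⟫ := by
      intro k X Y
      have q : ∀ Z W : V, ∑ i, ∑ j, ⟪F (bs i), bs j⟫ * (⟪α k (bs i), Z⟫ * ⟪α k (bs j), W⟫) =
          - ⟪α k (F (α k Z)), W⟫ := by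
        intro Z W
        have s1 : ∀ i, ∑ j, ⟪F (bs i), bs j⟫ * (⟪α k (bs i), Z⟫ * ⟪α k (bs j), W⟫) =
            ⟪bs i, α k Z⟫ * ⟪F (bs i), α k W⟫ := by
          intro i
          rw [← OrthonormalBasis.sum_inner_mul_inner bs (F (bs i)), Finset.mul_sum]
          refine Finset.sum_congr rfl fun j _ => ?_
          rw [hsk k (bs i), hsk k (bs j)]; ring
        simp_rw [s1]
        have s2 := sum_rk id F (α k Z)
        have s3 := congrArg (fun v => ⟪v, α k W⟫) s2
        simp only [sum_inner, real_inner_smul_left] at s3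
        rw [s3, hsk k (F (α k Z)), neg_neg]
      rw [sum_Ioi]
      · have q1 := q X Y
        have q2 := q Y X
        have q3 := tr_mul_skew hF (α k)
        have e4 : ⟪α k (F (α k Y)), X⟫ = - ⟪α k (F (α k X)), Y⟫ := by
          rw [hsk k, hF, hsk k, real_inner_comm]; ring
        have : ∀ i j, ⟪F (bs i), bs j⟫ * wedgeSelf (α k) (bs i) (bs j) X Y =
          2 * ⟪α k X, Y⟫ * (⟪F (bs i), bs j⟫ * ⟪α k (bs i), bs j⟫)
          - 2 * (⟪F (bs i), bs j⟫ * (⟪α k (bs i), X⟫ * ⟪α k (bs j), Y⟫))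
          + 2 * (⟪F (bs i), bs j⟫ * (⟪α k (bs i), Y⟫ * ⟪α k (bs j), X⟫)) := by
          intro i j; rw [wedgeSelf]; ring
        simp only [this, Finset.sum_add_distrib, Finset.sum_sub_distrib, ← Finset.mul_sum]
        rw [q1, q2, q3, e4]; ring
      · intro i j
        rw [skew_swap hF, wedgeSelf, wedgeSelf, skew_swap (hsk k) (bs i) (bs j)]; ring
      · intro i; simp [skew_self hF]
    refine LinearMap.ext fun X => ext_inner_right ℝ fun Y => ?_
    have h0 := hLF X Y
    have h1 : ∑ k, (∑ i, ∑ j ∈ Finset.Ioi i,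
        ⟪F (bs i), bs j⟫ * wedgeSelf (α k) (bs i) (bs j) X Y) = 0 := by
      rw [← h0, Finset.sum_comm]
      refine Finset.sum_congr rfl fun i _ => ?_
      rw [Finset.sum_comm]
      refine Finset.sum_congr rfl fun j _ => ?_
      rw [Finset.mul_sum]
    simp only [hwk, Finset.sum_add_distrib, ← Finset.mul_sum] at h1
    simp only [PP_apply, LinearMap.sum_apply, LinearMap.neg_apply, LinearMap.smul_apply,
      inner_neg_left, sum_inner, real_inner_smul_left, Module.End.mul_apply]
    simp only [neg_mul, Finset.sum_neg_distrib, mul_assoc, ← Finset.mul_sum] at h1 ⊢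
    linarith
  intro A hA
  have hAs := hgskew A hA
  rw [formInner_eq hF hAs]
  suffices h : tr ((F : Module.End ℝ V) * A) = 0 by rw [h]; ring
  -- main computation
  let ad : Module.End ℝ V → Module.End ℝ V →ₗ[ℝ] Module.End ℝ V := fun X =>
    LinearMap.mulLeft ℝ X - LinearMap.mulRight ℝ X
  have had : ∀ X Y, ad X Y = X * Y - Y * X := fun X Y => by simp [ad]
  have hs := sum_perp α hsk hon'
    (((LinearMap.mul ℝ (Module.End ℝ V)).compr₂ tr).compl₁₂ (ad F) (ad A))
  simp only [LinearMap.compl₁₂_apply, LinearMap.compr₂_apply, LinearMap.mul_apply', had] at hs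
  have hz : ∀ i j, tr ((F * (EE i j - PP_s15 α (EE (V := V) i j)) - (EE i j - PP_s15 α (EE i j)) * F) *
      (A * (EE i j - PP_s15 α (EE i j)) - (EE i j - PP_s15 α (EE i j)) * A)) = 0 := by
    intro i j
    have ho := horth _ (PP_orth α hon' (EE (V := V) i j))
    have hGs : IsSkew (EE i j - PP_s15 α (EE (V := V) i j)) :=
      hsub _ _ (EE_skew i j) (hgskew _ (hPg _))
    generalize EE i j - PP_s15 α (EE (V := V) i j) = G at ho hGs
    have hFG : (F : Module.End ℝ V) * G - G * F ∈ g := hFbr G hGs (fun B hB => by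
      rw [formInner_eq hGs (hgskew B hB), ho B hB]; ring)
    generalize (F : Module.End ℝ V) * G - G * F = B at hFG
    have := ho _ (hglie B hFG A hA)
    rw [← Module.End.mul_eq_comp, ← Module.End.mul_eq_comp, mul_sub, map_sub] at this
    rw [mul_sub, map_sub, ← mul_assoc, ← mul_assoc, mulc (B * A) G, mulc (B * G) A,
      mulc A (B * G), mulc (B * G) A, ← mul_assoc A B G, mulc (A * B) G]
    exact this
  have hex : ∀ X : Module.End ℝ V, tr ((F * X - X * F) * (A * X - X * A)) =
      2 * tr ((X * F * X) * A) - tr (F * A * (X * X)) - tr (A * F * (X * X)) := by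
    intro X
    have e : (F * X - X * F) * (A * X - X * A) =
      (F * X) * (A * X) - F * X * X * A - X * (F * A * X) + (X * F * X) * A := by noncomm_ring
    rw [e, map_add, map_sub, map_sub, mulc X, mulc (F * X * X) A, mulc (F * X) (A * X),
      mulc (X * F * X) A]
    have : A * X * (F * X) = A * (X * F * X) := by noncomm_ring
    rw [this]
    have : F * A * X * X = F * A * (X * X) := by noncomm_ring
    rw [this]
    have : A * (F * X * X) = A * F * (X * X) := by noncomm_ring
    rw [this]
    ring
  simp only [hz, Finset.sum_const_zero, hex, Finset.sum_sub_distrib, ← Finset.mul_sum,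
    ← map_sum, ← Finset.sum_mul] at hs
  rw [sum_EE_mul_EE hF, sum_EE_EE, hL, ← hCdef, hc] at hs
  have hPF : tr (PP_s15 α F * A) = tr ((F : Module.End ℝ V) * A) := by
    have := horth _ (PP_orth α hon' F) A hA
    rw [sub_mul, map_sub] at this; linarith
  simp only [smul_mul_assoc, mul_smul_comm, mul_one, map_smul, smul_eq_mul, neg_mul, map_neg,
    hPF, mulc A F] at hs
  rw [← hndef] at hs
  have hfin : (c + (n - 1)) * tr ((F : Module.End ℝ V) * A) = 0 := by linarith
  rcases mul_eq_zero.mp hfin with h | h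
  · exact absurd (by linarith) hcne
  · exact h
end
end
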